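/- Let ω < 1 and fix μ ∈ (0, π/2) with ω < μ/tan(μ). Let Ω^S = ℝ × (−1, 0). Suppose f₁ is bounded and locally Hölder continuous on the closure of Ω^S with |f₁(x)| ≤ e^{−μ|x₁|}, and f₂ is C¹ on ℝ with |f₂(x₁)| ≤ e^{−μ|x₁|}. Then there exist a constant C = C(ω, μ) and a function φ, C² in Ω^S and C¹ up to the closure, such that −Δφ = f₁ in Ω^S, ∂φ/∂x₂(x₁, 0) − ω φ(x₁, 0) = f₂(x₁) for all x₁ ∈ ℝ, φ(x₁, −1) = 0 for all x₁ ∈ ℝ, and |φ(x)| ≤ C e^{−μ|x₁|} on Ω^S. -/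

import Mathlib

open Complex Metric Set

/-- Second partial derivatives Laplacian for functions on `ℂ ≃ ℝ²`. -/
noncomputable def lap (f : ℂ → ℝ) (z : ℂ) : ℝ :=
  fderiv ℝ (fun w => fderiv ℝ f w 1) z 1 +
    fderiv ℝ (fun w => fderiv ℝ f w Complex.I) z Complex.I

/-- The strip `Ω^S = ℝ × (−1, 0)`. -/
def OmegaS : Set ℂ := {z : ℂ | -1 < z.im ∧ z.im < 0}

namespace FlatStrip

section Kernel

lemma hasDerivAt_posPart_pow (n : ℕ) (x : ℝ) :
    HasDerivAt (fun x : ℝ => (max 0 x) ^ (n + 2)) ((n + 2) * (max 0 x) ^ (n + 1)) x := by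
  rcases lt_trichotomy x 0 with h | rfl | h
  · have : (fun x : ℝ => (max 0 x) ^ (n + 2)) =ᶠ[nhds x] fun _ => 0 := by
      filter_upwards [Iio_mem_nhds h] with y hy
      simp [max_eq_left (show y ≤ 0 from le_of_lt hy)]
    rw [max_eq_left h.le]
    simpa using (hasDerivAt_const x (0 : ℝ)).congr_of_eventuallyEq this
  · rw [hasDerivAt_iff_isLittleO]
    have h1 : (fun x : ℝ => x ^ 2) =o[nhds 0] fun x => x := by
      simpa using Asymptotics.isLittleO_pow_pow (𝕜 := ℝ) (m := 1) (n := 2) (by norm_num)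
    have h2 : (fun x : ℝ => (max 0 x) ^ (n + 2)) =O[nhds 0] fun x : ℝ => x ^ 2 := by
      apply Asymptotics.IsBigO.of_bound 1
      filter_upwards [Metric.ball_mem_nhds (0 : ℝ) one_pos] with y hy
      have hy' : |y| < 1 := by simpa using hy
      have hm : max 0 y ≤ |y| := max_le (abs_nonneg _) (le_abs_self _)
      have hm0 : 0 ≤ max 0 y := le_max_left _ _
      rw [Real.norm_of_nonneg (by positivity), Real.norm_of_nonneg (by positivity), one_mul,
        ← sq_abs y]
      calc (max 0 y) ^ (n + 2) ≤ (max 0 y) ^ 2 :=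
            pow_le_pow_of_le_one hm0 (hm.trans hy'.le) (by omega)
        _ ≤ |y| ^ 2 := by gcongr
    simpa using h2.trans_isLittleO h1
  · have : (fun x : ℝ => (max 0 x) ^ (n + 2)) =ᶠ[nhds x] fun x => x ^ (n + 2) := by
      filter_upwards [Ioi_mem_nhds h] with y hy
      rw [max_eq_right (le_of_lt hy)]
    rw [max_eq_right h.le]
    refine ((hasDerivAt_pow (n + 2) x).congr_of_eventuallyEq this).congr_deriv ?_
    push_cast; rfl

lemma contDiff_posPart_pow (n : ℕ) : ContDiff ℝ n (fun x : ℝ => (max 0 x) ^ (n + 1)) := by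
  induction n with
  | zero => simpa using (continuous_const.max continuous_id : Continuous fun x : ℝ => max 0 x)
  | succ n ih =>
    push_cast
    rw [contDiff_succ_iff_deriv]
    refine ⟨fun x => (hasDerivAt_posPart_pow n x).differentiableAt, by simp, ?_⟩
    have : deriv (fun x : ℝ => (max 0 x) ^ (n + 2)) = fun x => ((n : ℝ) + 2) * (max 0 x) ^ (n + 1) :=
      funext fun x => (hasDerivAt_posPart_pow n x).deriv
    rw [this]
    exact contDiff_const.mul ih

/-- The radial profile `(1/4 - |u|²)₊ⁿ`. -/
noncomputable def bump (n : ℕ) (u : ℂ) : ℝ := (max 0 (1 / 4 - ‖u‖ ^ 2)) ^ n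

lemma bump_nonneg (n : ℕ) (u : ℂ) : 0 ≤ bump n u := pow_nonneg (le_max_left _ _) _

lemma bump_eq_zero {n : ℕ} (hn : n ≠ 0) {u : ℂ} (hu : 1 / 2 < ‖u‖) : bump n u = 0 := by
  have : 1 / 4 - ‖u‖ ^ 2 ≤ 0 := by nlinarith
  rw [bump, max_eq_left this, zero_pow hn]

lemma bump_anti (n : ℕ) {u v : ℂ} (h : ‖u‖ ≤ ‖v‖) : bump n v ≤ bump n u := by
  unfold bump; gcongr

lemma contDiff_bump (n : ℕ) : ContDiff ℝ n (bump (n + 1)) :=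
  (contDiff_posPart_pow n).comp (contDiff_const.sub (contDiff_norm_sq ℝ))

/-- The Euclidean inner product of `ℂ`. -/
noncomputable def ip : ℂ →L[ℝ] ℂ →L[ℝ] ℝ := reCLM.smulRight reCLM + imCLM.smulRight imCLM

@[simp] lemma ip_apply (u v : ℂ) : ip u v = u.re * v.re + u.im * v.im := by simp [ip]

lemma hasFDerivAt_bump (n : ℕ) (u : ℂ) :
    HasFDerivAt (bump (n + 2)) (-(2 * (n + 2) * bump (n + 1) u) • ip u) u := by
  have h1 : HasFDerivAt (fun u : ℂ => 1 / 4 - ‖u‖ ^ 2) (-((2 : ℝ) • ip u)) u := by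
    refine ((hasStrictFDerivAt_norm_sq (F := ℂ) u).hasFDerivAt.const_sub (1 / 4)).congr_fderiv ?_
    ext v; simp [Complex.inner]; ring
  refine ((hasDerivAt_posPart_pow n (1 / 4 - ‖u‖ ^ 2)).comp_hasFDerivAt u h1).congr_fderiv ?_
  rw [smul_neg, smul_smul, ← neg_smul]
  congr 1; simp only [bump]; ring

/-- The regularised logarithm is a superposition of dilates of `theta`. -/
noncomputable def theta : ℂ → ℝ := bump 4

/-- The radial weight with `∇ theta (u) = - rho (u) u`. -/
noncomputable def rho (u : ℂ) : ℝ := 8 * bump 3 u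

lemma fderiv_theta : fderiv ℝ theta = fun u => -(rho u) • ip u := by
  funext u
  rw [theta, (hasFDerivAt_bump 2 u).fderiv, rho]
  norm_num

lemma hasFDerivAt_rho (u : ℂ) : HasFDerivAt rho (-(48 * bump 2 u) • ip u) u := by
  refine ((hasFDerivAt_bump 1 u).const_mul 8).congr_fderiv ?_
  rw [smul_smul]
  congr 1
  push_cast; ring

lemma contDiff_theta : ContDiff ℝ 2 theta := (contDiff_bump 3).of_le (by norm_num)

lemma contDiff_rho : ContDiff ℝ 1 rho :=
  contDiff_const.mul ((contDiff_bump 2).of_le (by norm_num))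

lemma contDiff_fderiv_theta : ContDiff ℝ 1 (fderiv ℝ theta) :=
  contDiff_theta.fderiv_right (by norm_num)

lemma theta_nonneg (u : ℂ) : 0 ≤ theta u := bump_nonneg _ _

lemma rho_nonneg (u : ℂ) : 0 ≤ rho u := mul_nonneg (by norm_num) (bump_nonneg _ _)

lemma rho_anti {u v : ℂ} (h : ‖u‖ ≤ ‖v‖) : rho v ≤ rho u := by
  unfold rho; gcongr; exact bump_anti _ h

lemma theta_eq_of_norm_eq {u v : ℂ} (h : ‖u‖ = ‖v‖) : theta u = theta v := by
  simp [theta, bump, h]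

lemma rho_eq_of_norm_eq {u v : ℂ} (h : ‖u‖ = ‖v‖) : rho u = rho v := by
  simp [rho, bump, h]

/-- Kernels supported in the disc of radius `1/2`. -/
def SuppHalf {E : Type*} [Zero E] (Φ : ℂ → E) : Prop := ∀ u, 1 / 2 < ‖u‖ → Φ u = 0

lemma suppHalf_theta : SuppHalf theta := fun _ hu => bump_eq_zero (by norm_num) hu

lemma suppHalf_rho : SuppHalf rho := fun _ hu => by
  rw [rho, bump_eq_zero (by norm_num) hu, mul_zero]

lemma SuppHalf.fderiv {E : Type*} [NormedAddCommGroup E] [NormedSpace ℝ E] {Φ : ℂ → E}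
    (h : SuppHalf Φ) : SuppHalf (fderiv ℝ Φ) := fun u hu => by
  have : Φ =ᶠ[nhds u] fun _ => 0 := by
    filter_upwards [(isOpen_lt continuous_const continuous_norm).mem_nhds hu] with v hv
    exact h v hv
  rw [this.fderiv_eq]; simp

lemma SuppHalf.hasCompactSupport {E : Type*} [NormedAddCommGroup E] {Φ : ℂ → E}
    (h : SuppHalf Φ) : HasCompactSupport Φ :=
  HasCompactSupport.intro (isCompact_closedBall (0 : ℂ) (1 / 2)) fun u hu => h u (by
    simpa using hu)

lemma laplacian_theta (u : ℂ) :
    fderiv ℝ (fderiv ℝ theta) u 1 1 + fderiv ℝ (fderiv ℝ theta) u I I =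
      -2 * rho u - fderiv ℝ rho u u := by
  have h : HasFDerivAt (fun u : ℂ => -(rho u) • ip u)
      ((-(rho u)) • ip + (-(-(48 * bump 2 u) • ip u)).smulRight (ip u)) u :=
    (hasFDerivAt_rho u).neg.smul ip.hasFDerivAt
  rw [fderiv_theta, h.fderiv, (hasFDerivAt_rho u).fderiv]
  simp
  ring

end Kernel

open MeasureTheory Filter Topology ComplexConjugate

section Potential

variable {E : Type*} [NormedAddCommGroup E] [NormedSpace ℝ E]

/-- The integral of a dilated kernel `Φ` against the charge `f ν`. -/
noncomputable def avg (ν : Measure ℂ) (f : ℂ → ℝ) (Φ : ℂ → E) (t : ℝ) (z : ℂ) : E :=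
  ∫ w, f w • Φ (t⁻¹ • (z - w)) ∂ν

/-- The superposition over all scales `t ∈ (0, 1)` of the dilated averages, with weight `t⁻ᵏ`. -/
noncomputable def pot (ν : Measure ℂ) (f : ℂ → ℝ) (Φ : ℂ → E) (k : ℕ) (z : ℂ) : E :=
  ∫ t in (0 : ℝ)..1, (t ^ k)⁻¹ • avg ν f Φ t z

/-- The bound which makes `pot` converge absolutely and uniformly on `s`. -/
def Dom (ν : Measure ℂ) (f : ℂ → ℝ) (Φ : ℂ → E) (k : ℕ) (s : Set ℂ) : Prop :=
  ∃ K α : ℝ, 0 < α ∧ ∀ t ∈ Ioc (0 : ℝ) 1, ∀ z ∈ s, ‖avg ν f Φ t z‖ ≤ K * t ^ k * t ^ (α - 1)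

/-- Half-unit discs of radius `t / 2` have `ν`-mass at most `t ^ d`. -/
def Growth (ν : Measure ℂ) (d : ℕ) : Prop :=
  ∀ z : ℂ, ∀ t : ℝ, 0 < t → ν.real (closedBall z (t / 2)) ≤ t ^ d

variable {ν : Measure ℂ} {f g : ℂ → ℝ} {Φ : ℂ → E}

lemma SuppHalf.dilate (hs : SuppHalf Φ) {t : ℝ} (ht : 0 < t) {z w : ℂ} (h : t / 2 < ‖z - w‖) :
    Φ (t⁻¹ • (z - w)) = 0 := by
  apply hs
  rw [norm_smul, norm_inv, Real.norm_of_nonneg ht.le, inv_mul_eq_div, lt_div_iff₀ ht]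
  linarith

lemma SuppHalf.hasCompactSupport_dilate (hs : SuppHalf Φ) {t : ℝ} (ht : 0 < t) :
    HasCompactSupport (fun u : ℂ => Φ (t⁻¹ • u)) := by
  refine HasCompactSupport.intro (isCompact_closedBall (0 : ℂ) (t / 2)) fun u hu => ?_
  have := hs.dilate ht (z := u) (w := 0) (by simpa using hu)
  simpa using this

lemma avg_eq_convolution (t : ℝ) :
    avg ν f Φ t = convolution f (fun u : ℂ => Φ (t⁻¹ • u)) (ContinuousLinearMap.lsmul ℝ ℝ) ν := by
  funext z
  simp [avg, convolution]

lemma integrable_avg (hf : LocallyIntegrable f ν) (hΦ : Continuous Φ) (hs : SuppHalf Φ) {t : ℝ}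
    (ht : 0 < t) (z : ℂ) : Integrable (fun w => f w • Φ (t⁻¹ • (z - w))) ν := by
  have := (hs.hasCompactSupport_dilate ht).convolutionExists_right
    (ContinuousLinearMap.lsmul ℝ ℝ) hf (hΦ.comp (continuous_const_smul _)) z
  simpa [ConvolutionExistsAt] using this

lemma continuous_avg (hf : LocallyIntegrable f ν) (hΦ : Continuous Φ) (hs : SuppHalf Φ) {t : ℝ}
    (ht : 0 < t) : Continuous (avg ν f Φ t) := by
  rw [avg_eq_convolution]
  exact (hs.hasCompactSupport_dilate ht).continuous_convolution_right _ hf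
    (hΦ.comp (continuous_const_smul _))

lemma hasFDerivAt_integral_smul {V : Type*} [NormedAddCommGroup V] [NormedSpace ℝ V]
    (hf : LocallyIntegrable f ν) {κ : V → ℂ → E} {κ' : V → ℂ → V →L[ℝ] E} {x₀ : V} {s : Set V}
    {k : Set ℂ} (hs : s ∈ 𝓝 x₀) (hk : IsCompact k) (hκ : ∀ x ∈ s, Continuous (κ x))
    (hκ0 : ∀ w ∉ k, κ x₀ w = 0) (hκ' : Continuous (κ' x₀)) {C : ℝ}
    (hC : ∀ x ∈ s, ∀ w ∈ k, ‖κ' x w‖ ≤ C) (h0 : ∀ x ∈ s, ∀ w ∉ k, κ' x w = 0)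
    (hd : ∀ x ∈ s, ∀ w, HasFDerivAt (fun x => κ x w) (κ' x w) x) :
    HasFDerivAt (fun x => ∫ w, f w • κ x w ∂ν) (∫ w, f w • κ' x₀ w ∂ν) x₀ := by
  have hx₀ : x₀ ∈ s := mem_of_mem_nhds hs
  have hfk : IntegrableOn f k ν := hf.integrableOn_isCompact hk
  refine hasFDerivAt_integral_of_dominated_of_fderiv_le (𝕜 := ℝ)
    (F' := fun x w => f w • κ' x w) (bound := k.indicator fun w => ‖f w‖ * C) hs
    ?_ ?_ (hf.aestronglyMeasurable.smul hκ'.aestronglyMeasurable) ?_ ?_ ?_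
  · filter_upwards [hs] with x hx
    exact hf.aestronglyMeasurable.smul (hκ x hx).aestronglyMeasurable
  · have h1 : IntegrableOn (fun w => f w • κ x₀ w) k ν :=
      hfk.smul_continuousOn (hκ x₀ hx₀).continuousOn hk
    rw [← integrableOn_univ]
    refine h1.of_forall_sdiff_eq_zero MeasurableSet.univ fun w hw => ?_
    rw [hκ0 w hw.2, smul_zero]
  · refine Eventually.of_forall fun w x hx => ?_
    by_cases hw : w ∈ k
    · rw [indicator_of_mem hw, norm_smul]
      exact mul_le_mul_of_nonneg_left (hC x hx w hw) (norm_nonneg _)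
    · rw [indicator_of_notMem hw, h0 x hx w hw, smul_zero, norm_zero]
  · exact (integrable_indicator_iff hk.measurableSet).2 (hfk.norm.mul_const C)
  · exact Eventually.of_forall fun w x hx => (hd x hx w).const_smul (f w)

lemma hasFDerivAt_avg (hf : LocallyIntegrable f ν) (hΦ : ContDiff ℝ 1 Φ) (hs : SuppHalf Φ) {t : ℝ}
    (ht : 0 < t) (z : ℂ) :
    HasFDerivAt (avg ν f Φ t) (t⁻¹ • avg ν f (fderiv ℝ Φ) t z) z := by
  have hΦ' : Continuous (fderiv ℝ Φ) := hΦ.continuous_fderiv (by norm_num)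
  obtain ⟨C, hC⟩ := hs.fderiv.hasCompactSupport.exists_bound_of_continuous hΦ'
  have key := hasFDerivAt_integral_smul (ν := ν) hf (κ := fun z w => Φ (t⁻¹ • (z - w)))
    (κ' := fun z w => t⁻¹ • fderiv ℝ Φ (t⁻¹ • (z - w))) (ball_mem_nhds z one_pos)
    (isCompact_closedBall z (1 + t / 2)) (fun x _ => by have := hΦ.continuous; fun_prop)
    (C := |t⁻¹| * C) (fun w hw => hs.dilate ht ?_) (by fun_prop) (fun x _ w _ => ?_)
    (fun x hx w hw => ?_) (fun x _ w => ?_)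
  · refine key.congr_fderiv ?_
    rw [avg, ← integral_smul]
    exact integral_congr_ae (Eventually.of_forall fun w => smul_comm _ _ _)
  · simp only [mem_closedBall, not_le, dist_eq_norm, norm_sub_rev w] at hw
    linarith
  · rw [norm_smul]
    exact mul_le_mul_of_nonneg_left (hC _) (norm_nonneg _)
  · rw [hs.fderiv.dilate ht, smul_zero]
    simp only [mem_closedBall, not_le, dist_eq_norm, norm_sub_rev w] at hw
    simp only [mem_ball, dist_eq_norm] at hx
    have := norm_sub_le_norm_sub_add_norm_sub z x w
    rw [norm_sub_rev z x] at this
    linarith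
  · have h1 : HasFDerivAt (fun x : ℂ => t⁻¹ • (x - w)) (t⁻¹ • ContinuousLinearMap.id ℝ ℂ) x :=
      ((hasFDerivAt_id (𝕜 := ℝ) x).sub_const w).const_smul t⁻¹
    refine (((hΦ.differentiable (by norm_num)) _).hasFDerivAt.comp x h1).congr_fderiv ?_
    ext v; simp

lemma norm_avg_le [IsFiniteMeasureOnCompacts ν] {d : ℕ} (hν : Growth ν d) (hs : SuppHalf Φ)
    {C M : ℝ} (hC : ∀ u, ‖Φ u‖ ≤ C) {t : ℝ} (ht : 0 < t) {z : ℂ}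
    (hM : ∀ w, ‖z - w‖ ≤ t / 2 → |f w| ≤ M) : ‖avg ν f Φ t z‖ ≤ M * C * t ^ d := by
  have hM0 : 0 ≤ M := (abs_nonneg _).trans (hM z (by simp; positivity))
  have hC0 : 0 ≤ C := (norm_nonneg _).trans (hC 0)
  have h1 : avg ν f Φ t z = ∫ w in closedBall z (t / 2), f w • Φ (t⁻¹ • (z - w)) ∂ν := by
    symm
    apply setIntegral_eq_integral_of_forall_compl_eq_zero
    intro w hw
    rw [hs.dilate ht, smul_zero]
    simpa [dist_eq_norm, norm_sub_rev] using hw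
  rw [h1]
  refine (norm_setIntegral_le_of_norm_le_const (C := M * C)
    (isCompact_closedBall z (t / 2)).measure_lt_top ?_).trans ?_
  · intro w hw
    rw [norm_smul]
    exact mul_le_mul (hM w (by simpa [dist_eq_norm, norm_sub_rev] using hw)) (hC _)
      (norm_nonneg _) hM0
  · exact mul_le_mul_of_nonneg_left (hν z t ht) (by positivity)

lemma avg_add (hf : LocallyIntegrable f ν) (hg : LocallyIntegrable g ν) (hΦ : Continuous Φ)
    (hs : SuppHalf Φ) {t : ℝ} (ht : 0 < t) (z : ℂ) :
    avg ν (fun w => f w + g w) Φ t z = avg ν f Φ t z + avg ν g Φ t z := by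
  simp only [avg, add_smul]
  exact integral_add (integrable_avg hf hΦ hs ht z) (integrable_avg hg hΦ hs ht z)

lemma avg_const_mul (a : ℝ) (t : ℝ) (z : ℂ) :
    avg ν (fun w => a * f w) Φ t z = a • avg ν f Φ t z := by
  simp only [avg, mul_smul, integral_smul]

lemma stronglyMeasurable_avg [SFinite ν] (hf : Measurable f) (hΦ : Continuous Φ)  (z : ℂ) :
    StronglyMeasurable (fun t => avg ν f Φ t z) := by
  unfold avg
  refine StronglyMeasurable.integral_prod_right' (f := fun p : ℝ × ℂ => f p.2 • Φ (p.1⁻¹ • (z - p.2))) ?_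
  refine (hf.comp measurable_snd).stronglyMeasurable.smul ?_
  exact hΦ.comp_stronglyMeasurable (by fun_prop : Measurable _).stronglyMeasurable

lemma aestronglyMeasurable_pot [SFinite ν] (hf : Measurable f) (hΦ : Continuous Φ) (k : ℕ) (z : ℂ)
    (μ : Measure ℝ) : AEStronglyMeasurable (fun t : ℝ => (t ^ k)⁻¹ • avg ν f Φ t z) μ :=
  ((by fun_prop : Measurable fun t : ℝ => (t ^ k)⁻¹).stronglyMeasurable.smul
    (stronglyMeasurable_avg hf hΦ z)).aestronglyMeasurable

lemma Dom.bound {k : ℕ} {s : Set ℂ} (h : Dom ν f Φ k s) :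
    ∃ b : ℝ → ℝ, IntervalIntegrable b volume 0 1 ∧
      ∀ t ∈ Ioc (0 : ℝ) 1, ∀ z ∈ s, ‖(t ^ k)⁻¹ • avg ν f Φ t z‖ ≤ b t := by
  obtain ⟨K, α, hα, h⟩ := h
  refine ⟨fun t => K * t ^ (α - 1),
    (intervalIntegral.intervalIntegrable_rpow' (by linarith)).const_mul K, fun t ht z hz => ?_⟩
  have ht0 : 0 < t ^ k := pow_pos ht.1 k
  rw [norm_smul, norm_inv, Real.norm_of_nonneg ht0.le, inv_mul_le_iff₀ ht0]
  exact (h t ht z hz).trans (le_of_eq (by ring))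

lemma Dom.mono {k : ℕ} {s s' : Set ℂ} (h : Dom ν f Φ k s) (hs : s' ⊆ s) : Dom ν f Φ k s' := by
  obtain ⟨K, α, hα, h⟩ := h
  exact ⟨K, α, hα, fun t ht z hz => h t ht z (hs hz)⟩

lemma Dom.intervalIntegrable [SFinite ν] {k : ℕ} {s : Set ℂ} (h : Dom ν f Φ k s)
    (hf : Measurable f) (hΦ : Continuous Φ) {z : ℂ} (hz : z ∈ s) :
    IntervalIntegrable (fun t : ℝ => (t ^ k)⁻¹ • avg ν f Φ t z) volume 0 1 := by
  obtain ⟨b, hb, h⟩ := h.bound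
  refine hb.mono_fun (aestronglyMeasurable_pot hf hΦ k z _) ?_
  rw [uIoc_of_le zero_le_one]
  filter_upwards [ae_restrict_mem measurableSet_Ioc] with t ht
  exact (h t ht z hz).trans (le_abs_self _)

lemma continuousOn_pot [SFinite ν] {k : ℕ} {s : Set ℂ} (h : Dom ν f Φ k s)
    (hfm : Measurable f) (hf : LocallyIntegrable f ν) (hΦ : Continuous Φ) (hs : SuppHalf Φ) :
    ContinuousOn (pot ν f Φ k) s := by
  obtain ⟨b, hb, h⟩ := h.bound
  intro z hz
  refine intervalIntegral.continuousWithinAt_of_dominated_interval (bound := b)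
    (Eventually.of_forall fun z => aestronglyMeasurable_pot hfm hΦ k z _) ?_ hb ?_
  · filter_upwards [self_mem_nhdsWithin] with z hz
    rw [uIoc_of_le zero_le_one]
    exact Eventually.of_forall fun t ht => h t ht z hz
  · rw [uIoc_of_le zero_le_one]
    refine Eventually.of_forall fun t ht => ?_
    exact ((continuous_avg hf hΦ hs ht.1).const_smul _).continuousWithinAt

lemma hasFDerivAt_pot [SFinite ν] {k : ℕ} {s : Set ℂ} (hso : IsOpen s) (h : Dom ν f Φ k s)
    (h' : Dom ν f (fderiv ℝ Φ) (k + 1) s)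
    (hfm : Measurable f) (hf : LocallyIntegrable f ν) (hΦ : ContDiff ℝ 1 Φ) (hs : SuppHalf Φ)
    {z : ℂ} (hz : z ∈ s) :
    HasFDerivAt (pot ν f Φ k) (pot ν f (fderiv ℝ Φ) (k + 1) z) z := by
  obtain ⟨b, hb, hb'⟩ := h'.bound
  have hΦ' : Continuous (fderiv ℝ Φ) := hΦ.continuous_fderiv (by norm_num)
  refine intervalIntegral.hasFDerivAt_integral_of_dominated_of_fderiv_le (bound := b)
    (𝕜 := ℝ) (F' := fun z t => (t ^ (k + 1))⁻¹ • avg ν f (fderiv ℝ Φ) t z) (hso.mem_nhds hz)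
    (Eventually.of_forall fun z => aestronglyMeasurable_pot hfm hΦ.continuous k z _)
    (h.intervalIntegrable hfm hΦ.continuous hz) (aestronglyMeasurable_pot hfm hΦ' (k + 1) z _)
    ?_ hb ?_
  · rw [uIoc_of_le zero_le_one]
    exact Eventually.of_forall fun t ht z hz => hb' t ht z hz
  · rw [uIoc_of_le zero_le_one]
    refine Eventually.of_forall fun t ht z hz => ?_
    have := (hasFDerivAt_avg hf hΦ hs ht.1 z).const_smul ((t ^ k)⁻¹)
    rwa [smul_smul, ← mul_inv, ← pow_succ] at this

lemma avg_apply {F : Type*} [NormedAddCommGroup F] [NormedSpace ℝ F]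
    [CompleteSpace F] [CompleteSpace E] {Φ : ℂ → E} (L : E →L[ℝ] F)
    (hf : LocallyIntegrable f ν) (hΦ : Continuous Φ) (hs : SuppHalf Φ) {t : ℝ} (ht : 0 < t)
    (z : ℂ) : L (avg ν f Φ t z) = avg ν f (fun u => L (Φ u)) t z := by
  rw [avg, ← L.integral_comp_comm (integrable_avg hf hΦ hs ht z), avg]
  simp

lemma Dom.intervalIntegrable_apply [SFinite ν] {F : Type*} [NormedAddCommGroup F]
    [NormedSpace ℝ F] [CompleteSpace F] [CompleteSpace E]
    {k : ℕ} {s : Set ℂ} {Φ : ℂ → E} (L : E →L[ℝ] F)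
    (h : Dom ν f Φ k s) (hfm : Measurable f)
    (hf : LocallyIntegrable f ν) (hΦ : Continuous Φ) (hs : SuppHalf Φ) {z : ℂ} (hz : z ∈ s) :
    IntervalIntegrable (fun t : ℝ => (t ^ k)⁻¹ • avg ν f (fun u => L (Φ u)) t z) volume 0 1 := by
  have i1 := h.intervalIntegrable hfm hΦ hz
  have i2 : IntervalIntegrable (fun t : ℝ => L ((t ^ k)⁻¹ • avg ν f Φ t z)) volume 0 1 :=
    ⟨L.integrable_comp i1.1, L.integrable_comp i1.2⟩
  refine i2.congr ?_
  rw [uIoc_of_le zero_le_one]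
  intro t ht
  simp only [map_smul, avg_apply L hf hΦ hs ht.1 z]

lemma pot_apply [SFinite ν] {F : Type*} [NormedAddCommGroup F] [NormedSpace ℝ F]
    [CompleteSpace F] [CompleteSpace E]
    {k : ℕ} {s : Set ℂ} {Φ : ℂ → E} (L : E →L[ℝ] F)
    (h : Dom ν f Φ k s) (hfm : Measurable f)
    (hf : LocallyIntegrable f ν) (hΦ : Continuous Φ) (hs : SuppHalf Φ) {z : ℂ} (hz : z ∈ s) :
    L (pot ν f Φ k z) = pot ν f (fun u => L (Φ u)) k z := by
  rw [pot, ← L.intervalIntegral_comp_comm (h.intervalIntegrable hfm hΦ hz), pot]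
  refine intervalIntegral.integral_congr_ae ?_
  rw [uIoc_of_le zero_le_one]
  refine Eventually.of_forall fun t ht => ?_
  simp only [map_smul, avg_apply L hf hΦ hs ht.1 z]

end Potential

section Scale

variable {E : Type*} [NormedAddCommGroup E] [NormedSpace ℝ E] {ν : Measure ℂ} {f : ℂ → ℝ}

lemma hasDerivAt_avg {Φ : ℂ → E} (hf : LocallyIntegrable f ν) (hΦ : ContDiff ℝ 1 Φ)
    (hs : SuppHalf Φ) {t : ℝ} (ht : 0 < t) (z : ℂ) :
    HasDerivAt (fun t => avg ν f Φ t z) (-(t⁻¹ • avg ν f (fun u => fderiv ℝ Φ u u) t z)) t := by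
  have hΦ' : Continuous (fderiv ℝ Φ) := hΦ.continuous_fderiv (by norm_num)
  have hc : Continuous fun u => fderiv ℝ Φ u u := hΦ'.clm_apply continuous_id
  have hs' : SuppHalf fun u => fderiv ℝ Φ u u := fun u hu => by
    simp only [hs.fderiv u hu, zero_apply]
  obtain ⟨C, hC⟩ := hs'.hasCompactSupport.exists_bound_of_continuous hc
  have hC0 : 0 ≤ C := (norm_nonneg _).trans (hC 0)
  have hpos : ∀ x ∈ Ioo (t / 2) (2 * t), 0 < x := fun x hx => by linarith [hx.1]
  have hout : ∀ x ∈ Ioo (t / 2) (2 * t), ∀ w ∉ closedBall z t, x / 2 < ‖z - w‖ := by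
    intro x hx w hw
    simp only [mem_closedBall, not_le, dist_eq_norm, norm_sub_rev w] at hw
    linarith [hx.2]
  have ht' : t ∈ Ioo (t / 2) (2 * t) := ⟨by linarith, by linarith⟩
  have key := hasFDerivAt_integral_smul (ν := ν) hf (κ := fun (x : ℝ) w => Φ (x⁻¹ • (z - w)))
    (κ' := fun x w => ContinuousLinearMap.toSpanSingleton ℝ
      (-(x⁻¹ • fderiv ℝ Φ (x⁻¹ • (z - w)) (x⁻¹ • (z - w)))))
    (isOpen_Ioo.mem_nhds ht')
    (isCompact_closedBall z t) (fun x _ => by have := hΦ.continuous; fun_prop)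
    (C := (t / 2)⁻¹ * C) (fun w hw => hs.dilate ht (hout t ht' w hw))
    ?_ (fun x hx w _ => ?_)
    (fun x hx w hw => ?_) (fun x hx w => ?_)
  · refine key.hasDerivAt.congr_deriv ?_
    have hi := integrable_avg hf hc hs' ht z
    have e1 : (fun w => f w • ContinuousLinearMap.toSpanSingleton ℝ
        (-(t⁻¹ • fderiv ℝ Φ (t⁻¹ • (z - w)) (t⁻¹ • (z - w))))) = fun w =>
        ContinuousLinearMap.toSpanSingletonCLE (𝕜 := ℝ) (E := E) 
          (f w • (-(t⁻¹ • fderiv ℝ Φ (t⁻¹ • (z - w)) (t⁻¹ • (z - w))))) := by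
      funext w; ext; simp
    rw [e1, ContinuousLinearEquiv.integral_comp_comm]
    have hT (y : E) : ContinuousLinearMap.toSpanSingletonCLE (𝕜 := ℝ) y 1 = y := by
      exact (ContinuousLinearMap.toSpanSingleton_apply ℝ y 1).trans (one_smul ℝ y)
    simp only [hT, smul_neg]
    rw [integral_neg, avg, ← integral_smul]
    congr 1
    exact integral_congr_ae (Eventually.of_forall fun w => smul_comm _ _ _)
  · have h2 : Continuous fun w : ℂ => -(t⁻¹ • fderiv ℝ Φ (t⁻¹ • (z - w)) (t⁻¹ • (z - w))) :=
      ((hc.comp (by fun_prop : Continuous fun w : ℂ => t⁻¹ • (z - w))).const_smul _).neg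
    exact (ContinuousLinearMap.toSpanSingletonCLE (𝕜 := ℝ) (E := E)).continuous.comp h2
  · rw [ContinuousLinearMap.norm_toSpanSingleton, norm_neg, norm_smul, norm_inv,
      Real.norm_of_nonneg (hpos x hx).le]
    exact mul_le_mul (inv_anti₀ (by linarith) hx.1.le) (hC _) (norm_nonneg _)
      (inv_nonneg.2 (by linarith))
  · rw [hs'.dilate (hpos x hx) (hout x hx w hw)]
    ext; simp
  · have hx0 := (hpos x hx).ne'
    have h1 : HasDerivAt (fun x : ℝ => x⁻¹ • (z - w)) ((-(x ^ 2)⁻¹) • (z - w)) x :=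
      (hasDerivAt_inv hx0).smul_const _
    have h2 := ((hΦ.differentiable (by norm_num)) (x⁻¹ • (z - w))).hasFDerivAt.comp_hasDerivAt x h1
    have h3 : fderiv ℝ Φ (x⁻¹ • (z - w)) ((-(x ^ 2)⁻¹) • (z - w)) =
        -(x⁻¹ • fderiv ℝ Φ (x⁻¹ • (z - w)) (x⁻¹ • (z - w))) := by
      simp only [map_smul, map_neg, smul_smul, neg_smul]
      rw [sq, mul_inv]
    rw [h3] at h2
    exact h2.hasFDerivAt

/-- The Laplacian of the profile `theta`. -/
noncomputable def lapTheta (u : ℂ) : ℝ := -2 * rho u - fderiv ℝ rho u u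

lemma hasDerivAt_avg_rho (hf : LocallyIntegrable f ν) {t : ℝ} (ht : 0 < t) (z : ℂ) :
    HasDerivAt (fun t => (t ^ 2)⁻¹ * avg ν f rho t z) ((t ^ 3)⁻¹ * avg ν f lapTheta t z) t := by
  have hc : Continuous fun u => fderiv ℝ rho u u :=
    (contDiff_rho.continuous_fderiv (by norm_num)).clm_apply continuous_id
  have hs' : SuppHalf fun u => fderiv ℝ rho u u := fun u hu => by
    simp only [suppHalf_rho.fderiv u hu, zero_apply]
  have h1 : HasDerivAt (fun t : ℝ => (t ^ 2)⁻¹) (-(2 * t) / (t ^ 2) ^ 2) t := by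
    simpa using (hasDerivAt_pow 2 t).fun_inv (by positivity)
  refine (h1.mul (hasDerivAt_avg hf contDiff_rho suppHalf_rho ht z)).congr_deriv ?_
  have h2 : avg ν f lapTheta t z =
      -2 * avg ν f rho t z - avg ν f (fun u => fderiv ℝ rho u u) t z := by
    have i1 := integrable_avg hf contDiff_rho.continuous suppHalf_rho ht z
    have i2 := integrable_avg hf hc hs' ht z
    simp only [avg]
    rw [← integral_const_mul, ← integral_sub (i1.const_mul _) i2]
    congr 1; funext w; simp [lapTheta]; ring
  rw [h2, smul_eq_mul]
  field_simp
  ring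

lemma lap_eq {φ : ℂ → ℝ} {φ' : ℂ → ℂ →L[ℝ] ℝ} {φ'' : ℂ →L[ℝ] ℂ →L[ℝ] ℝ} {z : ℂ} {s : Set ℂ}
    (hs : s ∈ 𝓝 z) (h : ∀ w ∈ s, HasFDerivAt φ (φ' w) w) (h' : HasFDerivAt φ' φ'' z) :
    lap φ z = φ'' 1 1 + φ'' I I := by
  have key : ∀ v : ℂ, fderiv ℝ (fun w => fderiv ℝ φ w v) z v = φ'' v v := by
    intro v
    have h1 : (fun w => fderiv ℝ φ w v) =ᶠ[𝓝 z] fun w => φ' w v := by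
      filter_upwards [hs] with w hw
      rw [(h w hw).fderiv]
    rw [h1.fderiv_eq, (h'.clm_apply (hasFDerivAt_const v z)).fderiv]
    simp
  rw [lap, key, key]

lemma contDiffOn_two_of_hasFDerivAt {φ : ℂ → ℝ} {φ' : ℂ → ℂ →L[ℝ] ℝ}
    {φ'' : ℂ → ℂ →L[ℝ] ℂ →L[ℝ] ℝ} {s : Set ℂ} (hs : IsOpen s)
    (h : ∀ w ∈ s, HasFDerivAt φ (φ' w) w) (h' : ∀ w ∈ s, HasFDerivAt φ' (φ'' w) w)
    (hc : ContinuousOn φ'' s) : ContDiffOn ℝ 2 φ s := by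
  have h1 : ContDiffOn ℝ 1 φ' s := by
    rw [show (1 : WithTop ℕ∞) = 0 + 1 by norm_num, contDiffOn_succ_iff_fderiv_of_isOpen hs]
    refine ⟨fun w hw => (h' w hw).differentiableAt.differentiableWithinAt, by simp, ?_⟩
    rw [contDiffOn_zero]
    exact hc.congr fun w hw => (h' w hw).fderiv
  rw [show (2 : WithTop ℕ∞) = 1 + 1 by norm_num, contDiffOn_succ_iff_fderiv_of_isOpen hs]
  exact ⟨fun w hw => (h w hw).differentiableAt.differentiableWithinAt, by simp,
    h1.congr fun w hw => (h w hw).fderiv⟩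

/-- The three absolute convergence bounds giving a `C²` potential. -/
def Dom₂ (ν : Measure ℂ) (f : ℂ → ℝ) (s : Set ℂ) : Prop :=
  Dom ν f theta 1 s ∧ Dom ν f (fderiv ℝ theta) 2 s ∧ Dom ν f (fderiv ℝ (fderiv ℝ theta)) 3 s

lemma contDiffOn_pot [SFinite ν] (hfm : Measurable f) (hf : LocallyIntegrable f ν) {s : Set ℂ}
    (hs : IsOpen s) (h : Dom₂ ν f s) : ContDiffOn ℝ 2 (pot ν f theta 1) s := by
  obtain ⟨h0, h1, h2⟩ := h
  exact contDiffOn_two_of_hasFDerivAt hs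
    (fun w hw => hasFDerivAt_pot hs h0 h1 hfm hf (contDiff_theta.of_le (by norm_num))
      suppHalf_theta hw)
    (fun w hw => hasFDerivAt_pot hs h1 h2 hfm hf contDiff_fderiv_theta suppHalf_theta.fderiv hw)
    (continuousOn_pot h2 hfm hf (contDiff_fderiv_theta.continuous_fderiv (by norm_num))
      suppHalf_theta.fderiv.fderiv)

lemma lap_pot [SFinite ν] (hfm : Measurable f) (hf : LocallyIntegrable f ν) {s : Set ℂ}
    (hs : IsOpen s) (h : Dom₂ ν f s) {z : ℂ} (hz : z ∈ s) {l : ℝ}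
    (hl : Tendsto (fun t => (t ^ 2)⁻¹ * avg ν f rho t z) (𝓝[>] 0) (𝓝 l)) :
    lap (pot ν f theta 1) z = avg ν f rho 1 z - l := by
  obtain ⟨h0, h1, h2⟩ := h
  have hc2 : Continuous (fderiv ℝ (fderiv ℝ theta)) :=
    contDiff_fderiv_theta.continuous_fderiv (by norm_num)
  rw [lap_eq (hs.mem_nhds hz)
    (fun w hw => hasFDerivAt_pot hs h0 h1 hfm hf (contDiff_theta.of_le (by norm_num))
      suppHalf_theta hw)
    (hasFDerivAt_pot hs h1 h2 hfm hf contDiff_fderiv_theta suppHalf_theta.fderiv hz)]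
  obtain ⟨L, hL⟩ : ∃ L : (ℂ →L[ℝ] ℂ →L[ℝ] ℝ) →L[ℝ] ℝ, ∀ A, L A = A 1 1 + A I I :=
    ⟨(ContinuousLinearMap.apply ℝ ℝ (1 : ℂ)).comp
        (ContinuousLinearMap.apply ℝ (ℂ →L[ℝ] ℝ) (1 : ℂ)) +
      (ContinuousLinearMap.apply ℝ ℝ I).comp (ContinuousLinearMap.apply ℝ (ℂ →L[ℝ] ℝ) I),
      fun A => by simp⟩
  have e1 := pot_apply L h2 hfm hf hc2 suppHalf_theta.fderiv.fderiv hz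
  rw [hL] at e1
  have e2 : (fun u => L (fderiv ℝ (fderiv ℝ theta) u)) = lapTheta :=
    funext fun u => (hL _).trans (laplacian_theta u)
  rw [e1, e2, pot]
  have hint : IntervalIntegrable (fun t : ℝ => (t ^ 3)⁻¹ * avg ν f lapTheta t z) volume 0 1 := by
    have := h2.intervalIntegrable_apply L hfm hf hc2 suppHalf_theta.fderiv.fderiv hz
    rwa [e2] at this
  have h1' : Tendsto (fun t => (t ^ 2)⁻¹ * avg ν f rho t z) (𝓝[<] 1) (𝓝 (avg ν f rho 1 z)) := by
    have := (hasDerivAt_avg_rho (ν := ν) (f := f) hf one_pos z).continuousAt.tendsto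
    simpa using this.mono_left nhdsWithin_le_nhds
  exact intervalIntegral.integral_eq_sub_of_hasDerivAt_of_tendsto (f := fun t => (t ^ 2)⁻¹ * avg ν f rho t z) one_pos
    (fun t ht => hasDerivAt_avg_rho hf ht.1 z) hint hl h1'

end Scale

section Measures

lemma growth_volume : Growth volume 2 := by
  intro z t ht
  rw [Measure.real, Complex.volume_closedBall, ← ENNReal.ofReal_pow (by positivity),
    ENNReal.toReal_mul, ENNReal.toReal_ofReal (by positivity)]
  have : (NNReal.pi : ℝ) ≤ 4 := Real.pi_le_four
  simp only [ENNReal.coe_toReal]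
  nlinarith [sq_nonneg t]

/-- One-dimensional Lebesgue measure on the real axis of `ℂ`. -/
noncomputable def line : Measure ℂ := Measure.map (fun x : ℝ => (x : ℂ)) volume

lemma isClosedEmbedding_ofReal : IsClosedEmbedding (fun x : ℝ => (x : ℂ)) :=
  Complex.isometry_ofReal.isClosedEmbedding

lemma integral_line {E : Type*} [NormedAddCommGroup E] [NormedSpace ℝ E] (F : ℂ → E) :
    ∫ w, F w ∂line = ∫ x : ℝ, F x :=
  isClosedEmbedding_ofReal.measurableEmbedding.integral_map F

instance : SFinite line := by unfold line; infer_instance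

instance : IsFiniteMeasureOnCompacts line := by
  refine ⟨fun K hK => ?_⟩
  rw [line, isClosedEmbedding_ofReal.measurableEmbedding.map_apply]
  exact (isClosedEmbedding_ofReal.isCompact_preimage hK).measure_lt_top

lemma growth_line : Growth line 1 := by
  intro z t ht
  rw [Measure.real, line, isClosedEmbedding_ofReal.measurableEmbedding.map_apply]
  have hsub : (fun x : ℝ => (x : ℂ)) ⁻¹' closedBall z (t / 2) ⊆ Icc (z.re - t / 2) (z.re + t / 2) := by
    intro x hx
    have h1 : ‖(x : ℂ) - z‖ ≤ t / 2 := by simpa [dist_eq_norm] using hx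
    have h2 := (Complex.abs_re_le_norm ((x : ℂ) - z)).trans h1
    rw [abs_le] at h2
    simp only [sub_re, ofReal_re] at h2
    exact ⟨by linarith, by linarith⟩
  refine (ENNReal.toReal_mono (by simp) (measure_mono hsub)).trans ?_
  rw [Real.volume_Icc, ENNReal.toReal_ofReal (by linarith)]
  linarith

lemma locallyIntegrable_of_bounded {ν : Measure ℂ} [IsFiniteMeasureOnCompacts ν] {f : ℂ → ℝ}
    (hf : Measurable f) {M : ℝ} (hM : ∀ w, |f w| ≤ M) : LocallyIntegrable f ν := by
  have h1 : LocallyIntegrable (fun _ : ℂ => M) ν := continuous_const.locallyIntegrable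
  exact h1.mono hf.aestronglyMeasurable (Eventually.of_forall fun w =>
    (hM w).trans (le_abs_self M))

end Measures

section Bounds

variable {E : Type*} [NormedAddCommGroup E] [NormedSpace ℝ E] {f : ℂ → ℝ} {Φ : ℂ → E}

lemma SuppHalf.exists_bound (hΦ : Continuous Φ) (hs : SuppHalf Φ) :
    ∃ C, 0 ≤ C ∧ ∀ u, ‖Φ u‖ ≤ C := by
  obtain ⟨C, hC⟩ := hs.hasCompactSupport.exists_bound_of_continuous hΦ
  exact ⟨C, (norm_nonneg _).trans (hC 0), hC⟩

lemma dom_of_growth {ν : Measure ℂ} [IsFiniteMeasureOnCompacts ν] {d k : ℕ} (hν : Growth ν d)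
    (hk : k ≤ d) (hΦ : Continuous Φ) (hs : SuppHalf Φ) {s : Set ℂ} {M : ℝ}
    (hM : ∀ z ∈ s, ∀ w, ‖z - w‖ ≤ 1 / 2 → |f w| ≤ M) : Dom ν f Φ k s := by
  obtain ⟨C, hC0, hC⟩ := hs.exists_bound hΦ
  refine ⟨M * C, 1, one_pos, fun t ht z hz => ?_⟩
  have hM0 : 0 ≤ M := (abs_nonneg _).trans (hM z hz z (by simp))
  refine (norm_avg_le hν hs hC ht.1 fun w hw => hM z hz w (hw.trans (by linarith [ht.2]))).trans ?_
  rw [sub_self, Real.rpow_zero, mul_one]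
  exact mul_le_mul_of_nonneg_left (pow_le_pow_of_le_one ht.1.le ht.2 hk) (by positivity)

lemma dom_of_eq_zero {ν : Measure ℂ} [IsFiniteMeasureOnCompacts ν] {d : ℕ} (k : ℕ)
    (hν : Growth ν d) (hΦ : Continuous Φ) (hs : SuppHalf Φ) {s : Set ℂ} {M : ℝ}
    (hM : ∀ z ∈ s, ∀ w, ‖z - w‖ ≤ 1 / 2 → |f w| ≤ M) {a : ℝ} (ha : 0 < a)
    (h0 : ∀ t ∈ Ioo 0 a, ∀ z ∈ s, avg ν f Φ t z = 0) : Dom ν f Φ k s := by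
  obtain ⟨C, hC0, hC⟩ := hs.exists_bound hΦ
  refine ⟨M * C / a ^ k, 1, one_pos, fun t ht z hz => ?_⟩
  have hM0 : 0 ≤ M := (abs_nonneg _).trans (hM z hz z (by simp))
  rw [sub_self, Real.rpow_zero, mul_one]
  have ht0 := ht.1
  by_cases hta : t < a
  · rw [h0 t ⟨ht.1, hta⟩ z hz, norm_zero]
    positivity
  refine (norm_avg_le hν hs hC ht.1 fun w hw => hM z hz w (hw.trans (by linarith [ht.2]))).trans ?_
  rw [div_mul_eq_mul_div, mul_div_assoc]
  refine mul_le_mul_of_nonneg_left ((pow_le_one₀ ht.1.le ht.2).trans ?_) (by positivity)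
  rw [one_le_div (by positivity)]
  exact pow_le_pow_left₀ ha.le (not_lt.1 hta) k

lemma avg_one_volume (t : ℝ) (z : ℂ) :
    avg volume (fun _ => 1) Φ t z = ∫ w, Φ (t⁻¹ • w) := by
  simp only [avg, one_smul]
  exact integral_sub_left_eq_self (fun w : ℂ => Φ (t⁻¹ • w)) volume z

lemma avg_one_volume_scale {t : ℝ} (ht : 0 < t) (z : ℂ) :
    avg volume (fun _ => 1) Φ t z = t ^ 2 • ∫ w, Φ w := by
  rw [avg_one_volume, Measure.integral_comp_inv_smul, Complex.finrank_real_complex, abs_of_nonneg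
    (by positivity)]

lemma avg_one_fderiv (hΦ : ContDiff ℝ 1 Φ) (hs : SuppHalf Φ) {t : ℝ} (ht : 0 < t) (z : ℂ) :
    avg volume (fun _ => 1) (fderiv ℝ Φ) t z = 0 := by
  have h1 := hasFDerivAt_avg (ν := volume) (f := fun _ => 1)
    (continuous_const.locallyIntegrable) hΦ hs ht z
  have h2 : HasFDerivAt (avg volume (fun _ => 1) Φ t) (0 : ℂ →L[ℝ] E) z := by
    have : avg volume (fun _ => 1) Φ t = fun _ => ∫ w, Φ (t⁻¹ • w) :=
      funext fun z => avg_one_volume t z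
    rw [this]
    exact hasFDerivAt_const _ _
  have h3 := h1.unique h2
  exact (smul_eq_zero.1 h3).resolve_left (inv_pos.2 ht).ne'

lemma avg_sub_const {ν : Measure ℂ} [IsFiniteMeasureOnCompacts ν] (hf : LocallyIntegrable f ν)
    (hΦ : Continuous Φ) (hs : SuppHalf Φ) {t : ℝ} (ht : 0 < t) (z : ℂ) (a : ℝ) :
    avg ν f Φ t z = avg ν (fun w => f w - a) Φ t z + a • avg ν (fun _ => 1) Φ t z := by
  have hc : LocallyIntegrable (fun _ : ℂ => a) ν := continuous_const.locallyIntegrable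
  have := avg_add (hf.sub hc) hc hΦ hs ht z
  simp only [Pi.sub_apply, sub_add_cancel] at this
  rw [this, ← avg_const_mul]
  simp only [mul_one]
  rfl

/-- `f` is locally Hölder continuous near `z`, relative to `s`. -/
def HoldAt (f : ℂ → ℝ) (s : Set ℂ) (z : ℂ) : Prop :=
  ∃ ε > (0 : ℝ), ∃ K α : ℝ, 0 < α ∧ α ≤ 1 ∧ ∀ y₁ ∈ s ∩ ball z ε, ∀ y₂ ∈ s ∩ ball z ε,
    |f y₁ - f y₂| ≤ K * ‖y₁ - y₂‖ ^ α

lemma HoldAt.exists_semiglobal {z₀ : ℂ} (h : HoldAt f univ z₀) {M : ℝ}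
    (hM : ∀ w ∈ closedBall z₀ 1, |f w| ≤ M) :
    ∃ r > 0, r ≤ 1 / 2 ∧ ∃ K α : ℝ, 0 ≤ K ∧ 0 < α ∧ ∀ z ∈ ball z₀ r, ∀ w, ‖z - w‖ ≤ 1 / 2 →
      |f w - f z| ≤ K * ‖z - w‖ ^ α := by
  obtain ⟨ε, hε, K, α, hα, -, h⟩ := h
  have hM0 : 0 ≤ M := (abs_nonneg _).trans (hM z₀ (by simp))
  set r := min (ε / 2) (1 / 2) with hr
  have hr0 : 0 < r := by positivity
  have hrε : r ≤ ε / 2 := min_le_left _ _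
  have hr2 : r ≤ 1 / 2 := min_le_right _ _
  refine ⟨r, hr0, hr2, max K (2 * M / r ^ α), α, le_max_of_le_right (by positivity), hα,
    fun z hz w hw => ?_⟩
  have hz' : ‖z - z₀‖ < r := by simpa [dist_eq_norm] using hz
  have hwz : ‖w - z₀‖ ≤ ‖z - w‖ + ‖z - z₀‖ := by
    rw [norm_sub_rev z w]; exact norm_sub_le_norm_sub_add_norm_sub w z z₀
  by_cases hcl : ‖z - w‖ < r
  · have := h w ⟨mem_univ _, by rw [mem_ball, dist_eq_norm]; linarith⟩ z
      ⟨mem_univ _, by rw [mem_ball, dist_eq_norm]; linarith⟩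
    rw [norm_sub_rev w z] at this
    exact this.trans (mul_le_mul_of_nonneg_right (le_max_left _ _) (by positivity))
  · have h1 : |f w| ≤ M := hM w (by rw [mem_closedBall, dist_eq_norm]; linarith)
    have h2 : |f z| ≤ M := hM z (by rw [mem_closedBall, dist_eq_norm]; linarith)
    have h3 : |f w - f z| ≤ 2 * M := (abs_sub _ _).trans (by linarith)
    refine h3.trans ?_
    calc 2 * M = 2 * M / r ^ α * r ^ α := by field_simp
      _ ≤ max K (2 * M / r ^ α) * ‖z - w‖ ^ α := by
        apply mul_le_mul (le_max_right _ _) _ (by positivity) (le_max_of_le_right (by positivity))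
        exact Real.rpow_le_rpow hr0.le (not_lt.1 hcl) hα.le

lemma norm_avg_sub_le {ν : Measure ℂ} [IsFiniteMeasureOnCompacts ν] {d : ℕ} (hν : Growth ν d)
    (hs : SuppHalf Φ) {C : ℝ} (hC : ∀ u, ‖Φ u‖ ≤ C) {z : ℂ} {K α a : ℝ} (hα : 0 < α)
    (hK0 : 0 ≤ K) (hK : ∀ w, ‖z - w‖ ≤ 1 / 2 → |f w - a| ≤ K * ‖z - w‖ ^ α) {t : ℝ}
    (ht : t ∈ Ioc (0 : ℝ) 1) :
    ‖avg ν (fun w => f w - a) Φ t z‖ ≤ K * C * t ^ (d + 1) * t ^ (α - 1) := by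
  have ht0 := ht.1
  refine (norm_avg_le hν hs hC ht.1 (M := K * t ^ α) fun w hw => ?_).trans (le_of_eq ?_)
  · refine (hK w (hw.trans (by linarith [ht.2]))).trans ?_
    gcongr
    linarith
  · rw [Real.rpow_sub ht0, Real.rpow_one]
    field_simp
    ring

lemma dom_fderiv_volume (hf : LocallyIntegrable f volume) (hΦ : ContDiff ℝ 1 Φ) (hs : SuppHalf Φ)
    {s : Set ℂ} {K α : ℝ} (hK0 : 0 ≤ K) (hα : 0 < α)
    (hK : ∀ z ∈ s, ∀ w, ‖z - w‖ ≤ 1 / 2 → |f w - f z| ≤ K * ‖z - w‖ ^ α) :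
    Dom volume f (fderiv ℝ Φ) 3 s := by
  have hΦ' : Continuous (fderiv ℝ Φ) := hΦ.continuous_fderiv (by norm_num)
  obtain ⟨C, hC0, hC⟩ := hs.fderiv.exists_bound hΦ'
  refine ⟨K * C, α, hα, fun t ht z hz => ?_⟩
  rw [avg_sub_const hf hΦ' hs.fderiv ht.1 z (f z), avg_one_fderiv hΦ hs ht.1, smul_zero, add_zero]
  exact norm_avg_sub_le growth_volume hs.fderiv hC hα hK0 (hK z hz) ht

/-- The total mass of `rho`. -/
noncomputable def rhoMass : ℝ := ∫ u, rho u

lemma tendsto_avg_rho (hf : LocallyIntegrable f volume) {z : ℂ} {K α : ℝ} (hK0 : 0 ≤ K)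
    (hα : 0 < α) (hK : ∀ w, ‖z - w‖ ≤ 1 / 2 → |f w - f z| ≤ K * ‖z - w‖ ^ α) :
    Tendsto (fun t => (t ^ 2)⁻¹ * avg volume f rho t z) (𝓝[>] 0) (𝓝 (rhoMass * f z)) := by
  obtain ⟨C, hC0, hC⟩ := suppHalf_rho.exists_bound contDiff_rho.continuous
  have h1 : Tendsto (fun t : ℝ => K * C * t ^ α) (𝓝[>] 0) (𝓝 0) := by
    have : Tendsto (fun t : ℝ => t ^ α) (𝓝[>] 0) (𝓝 0) := by
      have := (Real.continuousAt_rpow_const 0 α (Or.inr hα.le)).tendsto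
      rw [Real.zero_rpow hα.ne'] at this
      exact this.mono_left nhdsWithin_le_nhds
    simpa using this.const_mul (K * C)
  rw [tendsto_iff_norm_sub_tendsto_zero]
  refine squeeze_zero' (Eventually.of_forall fun _ => norm_nonneg _) ?_ h1
  filter_upwards [Ioc_mem_nhdsGT (zero_lt_one' ℝ)] with t ht
  have ht0 := ht.1
  have h2 := norm_avg_sub_le growth_volume suppHalf_rho hC hα hK0 hK ht
  rw [avg_sub_const hf contDiff_rho.continuous suppHalf_rho ht.1 z (f z),
    avg_one_volume_scale ht.1, mul_add]
  have e : (t ^ 2)⁻¹ * f z • t ^ 2 • ∫ w, rho w = rhoMass * f z := by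
    simp only [smul_eq_mul, rhoMass]; field_simp
  rw [e, add_sub_cancel_right, norm_mul, norm_inv, Real.norm_of_nonneg (by positivity),
    inv_mul_le_iff₀ (by positivity)]
  refine h2.trans (le_of_eq ?_)
  rw [Real.rpow_sub ht0, Real.rpow_one]
  field_simp

lemma pot_volume_regularity (hfm : Measurable f) (hf : LocallyIntegrable f volume) {z₀ : ℂ} {M : ℝ}
    (hM : ∀ w ∈ closedBall z₀ 1, |f w| ≤ M) (h : HoldAt f univ z₀) :
    ContDiffAt ℝ 2 (pot volume f theta 1) z₀ ∧
      lap (pot volume f theta 1) z₀ = avg volume f rho 1 z₀ - rhoMass * f z₀ := by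
  obtain ⟨r, hr0, hr2, K, α, hK0, hα, hK⟩ := h.exists_semiglobal hM
  have hM' : ∀ z ∈ ball z₀ r, ∀ w, ‖z - w‖ ≤ 1 / 2 → |f w| ≤ M := by
    intro z hz w hw
    refine hM w ?_
    rw [mem_ball, dist_eq_norm] at hz
    rw [mem_closedBall, dist_eq_norm]
    have := norm_sub_le_norm_sub_add_norm_sub w z z₀
    rw [norm_sub_rev w z] at this
    linarith
  have hd : Dom₂ volume f (ball z₀ r) :=
    ⟨dom_of_growth growth_volume (by norm_num) contDiff_theta.continuous suppHalf_theta hM',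
      dom_of_growth growth_volume le_rfl contDiff_fderiv_theta.continuous suppHalf_theta.fderiv hM',
      dom_fderiv_volume hf contDiff_fderiv_theta suppHalf_theta.fderiv hK0 hα hK⟩
  exact ⟨(contDiffOn_pot hfm hf isOpen_ball hd).contDiffAt (ball_mem_nhds _ hr0),
    lap_pot hfm hf isOpen_ball hd (mem_ball_self hr0)
      (tendsto_avg_rho hf hK0 hα (hK z₀ (mem_ball_self hr0)))⟩

lemma avg_line_eq_zero (hs : SuppHalf Φ) {t : ℝ} (ht : 0 < t) {z : ℂ} (hz : t / 2 < |z.im|) :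
    avg line f Φ t z = 0 := by
  rw [avg, integral_line]
  have : ∀ x : ℝ, f x • Φ (t⁻¹ • (z - x)) = 0 := fun x => by
    rw [hs.dilate ht, smul_zero]
    have := Complex.abs_im_le_norm (z - x)
    simp only [sub_im, ofReal_im, sub_zero] at this
    linarith
  simp only [this, integral_zero]

lemma pot_line_regularity (hfm : Measurable f) {M : ℝ} (hM : ∀ w, |f w| ≤ M) {z₀ : ℂ}
    (hz₀ : z₀.im ≠ 0) :
    ContDiffAt ℝ 2 (pot line f theta 1) z₀ ∧
      lap (pot line f theta 1) z₀ = avg line f rho 1 z₀ := by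
  have hf : LocallyIntegrable f line := locallyIntegrable_of_bounded hfm hM
  have ha : 0 < |z₀.im| := abs_pos.2 hz₀
  set s := ball z₀ (|z₀.im| / 2) with hs
  have him : ∀ z ∈ s, |z₀.im| / 2 < |z.im| := by
    intro z hz
    have h1 := Complex.abs_im_le_norm (z₀ - z)
    have h2 : ‖z₀ - z‖ < |z₀.im| / 2 := by simpa [hs, dist_eq_norm, norm_sub_rev] using hz
    have h3 := abs_sub_abs_le_abs_sub z₀.im z.im
    rw [sub_im] at h1
    linarith
  have h0 {E : Type} [NormedAddCommGroup E] [NormedSpace ℝ E] {Φ : ℂ → E} (hΦ : SuppHalf Φ) :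
      ∀ t ∈ Ioo 0 |z₀.im|, ∀ z ∈ s, avg line f Φ t z = 0 := fun t ht z hz =>
    avg_line_eq_zero hΦ ht.1 ((div_lt_div_of_pos_right ht.2 two_pos).trans (him z hz))
  have hd : Dom₂ line f s :=
    ⟨dom_of_eq_zero 1 growth_line contDiff_theta.continuous suppHalf_theta
        (fun _ _ w _ => hM w) ha (h0 suppHalf_theta),
      dom_of_eq_zero 2 growth_line contDiff_fderiv_theta.continuous suppHalf_theta.fderiv
        (fun _ _ w _ => hM w) ha (h0 suppHalf_theta.fderiv),
      dom_of_eq_zero 3 growth_line (contDiff_fderiv_theta.continuous_fderiv (by norm_num))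
        suppHalf_theta.fderiv.fderiv (fun _ _ w _ => hM w) ha (h0 suppHalf_theta.fderiv.fderiv)⟩
  have hmem : z₀ ∈ s := mem_ball_self (by positivity)
  refine ⟨(contDiffOn_pot hfm hf isOpen_ball hd).contDiffAt (isOpen_ball.mem_nhds hmem), ?_⟩
  rw [lap_pot hfm hf isOpen_ball hd hmem (l := 0), sub_zero]
  refine tendsto_const_nhds.congr' ?_
  filter_upwards [Ioo_mem_nhdsGT ha] with t ht
  rw [h0 suppHalf_rho t ht z₀ hmem, mul_zero]

end Bounds

section Boundary

lemma norm_avg_le_mul_avg_one {ν : Measure ℂ} [IsFiniteMeasureOnCompacts ν] {f Φ : ℂ → ℝ}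
    (hΦ : Continuous Φ) (hs : SuppHalf Φ) (h0 : ∀ u, 0 ≤ Φ u) {t : ℝ} (ht : 0 < t) {z : ℂ} {B : ℝ}
    (hB : ∀ w, ‖z - w‖ ≤ t / 2 → |f w| ≤ B) :
    ‖avg ν f Φ t z‖ ≤ B * avg ν (fun _ => 1) Φ t z := by
  have hi := integrable_avg (ν := ν) (f := fun _ => 1) continuous_const.locallyIntegrable hΦ hs ht z
  rw [avg, avg, ← integral_const_mul]
  refine norm_integral_le_of_norm_le (hi.const_mul B) (Eventually.of_forall fun w => ?_)
  by_cases hw : ‖z - w‖ ≤ t / 2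
  · rw [norm_smul, Real.norm_of_nonneg (h0 _), one_smul]
    exact mul_le_mul_of_nonneg_right (hB w hw) (h0 _)
  · rw [hs.dilate ht (not_le.1 hw)]; simp

/-- The integral of `rho` over the horizontal line at height `r`. -/
noncomputable def slice (r : ℝ) : ℝ := avg line (fun _ => 1) rho 1 (r * I)

lemma continuous_slice : Continuous slice :=
  (continuous_avg (continuous_const.locallyIntegrable) contDiff_rho.continuous suppHalf_rho
    one_pos).comp (by fun_prop)

lemma slice_eq (r : ℝ) : slice r = ∫ s : ℝ, rho (s + r * I) := by
  rw [slice, avg, integral_line, ← integral_neg_eq_self]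
  congr 1; funext s
  simp only [inv_one, one_smul, ofReal_neg, sub_neg_eq_add]
  rw [add_comm]

lemma slice_nonneg (r : ℝ) : 0 ≤ slice r := by
  rw [slice_eq]; exact integral_nonneg fun s => rho_nonneg _

lemma slice_neg (r : ℝ) : slice (-r) = slice r := by
  rw [slice_eq, slice_eq]
  congr 1; funext s
  apply rho_eq_of_norm_eq
  rw [← Complex.norm_conj]
  simp

lemma slice_eq_zero {r : ℝ} (hr : 1 / 2 < r) : slice r = 0 :=
  avg_line_eq_zero suppHalf_rho one_pos (by simp; exact lt_of_lt_of_le (by linarith) (le_abs_self r))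

lemma rho_pos {u : ℂ} (hu : ‖u‖ < 1 / 2) : 0 < rho u := by
  have h : 0 < 1 / 4 - ‖u‖ ^ 2 := by nlinarith [norm_nonneg u]
  rw [rho, bump, max_eq_right h.le]
  positivity

lemma slice_pos {r : ℝ} (h0 : 0 ≤ r) (hr : r < 1 / 2) : 0 < slice r := by
  rw [slice_eq]
  have hc : Continuous fun s : ℝ => rho (s + r * I) :=
    contDiff_rho.continuous.comp (by fun_prop)
  refine hc.integral_pos_of_hasCompactSupport_nonneg_nonzero ?_ (fun s => rho_nonneg _) (x := 0) ?_
  · refine HasCompactSupport.intro (isCompact_Icc (a := -1) (b := 1)) fun s hs => suppHalf_rho _ ?_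
    have h1 : 1 < |s| := by
      by_contra! h
      exact hs (abs_le.1 h)
    have := Complex.abs_re_le_norm (s + r * I)
    simp at this
    linarith
  · apply ne_of_gt
    apply rho_pos
    simpa [abs_of_nonneg h0] using hr

lemma avg_line_one_rho {t : ℝ} (ht : 0 < t) (z : ℂ) :
    avg line (fun _ => 1) rho t z = t * slice (z.im / t) := by
  rw [avg, integral_line, slice_eq, ← smul_eq_mul]
  have h1 := Measure.integral_comp_inv_mul_left (fun s : ℝ => rho (s + (z.im / t : ℝ) * I)) t
  rw [abs_of_pos ht] at h1
  rw [← h1, ← integral_sub_left_eq_self (fun x : ℝ => rho (↑(t⁻¹ * x) + (z.im / t : ℝ) * I)) volume z.re]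
  congr 1; funext s
  rw [one_smul]
  congr 1
  apply Complex.ext
  · rw [smul_re]; simp
  · rw [smul_im]; simp; ring

/-- Half of the mass of `rho`: the jump constant of the single layer potential. -/
noncomputable def jump : ℝ := ∫ r in (0 : ℝ)..(1 / 2), slice r

lemma jump_pos : 0 < jump :=
  intervalIntegral.intervalIntegral_pos_of_pos_on (continuous_slice.intervalIntegrable _ _)
    (fun _ hr => slice_pos hr.1.le hr.2) (by norm_num)

lemma integral_slice_eq_jump {r : ℝ} (hr : 1 / 2 ≤ r) : ∫ s in (0 : ℝ)..r, slice s = jump := by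
  rw [jump, ← intervalIntegral.integral_add_adjacent_intervals
    (continuous_slice.intervalIntegrable 0 (1 / 2)) (continuous_slice.intervalIntegrable (1 / 2) r),
    add_eq_left]
  refine intervalIntegral.integral_zero_ae (Eventually.of_forall fun s hs => ?_)
  rw [uIoc_of_le hr] at hs
  exact slice_eq_zero hs.1

lemma slice_flux {h : ℝ} (hh : 0 < h) :
    IntervalIntegrable (fun t => h / t ^ 2 * slice (h / t)) volume 0 1 ∧
    ∫ t in (0 : ℝ)..1, h / t ^ 2 * slice (h / t) = jump - ∫ s in (0 : ℝ)..h, slice s := by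
  obtain ⟨C, hC0, hC⟩ : ∃ C, 0 ≤ C ∧ ∀ r, ‖slice r‖ ≤ C := by
    obtain ⟨C, hC0, hC⟩ := suppHalf_rho.exists_bound contDiff_rho.continuous
    refine ⟨_, ?_, fun r => norm_avg_le growth_line suppHalf_rho hC one_pos (M := 1)
      (fun w _ => by simp)⟩
    simpa using hC0
  have hint : IntervalIntegrable (fun t => h / t ^ 2 * slice (h / t)) volume 0 1 := by
    refine (intervalIntegrable_const (c := C * 4 / h)).mono_fun ?_ ?_
    · apply Measurable.aestronglyMeasurable
      have := continuous_slice.measurable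
      fun_prop
    · rw [uIoc_of_le zero_le_one]
      filter_upwards [ae_restrict_mem measurableSet_Ioc] with t ht
      have ht0 := ht.1
      rw [Real.norm_of_nonneg (show 0 ≤ C * 4 / h by positivity)]
      by_cases hs : 1 / 2 < h / t
      · rw [slice_eq_zero hs]; simp; positivity
      · rw [norm_mul, Real.norm_of_nonneg (show 0 ≤ h / t ^ 2 by positivity), mul_comm, mul_div_assoc]
        refine mul_le_mul (hC _) ?_ (by positivity) hC0
        rw [not_lt, div_le_iff₀ ht0] at hs
        rw [div_le_div_iff₀ (by positivity) hh]
        nlinarith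
  refine ⟨hint, ?_⟩
  have hd : ∀ t ∈ Ioo (0 : ℝ) 1, HasDerivAt (fun t => -∫ s in (0 : ℝ)..(h / t), slice s)
      (h / t ^ 2 * slice (h / t)) t := by
    intro t ht
    have ht0 := ht.1
    have h1 : HasDerivAt (fun t : ℝ => h / t) (-h / t ^ 2) t := by
      have := (hasDerivAt_inv ht0.ne').const_mul h
      refine this.congr_deriv ?_
      field_simp
    have h2 := (continuous_slice.integral_hasStrictDerivAt 0 (h / t)).hasDerivAt
    refine (h2.comp t h1).neg.congr_deriv ?_
    ring
  have hb : Tendsto (fun t => -∫ s in (0 : ℝ)..(h / t), slice s) (𝓝[<] 1)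
      (𝓝 (-∫ s in (0 : ℝ)..h, slice s)) := by
    have h1 : ContinuousAt (fun t => -∫ s in (0 : ℝ)..(h / t), slice s) 1 := by
      have h2 := (continuous_slice.integral_hasStrictDerivAt 0 (h / 1)).hasDerivAt.continuousAt
      have h3 : ContinuousAt (fun t : ℝ => h / t) 1 := by
        apply ContinuousAt.div continuousAt_const continuousAt_id; norm_num
      exact (ContinuousAt.comp (f := fun t : ℝ => h / t) h2 h3).neg
    have := h1.tendsto.mono_left (nhdsWithin_le_nhds (s := Iio 1))
    simpa using this
  have ha : Tendsto (fun t => -∫ s in (0 : ℝ)..(h / t), slice s) (𝓝[>] 0) (𝓝 (-jump)) := by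
    refine tendsto_const_nhds.congr' ?_
    filter_upwards [Ioo_mem_nhdsGT (show 0 < 2 * h by positivity)] with t ht
    have ht0 := ht.1
    rw [integral_slice_eq_jump]
    rw [le_div_iff₀ ht0]
    linarith [ht.2]
  rw [intervalIntegral.integral_eq_sub_of_hasDerivAt_of_tendsto
    (f := fun t => -∫ s in (0 : ℝ)..(h / t), slice s) one_pos hd hint ha hb]
  ring


/-- The charge on the real axis with density `g`. -/
def onRe (g : ℝ → ℝ) (w : ℂ) : ℝ := g w.re

/-- The vertical derivative of `theta`. -/
noncomputable def thetaI (u : ℂ) : ℝ := fderiv ℝ theta u I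

/-- The horizontal derivative of `theta`. -/
noncomputable def thetaRe (u : ℂ) : ℝ := fderiv ℝ theta u 1

lemma contDiff_thetaI : ContDiff ℝ 1 thetaI := contDiff_fderiv_theta.clm_apply contDiff_const

lemma contDiff_thetaRe : ContDiff ℝ 1 thetaRe := contDiff_fderiv_theta.clm_apply contDiff_const

lemma suppHalf_thetaI : SuppHalf thetaI := fun u hu => by
  simp [thetaI, suppHalf_theta.fderiv u hu]

lemma suppHalf_thetaRe : SuppHalf thetaRe := fun u hu => by
  simp [thetaRe, suppHalf_theta.fderiv u hu]

lemma thetaI_eq (u : ℂ) : thetaI u = -u.im * rho u := by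
  rw [thetaI, fderiv_theta]; simp; ring

lemma avg_line_thetaI (f : ℂ → ℝ) (t : ℝ) (z : ℂ) :
    avg line f thetaI t z = -z.im / t * avg line f rho t z := by
  rw [avg, avg, integral_line, integral_line, ← integral_const_mul]
  congr 1; funext s
  rw [thetaI_eq, smul_im]
  simp only [sub_im, ofReal_im, sub_zero, smul_eq_mul]
  ring

variable {g : ℝ → ℝ} {M : ℝ}

lemma measurable_onRe (hg : Measurable g) : Measurable (onRe g) := hg.comp Complex.measurable_re

lemma locallyIntegrable_onRe (hg : Measurable g) (hM : ∀ x, |g x| ≤ M) :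
    LocallyIntegrable (onRe g) line :=
  locallyIntegrable_of_bounded (measurable_onRe hg) (M := M) fun _ => hM _

lemma continuous_pot_line (hg : Measurable g) (hM : ∀ x, |g x| ≤ M) :
    Continuous (pot line (onRe g) theta 1) := by
  rw [← continuousOn_univ]
  exact continuousOn_pot (dom_of_growth growth_line le_rfl contDiff_theta.continuous suppHalf_theta
    (fun _ _ _ _ => hM _)) (measurable_onRe hg) (locallyIntegrable_onRe hg hM)
    contDiff_theta.continuous suppHalf_theta

lemma dom_line_of_im_ne_zero (hM : ∀ x, |g x| ≤ M) {E : Type*} [NormedAddCommGroup E]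
    [NormedSpace ℝ E] {Φ : ℂ → E} (hΦ : Continuous Φ) (hs : SuppHalf Φ) (k : ℕ) {a : ℝ}
    (ha : 0 < a) : Dom line (onRe g) Φ k {z | a < |z.im|} :=
  dom_of_eq_zero k growth_line hΦ hs (fun _ _ _ _ => hM _) ha fun t ht z hz =>
    avg_line_eq_zero hs ht.1 (by have : a < |z.im| := hz; linarith [ht.1, ht.2])

lemma hasFDerivAt_pot_line (hg : Measurable g) (hM : ∀ x, |g x| ≤ M) {z : ℂ} (hz : z.im ≠ 0) :
    HasFDerivAt (pot line (onRe g) theta 1) (pot line (onRe g) (fderiv ℝ theta) 2 z) z := by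
  have ha : 0 < |z.im| / 2 := by positivity
  have hlt : |z.im| / 2 < |z.im| := half_lt_self (by positivity)
  exact hasFDerivAt_pot (isOpen_lt continuous_const (by fun_prop))
    (dom_line_of_im_ne_zero hM contDiff_theta.continuous suppHalf_theta 1 ha)
    (dom_line_of_im_ne_zero hM contDiff_fderiv_theta.continuous suppHalf_theta.fderiv 2 ha)
    (measurable_onRe hg) (locallyIntegrable_onRe hg hM) (contDiff_theta.of_le (by norm_num))
    suppHalf_theta hlt

lemma fderiv_pot_line (hg : Measurable g) (hM : ∀ x, |g x| ≤ M) {z : ℂ} (hz : z.im ≠ 0) (v : ℂ) :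
    fderiv ℝ (pot line (onRe g) theta 1) z v =
      pot line (onRe g) (fun u => fderiv ℝ theta u v) 2 z := by
  have ha : 0 < |z.im| / 2 := by positivity
  have hlt : |z.im| / 2 < |z.im| := half_lt_self (by positivity)
  rw [(hasFDerivAt_pot_line hg hM hz).fderiv]
  exact pot_apply (ContinuousLinearMap.apply ℝ ℝ v)
    (dom_line_of_im_ne_zero hM contDiff_fderiv_theta.continuous suppHalf_theta.fderiv 2 ha)
    (measurable_onRe hg) (locallyIntegrable_onRe hg hM) contDiff_fderiv_theta.continuous
    suppHalf_theta.fderiv hlt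

lemma slice_bound : ∃ C, 0 ≤ C ∧ ∀ r, slice r ≤ C := by
  obtain ⟨C, hC0, hC⟩ := suppHalf_rho.exists_bound contDiff_rho.continuous
  refine ⟨1 * C * 1 ^ 1, by simpa using hC0, fun r => (le_abs_self _).trans ?_⟩
  exact norm_avg_le growth_line suppHalf_rho hC one_pos (M := 1) (fun w _ => by simp)

/-- Quantitative jump relation for the vertical derivative of the single layer potential. -/
lemma abs_pot_thetaI_sub_le : ∃ C, 0 ≤ C ∧ ∀ (g : ℝ → ℝ) (M : ℝ), Measurable g →
    (∀ x, |g x| ≤ M) → ∀ (a A L : ℝ), 0 ≤ A → 0 ≤ L → ∀ z : ℂ, z.im < 0 →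
    (∀ w, |onRe g w - a| ≤ A + L * ‖z - w‖) →
    |pot line (onRe g) thetaI 2 z - a * (jump - ∫ s in (0 : ℝ)..(-z.im), slice s)| ≤
      A * jump + L * C * (-z.im) ^ (1 / 2 : ℝ) := by
  obtain ⟨C, hC0, hC⟩ := slice_bound
  refine ⟨C, hC0, fun g M hg hM a A L hA hL z hz hgz => ?_⟩
  set h := -z.im with hh
  have hh0 : 0 < h := by linarith
  obtain ⟨hint, hflux⟩ := slice_flux hh0
  have hf := locallyIntegrable_onRe hg hM
  have hDom := dom_line_of_im_ne_zero hM contDiff_thetaI.continuous suppHalf_thetaI 2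
    (a := h / 2) (by positivity)
  have hmem : h / 2 < |z.im| := by rw [abs_of_neg hz]; linarith
  have hI1 := hDom.intervalIntegrable (measurable_onRe hg) contDiff_thetaI.continuous hmem
  rw [← Real.norm_eq_abs, ← hflux, pot, ← intervalIntegral.integral_const_mul,
    ← intervalIntegral.integral_sub hI1 (hint.const_mul a)]
  have hbi : IntervalIntegrable (fun t : ℝ => A * (h / t ^ 2 * slice (h / t)) +
      L * C * h ^ (1 / 2 : ℝ) / 2 * t ^ (-(1 / 2) : ℝ)) volume 0 1 :=
    (hint.const_mul A).add
      ((intervalIntegral.intervalIntegrable_rpow' (by norm_num)).const_mul _)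
  refine (intervalIntegral.norm_integral_le_of_norm_le zero_le_one (g := fun t : ℝ =>
    A * (h / t ^ 2 * slice (h / t)) + L * C * h ^ (1 / 2 : ℝ) / 2 * t ^ (-(1 / 2) : ℝ)) ?_ hbi).trans ?_
  · refine Eventually.of_forall fun t ht => ?_
    have ht0 : 0 < t := ht.1
    have e1 : avg line (onRe g) thetaI t z = h / t * (avg line (fun w => onRe g w - a) rho t z) +
        a * (h * slice (h / t)) := by
      rw [avg_line_thetaI, avg_sub_const hf contDiff_rho.continuous suppHalf_rho ht0 z a,
        avg_line_one_rho ht0, ← slice_neg (z.im / t), smul_eq_mul, ← neg_div, ← hh]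
      field_simp
    have e2 := norm_avg_le_mul_avg_one (ν := line) (f := fun w => onRe g w - a) (B := A + L * (t / 2))
      contDiff_rho.continuous suppHalf_rho rho_nonneg ht0 (z := z) (fun w hw => (hgz w).trans (by gcongr))
    rw [avg_line_one_rho ht0, ← slice_neg (z.im / t), ← neg_div, ← hh] at e2
    have e3 : (t ^ 2)⁻¹ • avg line (onRe g) thetaI t z - a * (h / t ^ 2 * slice (h / t)) =
        h / t ^ 3 * (avg line (fun w => onRe g w - a) rho t z) := by
      rw [e1, smul_eq_mul]; field_simp; ring
    rw [e3, norm_mul, Real.norm_of_nonneg (by positivity)]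
    have e4 : slice (h / t) * (h / t) ≤ C * (h ^ (1 / 2 : ℝ) * t ^ (-(1 / 2) : ℝ)) := by
      by_cases hc : 1 / 2 < h / t
      · rw [slice_eq_zero hc, zero_mul]; positivity
      · refine mul_le_mul (hC _) ?_ (by positivity) hC0
        rw [Real.rpow_neg ht0.le, ← div_eq_mul_inv, ← Real.div_rpow hh0.le ht0.le]
        calc h / t = (h / t) ^ (1 : ℝ) := (Real.rpow_one _).symm
          _ ≤ (h / t) ^ (1 / 2 : ℝ) :=
            Real.rpow_le_rpow_of_exponent_ge (by positivity) (by linarith) (by norm_num)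
    calc h / t ^ 3 * ‖avg line (fun w => onRe g w - a) rho t z‖
        ≤ h / t ^ 3 * ((A + L * (t / 2)) * (t * slice (h / t))) := by gcongr
      _ = A * (h / t ^ 2 * slice (h / t)) + L / 2 * (slice (h / t) * (h / t)) := by
          field_simp
      _ ≤ A * (h / t ^ 2 * slice (h / t)) + L / 2 * (C * (h ^ (1 / 2 : ℝ) * t ^ (-(1 / 2) : ℝ))) := by
          gcongr
      _ = _ := by ring
  · rw [intervalIntegral.integral_add (hint.const_mul A)
      ((intervalIntegral.intervalIntegrable_rpow' (by norm_num)).const_mul _),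
      intervalIntegral.integral_const_mul, intervalIntegral.integral_const_mul, hflux,
      integral_rpow (Or.inl (by norm_num))]
    have : 0 ≤ ∫ s in (0 : ℝ)..h, slice s :=
      intervalIntegral.integral_nonneg hh0.le fun s _ => slice_nonneg s
    norm_num
    nlinarith [mul_nonneg hA this]

lemma tendsto_fderiv_pot_line_I (hg : Measurable g) (hM : ∀ x, |g x| ≤ M) {x₀ : ℝ}
    (hc : ContinuousAt g x₀) :
    Tendsto (fun z => fderiv ℝ (pot line (onRe g) theta 1) z I) (𝓝[{z | z.im < 0}] (x₀ : ℂ))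
      (𝓝 (jump * g x₀)) := by
  obtain ⟨C, hC0, hC⟩ := abs_pot_thetaI_sub_le
  have hM0 : 0 ≤ M := (abs_nonneg _).trans (hM 0)
  have hG : Tendsto (fun z : ℂ => g x₀ * (jump - ∫ s in (0 : ℝ)..(-z.im), slice s))
      (𝓝[{z | z.im < 0}] (x₀ : ℂ)) (𝓝 (jump * g x₀)) := by
    have h1 : Continuous fun z : ℂ => ∫ s in (0 : ℝ)..(-z.im), slice s :=
      (intervalIntegral.continuous_primitive (fun a b => continuous_slice.intervalIntegrable a b)
        0).comp (by fun_prop)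
    have h2 : Continuous fun z : ℂ => g x₀ * (jump - ∫ s in (0 : ℝ)..(-z.im), slice s) := by
      fun_prop
    have := (h2.tendsto (x₀ : ℂ)).mono_left (nhdsWithin_le_nhds (s := {z : ℂ | z.im < 0}))
    simpa [mul_comm] using this
  have hkey : Tendsto (fun z => pot line (onRe g) thetaI 2 z -
      g x₀ * (jump - ∫ s in (0 : ℝ)..(-z.im), slice s)) (𝓝[{z | z.im < 0}] (x₀ : ℂ)) (𝓝 0) := by
    rw [Metric.tendsto_nhds]
    intro ε hε
    have hj := jump_pos
    set η := ε / (4 * jump) with hη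
    have hη0 : 0 < η := by positivity
    obtain ⟨δ, hδ, hgδ⟩ := Metric.continuousAt_iff.1 hc η hη0
    set L := 2 * M / δ with hL
    have hL0 : 0 ≤ L := by positivity
    have hgw : ∀ w : ℂ, |onRe g w - g x₀| ≤ η + L * ‖(x₀ : ℂ) - w‖ := by
      intro w
      have hre : |w.re - x₀| ≤ ‖(x₀ : ℂ) - w‖ := by
        have := Complex.abs_re_le_norm ((x₀ : ℂ) - w)
        rwa [sub_re, ofReal_re, abs_sub_comm] at this
      by_cases hw : |w.re - x₀| < δ
      · have := hgδ (x := w.re) (by rwa [Real.dist_eq])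
        rw [Real.dist_eq] at this
        have h2 : 0 ≤ L * ‖(x₀ : ℂ) - w‖ := by positivity
        simp only [onRe]; linarith
      · have h1 : |onRe g w - g x₀| ≤ 2 * M := (abs_sub _ _).trans (by
          have := hM w.re; have := hM x₀; simp only [onRe]; linarith)
        have h2 : 2 * M = L * δ := by rw [hL]; field_simp
        have h3 : L * δ ≤ L * ‖(x₀ : ℂ) - w‖ := by
          gcongr; exact (not_lt.1 hw).trans hre
        linarith
    have hsm : Tendsto (fun z : ℂ => (η + L * ‖(x₀ : ℂ) - z‖) * jump + L * C * (-z.im) ^ (1 / 2 : ℝ))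
        (𝓝[{z | z.im < 0}] (x₀ : ℂ)) (𝓝 (η * jump)) := by
      have h1 : Continuous fun z : ℂ => (η + L * ‖(x₀ : ℂ) - z‖) * jump +
          L * C * (-z.im) ^ (1 / 2 : ℝ) := by
        have : Continuous fun z : ℂ => (-z.im) ^ (1 / 2 : ℝ) :=
          (by fun_prop : Continuous fun z : ℂ => -z.im).rpow_const fun _ => Or.inr (by norm_num)
        fun_prop
      have := (h1.tendsto (x₀ : ℂ)).mono_left (nhdsWithin_le_nhds (s := {z : ℂ | z.im < 0}))
      simpa using this
    have hlt : η * jump < ε := by rw [hη]; field_simp; norm_num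
    filter_upwards [hsm.eventually (gt_mem_nhds hlt), self_mem_nhdsWithin] with z hz hzim
    rw [Real.dist_eq, sub_zero]
    refine (hC g M hg hM (g x₀) (η + L * ‖(x₀ : ℂ) - z‖) L (by positivity) hL0 z hzim
      fun w => (hgw w).trans ?_).trans_lt hz
    have := norm_sub_le_norm_sub_add_norm_sub (x₀ : ℂ) z w
    nlinarith
  have := hkey.add hG
  simp only [sub_add_cancel, zero_add] at this
  refine this.congr' ?_
  filter_upwards [self_mem_nhdsWithin] with z hz
  rw [fderiv_pot_line hg hM (ne_of_lt hz)]
  rfl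

lemma avg_line_thetaRe {t : ℝ} (ht : 0 < t) (z : ℂ) :
    avg line (fun _ => 1) thetaRe t z = 0 := by
  have hl : LocallyIntegrable (fun _ : ℂ => (1 : ℝ)) line := continuous_const.locallyIntegrable
  have h1 := hasFDerivAt_avg hl (contDiff_theta.of_le (by norm_num)) suppHalf_theta ht z
  have h2 : HasDerivAt (fun s : ℝ => z + s * (1 : ℂ)) 1 0 := by
    have := (Complex.ofRealCLM.hasDerivAt (x := 0)).mul_const (1 : ℂ)
    simpa using this.const_add z
  have h1' : HasFDerivAt (avg line (fun _ => 1) theta t)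
      (t⁻¹ • avg line (fun _ => 1) (fderiv ℝ theta) t z) (z + ((0 : ℝ) : ℂ) * 1) := by simpa using h1
  have h3 := h1'.comp_hasDerivAt (0 : ℝ) h2
  have h4 : HasDerivAt (fun s : ℝ => avg line (fun _ => 1) theta t (z + s * (1 : ℂ))) 0 0 := by
    have : (fun s : ℝ => avg line (fun _ => 1) theta t (z + s * (1 : ℂ))) =
        fun _ => avg line (fun _ => 1) theta t z := by
      funext s
      rw [avg, avg, integral_line, integral_line, ← integral_add_right_eq_self _ s]
      congr 1; funext x
      congr 3
      push_cast; ring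
    rw [this]
    exact hasDerivAt_const _ _
  have h5 := h3.unique h4
  have h6 := avg_apply (ContinuousLinearMap.apply ℝ ℝ (1 : ℂ)) hl contDiff_fderiv_theta.continuous
    suppHalf_theta.fderiv ht z
  rw [smul_apply, smul_eq_mul] at h5
  have h7 := (mul_eq_zero.1 h5).resolve_left (inv_pos.2 ht).ne'
  exact h6.symm.trans h7

lemma dom_thetaRe (hg : Measurable g) (hM : ∀ x, |g x| ≤ M)
    {s : Set ℂ} {K α : ℝ} (hK0 : 0 ≤ K) (hα : 0 < α)
    (hK : ∀ z ∈ s, ∀ w, ‖z - w‖ ≤ 1 / 2 → |onRe g w - onRe g z| ≤ K * ‖z - w‖ ^ α) :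
    Dom line (onRe g) thetaRe 2 s := by
  obtain ⟨C, hC0, hC⟩ := suppHalf_thetaRe.exists_bound contDiff_thetaRe.continuous
  refine ⟨K * C, α, hα, fun t ht z hz => ?_⟩
  rw [avg_sub_const (locallyIntegrable_onRe hg hM) contDiff_thetaRe.continuous suppHalf_thetaRe
    ht.1 z (onRe g z), avg_line_thetaRe ht.1, smul_zero, add_zero]
  exact norm_avg_sub_le growth_line suppHalf_thetaRe hC hα hK0 (hK z hz) ht

lemma tendsto_fderiv_pot_line_one (hg : Measurable g) (hM : ∀ x, |g x| ≤ M) {x₀ : ℝ}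
    (h : HoldAt (onRe g) univ x₀) :
    ∃ a, Tendsto (fun z => fderiv ℝ (pot line (onRe g) theta 1) z 1)
      (𝓝[{z | z.im < 0}] (x₀ : ℂ)) (𝓝 a) := by
  obtain ⟨r, hr0, -, K, α, hK0, hα, hK⟩ := h.exists_semiglobal (M := M) fun _ _ => hM _
  have hc := continuousOn_pot (dom_thetaRe hg hM hK0 hα hK) (measurable_onRe hg)
    (locallyIntegrable_onRe hg hM) contDiff_thetaRe.continuous suppHalf_thetaRe
  have h1 := (hc.continuousAt (ball_mem_nhds _ hr0)).tendsto.mono_left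
    (nhdsWithin_le_nhds (s := {z : ℂ | z.im < 0}))
  refine ⟨_, h1.congr' ?_⟩
  filter_upwards [self_mem_nhdsWithin] with z hz
  rw [fderiv_pot_line hg hM (ne_of_lt hz)]
  rfl

end Boundary

section Hold

variable {f g : ℂ → ℝ} {s s' : Set ℂ} {z : ℂ}

lemma HoldAt.congr_of_nhds (h : HoldAt f s z) {u : Set ℂ} (hu : u ∈ 𝓝 z)
    (hs : ∀ w ∈ s' ∩ u, w ∈ s ∧ g w = f w) : HoldAt g s' z := by
  obtain ⟨ε, hε, K, α, hα, hα1, h⟩ := h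
  obtain ⟨δ, hδ, hu⟩ := Metric.mem_nhds_iff.1 hu
  have key : ∀ y ∈ s' ∩ ball z (min ε δ), y ∈ s ∩ ball z ε ∧ g y = f y := fun y hy => by
    have h1 := hs y ⟨hy.1, hu (ball_subset_ball (min_le_right _ _) hy.2)⟩
    exact ⟨⟨h1.1, ball_subset_ball (min_le_left _ _) hy.2⟩, h1.2⟩
  refine ⟨min ε δ, lt_min hε hδ, K, α, hα, hα1, fun y₁ h₁ y₂ h₂ => ?_⟩
  rw [(key y₁ h₁).2, (key y₂ h₂).2]
  exact h y₁ (key y₁ h₁).1 y₂ (key y₂ h₂).1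

lemma HoldAt.add (hf : HoldAt f s z) (hg : HoldAt g s z) :
    HoldAt (fun w => f w + g w) s z := by
  obtain ⟨ε, hε, K, α, hα, hα1, hf⟩ := hf
  obtain ⟨δ, hδ, L, β, hβ, hβ1, hg⟩ := hg
  set r := min (min ε δ) (1 / 2) with hr
  have hr1 : r ≤ 1 / 2 := min_le_right _ _
  have hrε : r ≤ ε := (min_le_left _ _).trans (min_le_left _ _)
  have hrδ : r ≤ δ := (min_le_left _ _).trans (min_le_right _ _)
  refine ⟨r, by positivity, |K| + |L|, min α β, lt_min hα hβ, (min_le_left _ _).trans hα1,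
    fun y₁ h₁ y₂ h₂ => ?_⟩
  have hd : ‖y₁ - y₂‖ ≤ 1 := by
    rw [← dist_eq_norm]
    have := dist_triangle_right y₁ y₂ z
    have h3 : dist y₁ z < r := h₁.2
    have h4 : dist y₂ z < r := h₂.2
    linarith
  have hpow : ∀ γ, min α β ≤ γ → ‖y₁ - y₂‖ ^ γ ≤ ‖y₁ - y₂‖ ^ min α β := fun γ hγ => by
    rcases (norm_nonneg (y₁ - y₂)).eq_or_lt with h0 | h0
    · rw [← h0, Real.zero_rpow (lt_min hα hβ).ne', Real.zero_rpow ((lt_min hα hβ).trans_le hγ).ne']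
    · exact Real.rpow_le_rpow_of_exponent_ge h0 hd hγ
  have e1 := hf y₁ ⟨h₁.1, ball_subset_ball hrε h₁.2⟩ y₂ ⟨h₂.1, ball_subset_ball hrε h₂.2⟩
  have e2 := hg y₁ ⟨h₁.1, ball_subset_ball hrδ h₁.2⟩ y₂ ⟨h₂.1, ball_subset_ball hrδ h₂.2⟩
  have e3 : K * ‖y₁ - y₂‖ ^ α ≤ |K| * ‖y₁ - y₂‖ ^ min α β :=
    mul_le_mul (le_abs_self K) (hpow α (min_le_left _ _)) (by positivity) (abs_nonneg _)
  have e4 : L * ‖y₁ - y₂‖ ^ β ≤ |L| * ‖y₁ - y₂‖ ^ min α β :=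
    mul_le_mul (le_abs_self L) (hpow β (min_le_right _ _)) (by positivity) (abs_nonneg _)
  calc |f y₁ + g y₁ - (f y₂ + g y₂)| = |(f y₁ - f y₂) + (g y₁ - g y₂)| := by ring_nf
    _ ≤ |f y₁ - f y₂| + |g y₁ - g y₂| := abs_add_le _ _
    _ ≤ _ := by linarith

lemma HoldAt.const_mul (hf : HoldAt f s z) (a : ℝ) : HoldAt (fun w => a * f w) s z := by
  obtain ⟨ε, hε, K, α, hα, hα1, hf⟩ := hf
  refine ⟨ε, hε, |a| * K, α, hα, hα1, fun y₁ h₁ y₂ h₂ => ?_⟩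
  rw [← mul_sub, abs_mul, mul_assoc]
  exact mul_le_mul_of_nonneg_left (hf y₁ h₁ y₂ h₂) (abs_nonneg a)

lemma holdAt_of_contDiffAt (hf : ContDiffAt ℝ 1 f z) (s : Set ℂ) : HoldAt f s z := by
  obtain ⟨K, t, ht, hK⟩ := hf.exists_lipschitzOnWith
  obtain ⟨ε, hε, ht⟩ := Metric.mem_nhds_iff.1 ht
  refine ⟨ε, hε, K, 1, one_pos, le_rfl, fun y₁ h₁ y₂ h₂ => ?_⟩
  rw [Real.rpow_one]
  simpa [Real.dist_eq, dist_eq_norm] using hK.dist_le_mul y₁ (ht h₁.2) y₂ (ht h₂.2)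

lemma holdAt_of_le {K α : ℝ} (hα : 0 < α) (hα1 : α ≤ 1)
    (h : ∀ y₁ y₂, |f y₁ - f y₂| ≤ K * ‖y₁ - y₂‖ ^ α) (s : Set ℂ) : HoldAt f s z :=
  ⟨1, one_pos, K, α, hα, hα1, fun _ _ _ _ => h _ _⟩

/-- The single layer potential of a bounded density is Hölder continuous. -/
lemma pot_line_holder {g : ℝ → ℝ} (hg : Measurable g) {M : ℝ} (hM : ∀ x, |g x| ≤ M) :
    ∃ K, 0 ≤ K ∧ ∀ z z', |pot line (onRe g) theta 1 z - pot line (onRe g) theta 1 z'| ≤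
      K * ‖z - z'‖ ^ (1 / 2 : ℝ) := by
  have hM0 : 0 ≤ M := (abs_nonneg _).trans (hM 0)
  obtain ⟨C, hC0, hC⟩ := suppHalf_theta.exists_bound contDiff_theta.continuous
  obtain ⟨C', hC0', hC'⟩ := suppHalf_theta.fderiv.exists_bound contDiff_fderiv_theta.continuous
  have hf := locallyIntegrable_onRe hg hM
  have hmM := measurable_onRe hg
  set D := 2 * C + C' with hD
  have hDom := dom_of_growth growth_line le_rfl contDiff_theta.continuous suppHalf_theta
    (f := onRe g) (s := univ) (fun _ _ _ _ => hM _)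
  refine ⟨M * D * 2, by positivity, fun z z' => ?_⟩
  set δ := ‖z - z'‖ with hδ
  rw [pot, pot, ← intervalIntegral.integral_sub
    (hDom.intervalIntegrable hmM contDiff_theta.continuous (mem_univ z))
    (hDom.intervalIntegrable hmM contDiff_theta.continuous (mem_univ z'))]
  have hbi : IntervalIntegrable (fun t : ℝ => M * D * δ ^ (1 / 2 : ℝ) * t ^ (-(1 / 2) : ℝ))
      volume 0 1 := (intervalIntegral.intervalIntegrable_rpow' (by norm_num)).const_mul _
  rw [← Real.norm_eq_abs]
  refine (intervalIntegral.norm_integral_le_of_norm_le zero_le_one (g := fun t : ℝ =>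
    M * D * δ ^ (1 / 2 : ℝ) * t ^ (-(1 / 2) : ℝ)) ?_ hbi).trans ?_
  · refine Eventually.of_forall fun t ht => ?_
    have ht0 : 0 < t := ht.1
    have hb : ∀ w, ‖avg line (onRe g) theta t w‖ ≤ M * C * t := fun w => by
      have := norm_avg_le growth_line suppHalf_theta hC ht0 (z := w) (f := onRe g)
        (fun _ _ => hM _)
      rwa [pow_one] at this
    have e1 : ‖avg line (onRe g) theta t z - avg line (onRe g) theta t z'‖ ≤ M * D * t := by
      refine (norm_sub_le _ _).trans ((add_le_add (hb z) (hb z')).trans ?_)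
      have : 0 ≤ M * C' * t := by positivity
      rw [hD]; linarith
    have e2 : ‖avg line (onRe g) theta t z - avg line (onRe g) theta t z'‖ ≤ M * D * δ := by
      have := convex_univ.norm_image_sub_le_of_norm_hasFDerivWithin_le (𝕜 := ℝ)
        (f := avg line (onRe g) theta t) (C := M * C') (x := z') (y := z)
        (fun w _ => (hasFDerivAt_avg hf (contDiff_theta.of_le (by norm_num)) suppHalf_theta ht0
          w).hasFDerivWithinAt) (fun w _ => ?_) (mem_univ _) (mem_univ _)
      · refine this.trans ?_
        rw [← hδ, hD]
        have : 0 ≤ M * C * δ := by positivity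
        linarith
      · rw [norm_smul, norm_inv, Real.norm_of_nonneg ht0.le, inv_mul_le_iff₀ ht0]
        have := norm_avg_le growth_line suppHalf_theta.fderiv hC' ht0 (z := w)
          (f := onRe g) (fun _ _ => hM _)
        rw [pow_one] at this
        linarith
    have e3 : min t δ ≤ t ^ (1 / 2 : ℝ) * δ ^ (1 / 2 : ℝ) := by
      have hδ0 : 0 ≤ δ := norm_nonneg _
      have hm : 0 ≤ min t δ := le_min ht0.le hδ0
      calc min t δ = min t δ ^ (1 / 2 : ℝ) * min t δ ^ (1 / 2 : ℝ) := by
            rw [← Real.sqrt_eq_rpow, Real.mul_self_sqrt hm]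
        _ ≤ _ := mul_le_mul (Real.rpow_le_rpow hm (min_le_left _ _) (by norm_num))
            (Real.rpow_le_rpow hm (min_le_right _ _) (by norm_num)) (by positivity) (by positivity)
    have e4 : ‖avg line (onRe g) theta t z - avg line (onRe g) theta t z'‖ ≤
        M * D * (t ^ (1 / 2 : ℝ) * δ ^ (1 / 2 : ℝ)) := by
      refine le_trans ?_ (mul_le_mul_of_nonneg_left e3 (by positivity))
      rcases min_choice t δ with h | h <;> rw [h] <;> assumption
    rw [← smul_sub, pow_one, norm_smul, norm_inv, Real.norm_of_nonneg ht0.le, inv_mul_le_iff₀ ht0]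
    refine e4.trans (le_of_eq ?_)
    have : t * t ^ (-(1 / 2) : ℝ) = t ^ (1 / 2 : ℝ) := by
      rw [← Real.rpow_one_add' ht0.le (by norm_num)]; norm_num
    rw [← this]; ring
  · rw [intervalIntegral.integral_const_mul, integral_rpow (Or.inl (by norm_num))]
    norm_num
    linarith

end Hold

section Closure

lemma isOpen_OmegaS : IsOpen OmegaS :=
  (isOpen_lt continuous_const continuous_im).inter (isOpen_lt continuous_im continuous_const)

lemma convex_OmegaS : Convex ℝ OmegaS :=
  (convex_halfSpace_im_gt (-1)).inter (convex_halfSpace_im_lt 0)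

lemma closure_OmegaS : closure OmegaS = {z : ℂ | -1 ≤ z.im ∧ z.im ≤ 0} := by
  have : OmegaS = im ⁻¹' Ioo (-1) 0 := rfl
  rw [this, ← Complex.isOpenMap_im.preimage_closure_eq_closure_preimage continuous_im,
    closure_Ioo (by norm_num)]
  rfl

lemma contDiffOn_closure_of_tendsto {φ : ℂ → ℝ} {s : Set ℂ} (hso : IsOpen s) (hsc : Convex ℝ s)
    (hne : s.Nonempty) (hd : DifferentiableOn ℝ φ s) (hc : ContinuousOn φ (closure s))
    {φ' : ℂ → ℂ →L[ℝ] ℝ} (hlim : ∀ z ∈ closure s, Tendsto (fderiv ℝ φ) (𝓝[s] z) (𝓝 (φ' z))) :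
    ContDiffOn ℝ 1 φ (closure s) ∧ ∀ z ∈ closure s, fderivWithin ℝ φ (closure s) z = φ' z := by
  have hw : ∀ z ∈ closure s, HasFDerivWithinAt φ (φ' z) (closure s) z := fun z hz =>
    hasFDerivWithinAt_closure_of_tendsto_fderiv hd hsc hso
      (fun w hw => (hc w hw).mono subset_closure) (hlim z hz)
  have hu : UniqueDiffOn ℝ (closure s) :=
    uniqueDiffOn_convex hsc.closure (hne.mono (hso.subset_interior_iff.2 subset_closure))
  have hf : ∀ z ∈ closure s, fderivWithin ℝ φ (closure s) z = φ' z := fun z hz =>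
    (hw z hz).fderivWithin (hu z hz)
  refine ⟨?_, hf⟩
  rw [show (1 : WithTop ℕ∞) = 0 + 1 by norm_num, contDiffOn_succ_iff_fderivWithin hu]
  refine ⟨fun z hz => (hw z hz).differentiableWithinAt, by simp, ?_⟩
  rw [contDiffOn_zero]
  have h1 : ContinuousOn (extendFrom s (fderiv ℝ φ)) (closure s) :=
    continuousOn_extendFrom subset_rfl fun z hz => ⟨_, hlim z hz⟩
  refine h1.congr fun z hz => ?_
  rw [hf z hz, extendFrom_eq hz (hlim z hz)]

lemma tendsto_clm_of_apply {l : Filter ℂ} {A : ℂ → ℂ →L[ℝ] ℝ} {a b : ℝ}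
    (h1 : Tendsto (fun z => A z 1) l (𝓝 a)) (hI : Tendsto (fun z => A z I) l (𝓝 b)) :
    Tendsto A l (𝓝 (a • reCLM + b • imCLM)) := by
  have : A = fun z => A z 1 • reCLM + A z I • imCLM := by
    funext z; ext v
    conv_lhs => rw [← re_add_im v]
    have e : (v.re : ℂ) + v.im * I = v.re • (1 : ℂ) + v.im • I := by simp
    rw [e, map_add, map_smul, map_smul]
    simp [mul_comm]
  rw [this]
  exact (h1.smul_const _).add (hI.smul_const _)

end Closure

section Reflection

variable {E : Type*} [NormedAddCommGroup E] [NormedSpace ℝ E]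

lemma integral_conj_add (G : ℂ → E) (c : ℂ) : ∫ w, G (conj w + c) = ∫ w, G w := by
  rw [← integral_add_right_eq_self G c]
  exact conjLIE.measurePreserving.integral_comp conjLIE.toHomeomorph.measurableEmbedding
    (fun w => G (w + c))

lemma avg_conj_add (f : ℂ → ℝ) (Φ : ℂ → E) (t : ℝ) (z c : ℂ) :
    avg volume f Φ t (conj z + c) =
      avg volume (fun w => f (conj w + c)) (fun u => Φ (conj u)) t z := by
  rw [avg, ← integral_conj_add _ c, avg]
  refine integral_congr_ae (Eventually.of_forall fun w => ?_)
  have : t⁻¹ • (conj z + c - (conj w + c)) = conj (t⁻¹ • (z - w)) := by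
    simp
  simp only [this]

lemma theta_conj (u : ℂ) : theta (conj u) = theta u := theta_eq_of_norm_eq (norm_conj u)

lemma rho_conj (u : ℂ) : rho (conj u) = rho u := rho_eq_of_norm_eq (norm_conj u)

lemma thetaI_conj (u : ℂ) : thetaI (conj u) = -thetaI u := by
  rw [thetaI_eq, thetaI_eq, rho_conj, conj_im]; ring

/-- Extension of a function on the strip, odd about `Im = -1` and even about `Im = 0`. -/
noncomputable def ext (F : ℂ → ℝ) (w : ℂ) : ℝ :=
  Real.sign (w.im + 1) * F (w.re - (|1 - abs (w.im + 1)| : ℝ) * I)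

variable {F G : ℂ → ℝ}

lemma ext_eq {w : ℂ} (h : w ∈ OmegaS) : ext F w = F w := by
  obtain ⟨h1, h2⟩ := h
  have e : |1 - abs (w.im + 1)| = -w.im := by
    rw [abs_of_pos (by linarith : 0 < w.im + 1), abs_of_pos (by linarith)]; ring
  rw [ext, Real.sign_of_pos (by linarith), e, one_mul]
  congr 1
  apply Complex.ext <;> simp

lemma ext_conj_sub (w : ℂ) : ext F (conj w + (-2 * I)) = -ext F w := by
  have e : (conj w + (-2 * I)).im + 1 = -(w.im + 1) := by simp; linarith
  have e' : (conj w + (-2 * I)).re = w.re := by simp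
  rw [ext, ext, e, e', Real.sign_neg, abs_neg]; ring

lemma ext_conj {w : ℂ} (hw : |w.im| < 1) : ext F (conj w) = ext F w := by
  obtain ⟨h1, h2⟩ := abs_lt.1 hw
  rw [ext, ext, conj_im, conj_re, Real.sign_of_pos (by linarith), Real.sign_of_pos (by linarith),
    abs_of_pos (by linarith : 0 < -w.im + 1), abs_of_pos (by linarith : 0 < w.im + 1)]
  have e : |1 - (-w.im + 1)| = |1 - (w.im + 1)| := by rw [← abs_neg]; congr 1; ring
  rw [e]

lemma measurable_sign : Measurable Real.sign := by
  unfold Real.sign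
  exact Measurable.ite measurableSet_Iio measurable_const
    (Measurable.ite measurableSet_Ioi measurable_const measurable_const)

lemma measurable_ext (hF : Measurable F) : Measurable (ext F) := by
  refine (measurable_sign.comp (by fun_prop)).mul (hF.comp ?_)
  fun_prop

lemma abs_sign_le (x : ℝ) : |Real.sign x| ≤ 1 := by
  rcases Real.sign_apply_eq x with h | h | h <;> rw [h] <;> norm_num

lemma abs_ext_le (w : ℂ) : |ext F w| ≤ |F (w.re - (|1 - abs (w.im + 1)| : ℝ) * I)| := by
  rw [ext, abs_mul]
  exact mul_le_of_le_one_left (abs_nonneg _) (abs_sign_le _)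

lemma sign_nonneg' {x : ℝ} (hx : 0 ≤ x) : 0 ≤ Real.sign x := by
  rcases hx.eq_or_lt with rfl | h
  · simp
  · simp [Real.sign_of_pos h]

lemma ext_nonneg (hF : ∀ w, 0 ≤ F w) {w : ℂ} (hw : -1 ≤ w.im) : 0 ≤ ext F w :=
  mul_nonneg (sign_nonneg' (by linarith)) (hF _)

lemma ext_nonpos (hF : ∀ w, 0 ≤ F w) {w : ℂ} (hw : w.im ≤ -1) : ext F w ≤ 0 := by
  refine mul_nonpos_of_nonpos_of_nonneg ?_ (hF _)
  have := sign_nonneg' (x := -(w.im + 1)) (by linarith)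
  rw [Real.sign_neg] at this
  linarith

lemma ext_add (w : ℂ) : ext (fun w => F w + G w) w = ext F w + ext G w := by
  simp only [ext]; ring

lemma ext_const_mul (a : ℝ) (w : ℂ) : ext (fun w => a * F w) w = a * ext F w := by
  simp only [ext]; ring

lemma avg_ext_reflect {Φ : ℂ → ℝ} (hΦ : ∀ u, Φ (conj u) = Φ u) (t : ℝ) (z : ℂ) :
    avg volume (ext F) Φ t (conj z + (-2 * I)) = -avg volume (ext F) Φ t z := by
  rw [avg_conj_add]
  simp only [ext_conj_sub, hΦ, avg, neg_smul, integral_neg]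

lemma avg_ext_bottom {Φ : ℂ → ℝ} (hΦ : ∀ u, Φ (conj u) = Φ u) (t x : ℝ) :
    avg volume (ext F) Φ t ((x : ℂ) - I) = 0 := by
  have h := avg_ext_reflect (F := F) hΦ t ((x : ℂ) - I)
  have e : conj ((x : ℂ) - I) + (-2 * I) = (x : ℂ) - I := by
    simp only [map_sub, conj_ofReal, conj_I]; ring
  rw [e] at h
  linarith

lemma avg_ext_thetaI {t : ℝ} (ht : t ∈ Ioc (0 : ℝ) 1) (x : ℝ) :
    avg volume (ext F) thetaI t (x : ℂ) = 0 := by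
  have h := avg_conj_add (ext F) thetaI t (x : ℂ) 0
  have h' : avg volume (fun w => ext F (conj w + 0)) (fun u => thetaI (conj u)) t (x : ℂ) =
      -avg volume (ext F) thetaI t (x : ℂ) := by
    simp only [avg, ← integral_neg]
    refine integral_congr_ae (Eventually.of_forall fun w => ?_)
    simp only [add_zero, thetaI_conj]
    by_cases hw : |w.im| < 1
    · rw [ext_conj hw, smul_neg]
    · have := suppHalf_thetaI.dilate ht.1 (z := (x : ℂ)) (w := w) (by
        have := Complex.abs_im_le_norm ((x : ℂ) - w)
        simp only [sub_im, ofReal_im, zero_sub, abs_neg] at this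
        linarith [ht.2])
      rw [this]; simp
  rw [h', add_zero, conj_ofReal] at h
  linarith

lemma norm_sub_le_norm_reflect {z w : ℂ} (hz : -1 ≤ z.im) (hw : -1 ≤ w.im) :
    ‖z - w‖ ≤ ‖conj z + (-2 * I) - w‖ := by
  rw [Complex.norm_def, Complex.norm_def]
  refine Real.sqrt_le_sqrt ?_
  simp only [normSq_apply, sub_re, sub_im, add_re, add_im, conj_re, conj_im]
  simp
  nlinarith [mul_nonneg (by linarith : 0 ≤ z.im + 1) (by linarith : 0 ≤ w.im + 1)]

lemma norm_reflect_le_norm_sub {z w : ℂ} (hz : -1 ≤ z.im) (hw : w.im ≤ -1) :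
    ‖conj z + (-2 * I) - w‖ ≤ ‖z - w‖ := by
  rw [Complex.norm_def, Complex.norm_def]
  refine Real.sqrt_le_sqrt ?_
  simp only [normSq_apply, sub_re, sub_im, add_re, add_im, conj_re, conj_im]
  simp
  nlinarith [mul_nonneg (by linarith : 0 ≤ z.im + 1) (by linarith : 0 ≤ -1 - w.im)]

lemma avg_ext_rho_nonneg (hF : ∀ w, 0 ≤ F w) (hi : LocallyIntegrable (ext F) volume) {z : ℂ}
    (hz : -1 ≤ z.im) : 0 ≤ avg volume (ext F) rho 1 z := by
  have hr := avg_ext_reflect (F := F) rho_conj 1 z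
  have hc := contDiff_rho.continuous
  have : 0 ≤ avg volume (ext F) rho 1 z - avg volume (ext F) rho 1 (conj z + (-2 * I)) := by
    rw [avg, avg, ← integral_sub (integrable_avg hi hc suppHalf_rho one_pos _)
      (integrable_avg hi hc suppHalf_rho one_pos _)]
    refine integral_nonneg fun w => ?_
    simp only [inv_one, one_smul, Pi.zero_apply, smul_eq_mul, ← mul_sub]
    rcases le_total (-1) w.im with hw | hw
    · exact mul_nonneg (ext_nonneg hF hw)
        (sub_nonneg.2 (rho_anti (norm_sub_le_norm_reflect hz hw)))
    · exact mul_nonneg_of_nonpos_of_nonpos (ext_nonpos hF hw)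
        (sub_nonpos.2 (rho_anti (norm_reflect_le_norm_sub hz hw)))
  linarith

lemma pot_ext_bottom (x : ℝ) (k : ℕ) : pot volume (ext F) theta k ((x : ℂ) - I) = 0 := by
  simp [pot, avg_ext_bottom theta_conj]

section Volume

variable {f : ℂ → ℝ} {M : ℝ}

lemma hasFDerivAt_pot_volume (hf : Measurable f) (hM : ∀ w, |f w| ≤ M) (z : ℂ) :
    HasFDerivAt (pot volume f theta 1) (pot volume f (fderiv ℝ theta) 2 z) z :=
  hasFDerivAt_pot isOpen_univ
    (dom_of_growth growth_volume (by norm_num) contDiff_theta.continuous suppHalf_theta fun _ _ w _ => hM w)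
    (dom_of_growth growth_volume (by norm_num) contDiff_fderiv_theta.continuous
      suppHalf_theta.fderiv fun _ _ w _ => hM w) hf (locallyIntegrable_of_bounded hf hM)
    (contDiff_theta.of_le (by norm_num)) suppHalf_theta (mem_univ z)

lemma contDiff_pot_volume (hf : Measurable f) (hM : ∀ w, |f w| ≤ M) :
    ContDiff ℝ 1 (pot volume f theta 1) := by
  rw [contDiff_one_iff_fderiv]
  refine ⟨fun z => (hasFDerivAt_pot_volume hf hM z).differentiableAt, ?_⟩
  rw [funext fun z => (hasFDerivAt_pot_volume hf hM z).fderiv, ← continuousOn_univ]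
  exact continuousOn_pot
    (dom_of_growth growth_volume (by norm_num) contDiff_fderiv_theta.continuous
      suppHalf_theta.fderiv fun _ _ w _ => hM w) hf (locallyIntegrable_of_bounded hf hM)
      contDiff_fderiv_theta.continuous suppHalf_theta.fderiv

lemma abs_ext_le_of_bound (hM : ∀ w, |F w| ≤ M) (w : ℂ) : |ext F w| ≤ M :=
  (abs_ext_le w).trans (hM _)

lemma fderiv_pot_ext_top (hF : Measurable F) (hM : ∀ w, |F w| ≤ M) (x : ℝ) :
    fderiv ℝ (pot volume (ext F) theta 1) (x : ℂ) I = 0 := by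
  have hm := measurable_ext hF
  have hM' := abs_ext_le_of_bound hM
  obtain ⟨L, hL⟩ : ∃ L : (ℂ →L[ℝ] ℝ) →L[ℝ] ℝ, ∀ A, L A = A I :=
    ⟨ContinuousLinearMap.apply ℝ ℝ I, fun A => rfl⟩
  rw [(hasFDerivAt_pot_volume hm hM' _).fderiv, ← hL, pot_apply L
    (dom_of_growth (k := 2) growth_volume (by norm_num) contDiff_fderiv_theta.continuous
      suppHalf_theta.fderiv fun _ _ w _ => hM' w) hm (locallyIntegrable_of_bounded hm hM')
      contDiff_fderiv_theta.continuous suppHalf_theta.fderiv (mem_univ _)]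
  simp only [hL]
  change pot volume (ext F) thetaI 2 _ = 0
  rw [pot, intervalIntegral.integral_congr_ae (g := fun _ => 0), intervalIntegral.integral_zero]
  rw [uIoc_of_le zero_le_one]
  exact Eventually.of_forall fun t ht => by simp [avg_ext_thetaI ht]

end Volume

end Reflection

section Wave

/-- Product of an exponential along the strip and a sine across it. -/
noncomputable def wave (κ l η : ℝ) (w : ℂ) : ℝ :=
  Real.exp (κ * w.re) * Real.sin (l * (1 + w.im) + η)

variable {κ l η : ℝ}

lemma contDiff_wave {n : WithTop ℕ∞} : ContDiff ℝ n (wave κ l η) := by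
  have hre : ContDiff ℝ n (fun w : ℂ => w.re) := reCLM.contDiff
  have him : ContDiff ℝ n (fun w : ℂ => w.im) := imCLM.contDiff
  exact (contDiff_const.mul hre).exp.mul
    ((contDiff_const.mul (contDiff_const.add him)).add contDiff_const).sin

lemma hasFDerivAt_wave (w : ℂ) : HasFDerivAt (wave κ l η)
    ((κ * wave κ l η w) • reCLM + (l * wave κ l (η + Real.pi / 2) w) • imCLM) w := by
  have hre : HasFDerivAt (fun w : ℂ => w.re) reCLM w := reCLM.hasFDerivAt
  have him : HasFDerivAt (fun w : ℂ => w.im) imCLM w := imCLM.hasFDerivAt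
  refine ((hre.const_mul κ).exp.mul (((him.const_add 1).const_mul l).add_const η).sin).congr_fderiv
    ?_
  refine ContinuousLinearMap.ext fun v => ?_
  simp only [wave, ← add_assoc, Real.sin_add_pi_div_two, add_apply, smul_apply, smul_eq_mul,
    reCLM_apply, imCLM_apply]
  ring

lemma fderiv_wave_one (w : ℂ) : fderiv ℝ (wave κ l η) w 1 = κ * wave κ l η w := by
  rw [(hasFDerivAt_wave w).fderiv]; simp

lemma fderiv_wave_I (w : ℂ) :
    fderiv ℝ (wave κ l η) w I = l * wave κ l (η + Real.pi / 2) w := by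
  rw [(hasFDerivAt_wave w).fderiv]; simp

lemma lap_const_mul_wave (k : ℝ) (z : ℂ) :
    lap (fun w => k * wave κ l η w) z = k * ((κ ^ 2 - l ^ 2) * wave κ l η z) := by
  have hd : ∀ e w, DifferentiableAt ℝ (wave κ l e) w := fun e w =>
    (hasFDerivAt_wave w).differentiableAt
  have h1 : ∀ w, fderiv ℝ (fun w => k * wave κ l η w) w 1 = (k * κ) * wave κ l η w := fun w => by
    rw [fderiv_const_mul (hd _ _)]; simp [fderiv_wave_one]; ring
  have h2 : ∀ w, fderiv ℝ (fun w => k * wave κ l η w) w I =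
      (k * l) * wave κ l (η + Real.pi / 2) w := fun w => by
    rw [fderiv_const_mul (hd _ _)]; simp [fderiv_wave_I]; ring
  have h3 : wave κ l (η + Real.pi / 2 + Real.pi / 2) z = -wave κ l η z := by
    simp only [wave, ← add_assoc, Real.sin_add_pi_div_two, Real.cos_add_pi_div_two]; ring
  simp only [lap, h1, h2]
  rw [fderiv_const_mul (hd _ _), fderiv_const_mul (hd _ _), smul_apply, smul_apply,
    fderiv_wave_one, fderiv_wave_I, h3]
  simp only [smul_eq_mul]
  ring

/-- The factor by which a dilated average multiplies a wave. -/
noncomputable def coef (κ l : ℝ) (Φ : ℂ → ℝ) (t : ℝ) : ℝ :=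
  ∫ u : ℂ, Real.exp (-κ * u.re) * Real.cos (l * u.im) * Φ (t⁻¹ • u)

variable {Φ : ℂ → ℝ}

lemma avg_wave (hΦ : Continuous Φ) (hs : SuppHalf Φ) (hc : ∀ u, Φ (conj u) = Φ u) {t : ℝ}
    (ht : 0 < t) (z : ℂ) : avg volume (wave κ l η) Φ t z = coef κ l Φ t * wave κ l η z := by
  have hΦt : Continuous fun u : ℂ => Φ (t⁻¹ • u) := hΦ.comp (continuous_const_smul _)
  have hi : ∀ G : ℂ → ℝ, Continuous G → Integrable (fun u => G u * Φ (t⁻¹ • u)) volume :=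
    fun G hG => (hG.mul hΦt).integrable_of_hasCompactSupport
      ((hs.hasCompactSupport_dilate ht).mul_left)
  set c : ℝ := Real.exp (κ * z.re) with hc'
  set A : ℝ := l * (1 + z.im) + η with hA
  have h0 : ∫ u : ℂ, (Real.exp (-κ * u.re) * Real.sin (l * u.im)) * Φ (t⁻¹ • u) = 0 := by
    have h := integral_conj_add
      (fun u : ℂ => (Real.exp (-κ * u.re) * Real.sin (l * u.im)) * Φ (t⁻¹ • u)) 0
    have e : ∀ u : ℂ, t⁻¹ • conj u = conj (t⁻¹ • u) := fun u => by simp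
    simp only [add_zero, conj_re, conj_im, e, hc, mul_neg, Real.sin_neg, neg_mul,
      integral_neg] at h
    simp only [neg_mul]
    linarith
  rw [avg, ← integral_sub_left_eq_self _ volume z]
  have e : ∀ u : ℂ, wave κ l η (z - u) • Φ (t⁻¹ • (z - (z - u))) =
      (c * Real.sin A) * ((Real.exp (-κ * u.re) * Real.cos (l * u.im)) * Φ (t⁻¹ • u)) -
      (c * Real.cos A) * ((Real.exp (-κ * u.re) * Real.sin (l * u.im)) * Φ (t⁻¹ • u)) := fun u => by
    have e1 : κ * (z - u).re = κ * z.re + -κ * u.re := by simp; ring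
    have e2 : l * (1 + (z - u).im) + η = A - l * u.im := by simp [hA]; ring
    rw [wave, e1, e2, Real.exp_add, Real.sin_sub, sub_sub_cancel, smul_eq_mul]
    ring
  simp only [e]
  rw [integral_sub ((hi _ (by fun_prop)).const_mul _) ((hi _ (by fun_prop)).const_mul _),
    integral_const_mul, integral_const_mul, h0, coef, wave]
  ring

lemma coef_pos (hΦ : Continuous Φ) (hs : SuppHalf Φ) (h0 : ∀ u, 0 ≤ Φ u) (hp : 0 < Φ 0)
    (hl : 0 < l) (hl' : l < Real.pi / 2) {t : ℝ} (ht : t ∈ Ioc (0 : ℝ) 1) : 0 < coef κ l Φ t := by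
  have hΦt : Continuous fun u : ℂ => Φ (t⁻¹ • u) := hΦ.comp (continuous_const_smul _)
  refine Continuous.integral_pos_of_hasCompactSupport_nonneg_nonzero (x := 0)
    ((by fun_prop : Continuous fun u : ℂ => Real.exp (-κ * u.re) * Real.cos (l * u.im)).mul hΦt)
    ((hs.hasCompactSupport_dilate ht.1).mul_left) (fun u => ?_) ?_
  · by_cases hu : 1 / 2 < ‖u‖
    · have := hs.dilate ht.1 (z := u) (w := 0) (by rw [sub_zero]; linarith [ht.2])
      rw [sub_zero] at this
      simp only [Pi.zero_apply, this, mul_zero, le_refl]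
    · have h1 := (Complex.abs_im_le_norm u).trans (not_lt.1 hu)
      have h2 : |l * u.im| ≤ l * (1 / 2) := by
        rw [abs_mul, abs_of_pos hl]; exact mul_le_mul_of_nonneg_left h1 hl.le
      have h3 := abs_le.1 h2
      exact mul_nonneg (mul_nonneg (Real.exp_pos _).le
        (Real.cos_nonneg_of_mem_Icc ⟨by linarith, by linarith⟩)) (h0 _)
  · simp [hp.ne']

lemma coef_rho_lt (hκ : |κ| < l) (hl' : l < Real.pi / 2) : coef κ l rho 1 < rhoMass := by
  have hl : 0 < l := (abs_nonneg κ).trans_lt hκ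
  have hcont : Continuous (wave κ l (Real.pi / 2)) := (contDiff_wave (n := 1)).continuous
  have hloc : LocallyIntegrable (wave κ l (Real.pi / 2)) volume := hcont.locallyIntegrable
  obtain ⟨M, hM⟩ := (isCompact_closedBall (-I) 1).exists_bound_of_continuousOn
    (f := wave κ l (Real.pi / 2)) hcont.continuousOn
  have h1 : wave κ l (Real.pi / 2) (-I) = 1 := by simp [wave]
  have hdom : Dom volume (wave κ l (Real.pi / 2)) theta 1 {-I} :=
    dom_of_growth (M := M) growth_volume (by norm_num) contDiff_theta.continuous suppHalf_theta
      fun z hz w hw => hM w (by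
        rw [mem_closedBall, dist_eq_norm, ← norm_neg, neg_sub, ← mem_singleton_iff.1 hz]
        linarith)
  have hint := hdom.intervalIntegrable hcont.measurable contDiff_theta.continuous (mem_singleton _)
  have hpot : pot volume (wave κ l (Real.pi / 2)) theta 1 =
      fun z => (∫ t in (0 : ℝ)..1, (t ^ 1)⁻¹ • coef κ l theta t) * wave κ l (Real.pi / 2) z := by
    funext z
    rw [pot, ← intervalIntegral.integral_mul_const]
    refine intervalIntegral.integral_congr_ae ?_
    rw [uIoc_of_le zero_le_one]
    refine Eventually.of_forall fun t ht => ?_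
    rw [avg_wave contDiff_theta.continuous suppHalf_theta theta_conj ht.1, smul_eq_mul,
      smul_eq_mul, mul_assoc]
  have hk : 0 < ∫ t in (0 : ℝ)..1, (t ^ 1)⁻¹ • coef κ l theta t := by
    refine intervalIntegral.intervalIntegral_pos_of_pos_on ?_ (fun t ht => ?_) one_pos
    · refine hint.congr ?_
      rw [uIoc_of_le zero_le_one]
      intro t ht
      simp only [avg_wave contDiff_theta.continuous suppHalf_theta theta_conj ht.1, h1, mul_one]
    · refine smul_pos (by have := ht.1; positivity) (coef_pos contDiff_theta.continuous
        suppHalf_theta theta_nonneg ?_ hl hl' ⟨ht.1, ht.2.le⟩)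
      simp [theta, bump]
  have hreg := (pot_volume_regularity hcont.measurable hloc hM
    (holdAt_of_contDiffAt contDiff_wave.contDiffAt univ)).2
  rw [hpot, lap_const_mul_wave, h1, avg_wave contDiff_rho.continuous suppHalf_rho rho_conj one_pos,
    h1] at hreg
  have : κ ^ 2 < l ^ 2 := by rw [← sq_abs]; gcongr
  nlinarith

end Wave

section Lap

variable {f g : ℂ → ℝ} {z : ℂ}

lemma eventually_differentiableAt (hf : ContDiffAt ℝ 2 f z) :
    ∀ᶠ w in 𝓝 z, DifferentiableAt ℝ f w :=
  (hf.eventually (by norm_num)).mono fun _ h => h.differentiableAt (by norm_num)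

lemma differentiableAt_fderiv_apply (hf : ContDiffAt ℝ 2 f z) (v : ℂ) :
    DifferentiableAt ℝ (fun w => fderiv ℝ f w v) z :=
  ((hf.fderiv_right (m := 1) (by norm_num)).differentiableAt (by norm_num)).clm_apply
    (differentiableAt_const v)

lemma lap_add (hf : ContDiffAt ℝ 2 f z) (hg : ContDiffAt ℝ 2 g z) :
    lap (fun w => f w + g w) z = lap f z + lap g z := by
  have h : ∀ v, fderiv ℝ (fun w => fderiv ℝ (fun w => f w + g w) w v) z v =
      fderiv ℝ (fun w => fderiv ℝ f w v) z v + fderiv ℝ (fun w => fderiv ℝ g w v) z v := by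
    intro v
    have e : (fun w => fderiv ℝ (fun w => f w + g w) w v) =ᶠ[𝓝 z]
        fun w => fderiv ℝ f w v + fderiv ℝ g w v := by
      filter_upwards [eventually_differentiableAt hf, eventually_differentiableAt hg] with w h1 h2
      rw [fderiv_fun_add h1 h2, add_apply]
    rw [e.fderiv_eq, fderiv_fun_add (differentiableAt_fderiv_apply hf v)
      (differentiableAt_fderiv_apply hg v), add_apply]
  rw [lap, h, h, lap, lap]; ring

lemma lap_const_mul (hf : ContDiffAt ℝ 2 f z) (a : ℝ) :
    lap (fun w => a * f w) z = a * lap f z := by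
  have h : ∀ v, fderiv ℝ (fun w => fderiv ℝ (fun w => a * f w) w v) z v =
      a * fderiv ℝ (fun w => fderiv ℝ f w v) z v := by
    intro v
    have e : (fun w => fderiv ℝ (fun w => a * f w) w v) =ᶠ[𝓝 z]
        fun w => a * fderiv ℝ f w v := by
      filter_upwards [eventually_differentiableAt hf] with w h1
      rw [fderiv_const_mul h1, smul_apply, smul_eq_mul]
    rw [e.fderiv_eq, fderiv_const_mul (differentiableAt_fderiv_apply hf v), smul_apply,
      smul_eq_mul]
  rw [lap, h, h, lap]; ring

lemma deriv_deriv_nonpos_of_isLocalMax {h : ℝ → ℝ} {x : ℝ} (hm : IsLocalMax h x)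
    (hc : ContinuousAt h x) : deriv (deriv h) x ≤ 0 := by
  by_contra! hpos
  have hmin := isLocalMin_of_deriv_deriv_pos hpos hm.deriv_eq_zero hc
  have he : h =ᶠ[𝓝 x] fun _ => h x := by
    filter_upwards [hm, hmin] with y h1 h2 using le_antisymm h1 h2
  have : deriv (deriv h) x = 0 := by
    rw [he.deriv.deriv_eq]; simp
  linarith

lemma lap_nonpos_of_isLocalMax (hf : ContDiffAt ℝ 2 f z) (hm : IsLocalMax f z) : lap f z ≤ 0 := by
  have key : ∀ v, fderiv ℝ (fun w => fderiv ℝ f w v) z v ≤ 0 := by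
    intro v
    set p : ℝ → ℂ := fun s => z + s • v with hp
    have hp' : ∀ s, HasDerivAt p v s := fun s => by
      have := ((hasDerivAt_id s).smul_const v).const_add z
      rwa [one_smul] at this
    have hp0 : p 0 = z := by simp [hp]
    have hpt : Tendsto p (𝓝 0) (𝓝 z) := by
      have := (hp' 0).continuousAt.tendsto
      rwa [hp0] at this
    have hd : deriv (fun s => f (p s)) =ᶠ[𝓝 0] fun s => fderiv ℝ f (p s) v := by
      filter_upwards [hpt.eventually (eventually_differentiableAt hf)] with s hs
      exact (hs.hasFDerivAt.comp_hasDerivAt s (hp' s)).deriv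
    have hdd : deriv (deriv fun s => f (p s)) 0 = fderiv ℝ (fun w => fderiv ℝ f w v) z v := by
      rw [hd.deriv_eq]
      have h2 := (differentiableAt_fderiv_apply hf v).hasFDerivAt
      rw [← hp0] at h2
      rw [← hp0]
      exact (h2.comp_hasDerivAt (0 : ℝ) (hp' 0)).deriv
    rw [← hdd]
    refine deriv_deriv_nonpos_of_isLocalMax ?_ ?_
    · have : ∀ᶠ s in 𝓝 (0 : ℝ), f (p s) ≤ f z := hpt.eventually hm
      filter_upwards [this] with s hs
      rwa [hp0]
    · refine ContinuousAt.comp ?_ (hp' 0).continuousAt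
      rw [hp0]; exact hf.continuousAt
  exact add_nonpos (key 1) (key I)

end Lap

section MaximumPrinciple

lemma exp_neg_abs_le {μ κ : ℝ} (hκ : |κ| = μ) (x : ℝ) : Real.exp (-μ * |x|) ≤ Real.exp (κ * x) := by
  refine Real.exp_le_exp.2 ?_
  have := neg_abs_le (κ * x)
  rw [abs_mul, hκ] at this
  linarith

variable {l η : ℝ}

lemma sin_pos_of_strip (hl : 0 < l) (hη : 0 < η) (hlη : l + η < Real.pi / 2) {y : ℝ}
    (hy : -1 ≤ y) (hy' : y ≤ 0) : Real.sin η ≤ Real.sin (l * (1 + y) + η) ∧ 0 < Real.sin η := by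
  refine ⟨Real.sin_le_sin_of_le_of_le_pi_div_two (by linarith [Real.pi_pos]) ?_ ?_,
    Real.sin_pos_of_pos_of_lt_pi hη (by linarith [Real.pi_pos])⟩
  · nlinarith
  · nlinarith

lemma wave_pos (hl : 0 < l) (hη : 0 < η) (hlη : l + η < Real.pi / 2) {z : ℂ}
    (hz : z ∈ closure OmegaS) (κ : ℝ) : 0 < wave κ l η z := by
  rw [closure_OmegaS] at hz
  obtain ⟨h1, h2⟩ := sin_pos_of_strip hl hη hlη hz.1 hz.2
  exact mul_pos (Real.exp_pos _) (h2.trans_le h1)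

lemma le_barrier {μ τ c H A ε κ : ℝ} (hμ : 0 < μ) (hμl : μ < l) (hη : 0 < η)
    (hlη : l + η < Real.pi / 2) (hc : 0 < c)
    (hτ : c ≤ l * Real.cos (l + η) - τ * Real.sin (l + η)) (hH : 0 ≤ H) {φ : ℂ → ℝ} {g : ℝ → ℝ}
    (hφc : ContinuousOn φ (closure OmegaS)) (hφ2 : ∀ z ∈ OmegaS, ContDiffAt ℝ 2 φ z)
    (hlap : ∀ z ∈ OmegaS, lap φ z = 0) (hbot : ∀ x : ℝ, φ ((x : ℂ) - I) = 0)
    (hA : ∀ z ∈ closure OmegaS, |φ z| ≤ A * Real.exp (-μ * |z.re|))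
    (htop : ∀ x : ℝ, HasDerivWithinAt (fun y : ℝ => φ (x + y * I)) (g x) (Iic 0) 0)
    (hg : ∀ x : ℝ, g x - τ * φ x ≤ H * Real.exp (-μ * |x|)) (hκ : |κ| = μ) (hε : 0 < ε)
    {z : ℂ} (hz : z ∈ closure OmegaS) :
    φ z ≤ H / c * (wave κ l η z + ε * wave (-κ) l η z) := by
  have hl : 0 < l := hμ.trans hμl
  set S : ℂ → ℝ := fun z => wave κ l η z + ε * wave (-κ) l η z with hS
  have hSpos : ∀ z ∈ closure OmegaS, 0 < S z := fun z hz =>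
    add_pos (wave_pos hl hη hlη hz κ) (mul_pos hε (wave_pos hl hη hlη hz (-κ)))
  have hS2 : ContDiff ℝ 2 S := contDiff_wave.add (contDiff_const.mul contDiff_wave)
  have hSlap : ∀ z, lap S z = (μ ^ 2 - l ^ 2) * S z := fun z => by
    rw [hS, lap_add contDiff_wave.contDiffAt (contDiff_const.mul contDiff_wave).contDiffAt,
      lap_const_mul_wave]
    have := lap_const_mul_wave (κ := κ) (l := l) (η := η) 1 z
    simp only [one_mul] at this
    rw [this, ← hκ, sq_abs]; ring
  by_contra! hcon
  -- the ratio attains its maximum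
  have hq : ContinuousOn (fun z => φ z / S z) (closure OmegaS) :=
    hφc.div hS2.continuous.continuousOn fun z hz => (hSpos z hz).ne'
  have hQ0 : H / c < φ z / S z := by rwa [lt_div_iff₀ (hSpos z hz)]
  have hHc : 0 ≤ H / c := by positivity
  obtain ⟨z₁, hz₁, hmax⟩ : ∃ z₁ ∈ closure OmegaS,
      IsMaxOn (fun z => φ z / S z) (closure OmegaS) z₁ := by
    refine hq.exists_isMaxOn' isClosed_closure hz ?_
    set m : ℝ := min 1 ε with hm
    have hm0 : 0 < m := lt_min one_pos hε
    have hA0 : 0 ≤ A := by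
      have := (abs_nonneg _).trans (hA z hz)
      exact nonneg_of_mul_nonneg_left this (Real.exp_pos _)
    obtain ⟨-, hsη⟩ := sin_pos_of_strip hl hη hlη (y := 0) (by norm_num) le_rfl
    have hlow : ∀ w ∈ closure OmegaS, Real.sin η * m * Real.exp (μ * |w.re|) ≤ S w := by
      intro w hw
      have hw' := hw
      rw [closure_OmegaS] at hw'
      obtain ⟨h1, -⟩ := sin_pos_of_strip hl hη hlη hw'.1 hw'.2
      have h2 : m * Real.exp (μ * |w.re|) ≤ Real.exp (κ * w.re) + ε * Real.exp (-κ * w.re) := by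
        have e1 := Real.exp_pos (κ * w.re)
        have e2 := Real.exp_pos (-κ * w.re)
        rw [← hκ, ← abs_mul]
        rcases abs_cases (κ * w.re) with ⟨h, -⟩ | ⟨h, -⟩ <;> rw [h]
        · nlinarith [min_le_left 1 ε]
        · rw [← neg_mul]; nlinarith [min_le_right 1 ε]
      calc Real.sin η * m * Real.exp (μ * |w.re|) = Real.sin η * (m * Real.exp (μ * |w.re|)) := by
            ring
        _ ≤ Real.sin (l * (1 + w.im) + η) * (Real.exp (κ * w.re) + ε * Real.exp (-κ * w.re)) :=
            mul_le_mul h1 h2 (by positivity) (hsη.le.trans h1)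
        _ = S w := by simp only [hS, wave]; ring
    have hup : ∀ w ∈ closure OmegaS,
        φ w / S w ≤ A / (Real.sin η * m) * Real.exp (-(μ * |w.re|)) := by
      intro w hw
      rw [div_le_iff₀ (hSpos w hw)]
      have h1 := (le_abs_self _).trans (hA w hw)
      have h2 := hlow w hw
      have h3 : Real.exp (-μ * |w.re|) ≤ 1 := Real.exp_le_one_iff.2 (by
        have := abs_nonneg w.re; nlinarith)
      calc φ w ≤ A * Real.exp (-μ * |w.re|) := h1
        _ ≤ A := mul_le_of_le_one_right hA0 h3
        _ = A / (Real.sin η * m) * Real.exp (-(μ * |w.re|)) *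
            (Real.sin η * m * Real.exp (μ * |w.re|)) := by
            rw [Real.exp_neg]; field_simp
        _ ≤ _ := mul_le_mul_of_nonneg_left h2 (by positivity)
    have hlim : Tendsto (fun w : ℂ => A / (Real.sin η * m) * Real.exp (-(μ * |w.re|)))
        (cocompact ℂ ⊓ 𝓟 (closure OmegaS)) (𝓝 0) := by
      rw [show (0 : ℝ) = A / (Real.sin η * m) * 0 by ring]
      refine Tendsto.const_mul _ (Real.tendsto_exp_neg_atTop_nhds_zero.comp
        (Tendsto.const_mul_atTop hμ ?_))
      refine tendsto_atTop_mono' _ (f₁ := fun w : ℂ => ‖w‖ + (-1)) ?_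
        (tendsto_atTop_add_const_right _ _ (tendsto_norm_cocompact_atTop.mono_left inf_le_left))
      filter_upwards [mem_inf_of_right (mem_principal_self _)] with w hw
      rw [closure_OmegaS] at hw
      have := norm_le_abs_re_add_abs_im w
      have h4 : |w.im| ≤ 1 := abs_le.2 ⟨hw.1, hw.2.trans zero_le_one⟩
      linarith
    filter_upwards [hlim.eventually (gt_mem_nhds (hHc.trans_lt hQ0)),
      mem_inf_of_right (mem_principal_self _)] with w h1 h2
    exact (hup w h2).trans h1.le
  set Q := φ z₁ / S z₁ with hQ
  have hQH : H / c < Q := hQ0.trans_le (hmax hz)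
  have hQpos : 0 < Q := hHc.trans_lt hQH
  have hle : ∀ w ∈ closure OmegaS, φ w ≤ Q * S w := fun w hw => by
    rw [← div_le_iff₀ (hSpos w hw)]; exact hmax hw
  have heq : φ z₁ = Q * S z₁ := by rw [hQ, div_mul_cancel₀ _ (hSpos z₁ hz₁).ne']
  have hz₁' := hz₁
  rw [closure_OmegaS] at hz₁'
  rcases hz₁'.1.eq_or_lt with hb | hb
  · have : z₁ = (z₁.re : ℂ) - I := by apply Complex.ext <;> simp [← hb]
    have h0 := hbot z₁.re
    rw [← this, heq] at h0
    exact (mul_pos hQpos (hSpos z₁ hz₁)).ne' h0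
  rcases hz₁'.2.eq_or_lt with ht | ht
  · have hx : z₁ = (z₁.re : ℂ) := by apply Complex.ext <;> simp [ht]
    set x := z₁.re
    have hd := (htop x).sub
      ((((hS2.differentiable (by norm_num)).differentiableAt (x := z₁)).hasFDerivAt.const_mul
        Q).comp_hasDerivWithinAt_of_eq (0 : ℝ) (s := Iic 0)
        (f := fun y : ℝ => (x : ℂ) + y * I) (f' := I) ?_ (by simpa using hx))
    · have hSd : fderiv ℝ S z₁ I = l * Real.cos (l + η) *
          (Real.exp (κ * x) + ε * Real.exp (-κ * x)) := by
        rw [hS, fderiv_fun_add (hasFDerivAt_wave _).differentiableAt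
          ((hasFDerivAt_wave _).differentiableAt.const_mul _),
          fderiv_const_mul (hasFDerivAt_wave _).differentiableAt, add_apply, smul_apply,
          fderiv_wave_I, fderiv_wave_I]
        simp only [wave, ht, ← add_assoc, Real.sin_add_pi_div_two, smul_eq_mul]
        rw [show z₁.re = x from rfl]
        simp
        ring
      have hSv : S z₁ = Real.sin (l + η) * (Real.exp (κ * x) + ε * Real.exp (-κ * x)) := by
        simp only [hS, wave, ht]
        rw [show z₁.re = x from rfl]
        simp
        ring
      have hnn : 0 ≤ g x - Q * fderiv ℝ S z₁ I := by
        have hloc : IsLocalMaxOn (fun y : ℝ => φ (x + y * I) - Q * S (x + y * I)) (Iic 0) 0 := by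
          filter_upwards [self_mem_nhdsWithin,
            mem_nhdsWithin_of_mem_nhds (Ioi_mem_nhds (show (-1 : ℝ) < 0 by norm_num))] with y h1 h2
          have e0 : φ (x + ((0 : ℝ) : ℂ) * I) - Q * S (x + ((0 : ℝ) : ℂ) * I) = 0 := by
            simp only [ofReal_zero, zero_mul, add_zero, ← hx, heq, sub_self]
          rw [e0]
          refine sub_nonpos.2 (hle _ ?_)
          rw [closure_OmegaS]
          simp only [mem_ofPred_eq, add_im, ofReal_im, mul_im, ofReal_re, I_im, mul_one, I_re,
            mul_zero, add_zero, zero_add]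
          exact ⟨(mem_Ioi.1 h2).le, h1⟩
        have h1 := hloc.hasFDerivWithinAt_nonpos hd.hasFDerivWithinAt (y := -1) (by
          refine mem_posTangentConeAt_of_segment_subset ?_
          rw [segment_symm, segment_eq_Icc (by norm_num)]
          intro y hy; exact hy.2.trans (by norm_num))
        simp at h1
        simpa using h1
      have hE : 0 < Real.exp (κ * x) + ε * Real.exp (-κ * x) := by positivity
      have hgx := hg x
      rw [← hx, heq, hSv] at hgx
      rw [hSd] at hnn
      set E := Real.exp (κ * x) + ε * Real.exp (-κ * x) with hEdef
      have hEx : Real.exp (-μ * |x|) ≤ E := by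
        have := exp_neg_abs_le hκ x
        have h5 := Real.exp_pos (-κ * x)
        rw [hEdef]; nlinarith
      have h6 : H < Q * c := by rwa [div_lt_iff₀ hc] at hQH
      have h7 : H * E < Q * c * E := mul_lt_mul_of_pos_right h6 hE
      have h8 : Q * E * c ≤ Q * E * (l * Real.cos (l + η) - τ * Real.sin (l + η)) :=
        mul_le_mul_of_nonneg_left hτ (by positivity)
      have h9 := mul_le_mul_of_nonneg_left hEx hH
      nlinarith
    · have : HasDerivAt (fun y : ℝ => (x : ℂ) + y * I) I 0 := by
        simpa using ((hasDerivAt_id (0 : ℝ)).ofReal_comp.mul_const I).const_add (x : ℂ)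
      exact this.hasDerivWithinAt
  · have hin : z₁ ∈ OmegaS := ⟨hb, ht⟩
    have hlm : IsLocalMax (fun w => φ w + -Q * S w) z₁ := by
      filter_upwards [isOpen_OmegaS.mem_nhds hin] with w hw
      have := hle w (subset_closure hw)
      rw [heq]; linarith
    have hn := lap_nonpos_of_isLocalMax ((hφ2 z₁ hin).add (contDiffAt_const.mul hS2.contDiffAt)) hlm
    rw [lap_add (hφ2 z₁ hin) (contDiffAt_const.mul hS2.contDiffAt), hlap z₁ hin,
      lap_const_mul hS2.contDiffAt, hSlap] at hn
    have h1 : 0 < (l ^ 2 - μ ^ 2) := by nlinarith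
    have h2 := mul_pos (mul_pos hQpos h1) (hSpos z₁ hz₁)
    nlinarith

lemma le_exp_of_harmonic {μ τ c H A : ℝ} (hμ : 0 < μ) (hμl : μ < l) (hη : 0 < η)
    (hlη : l + η < Real.pi / 2) (hc : 0 < c)
    (hτ : c ≤ l * Real.cos (l + η) - τ * Real.sin (l + η)) (hH : 0 ≤ H) {φ : ℂ → ℝ} {g : ℝ → ℝ}
    (hφc : ContinuousOn φ (closure OmegaS)) (hφ2 : ∀ z ∈ OmegaS, ContDiffAt ℝ 2 φ z)
    (hlap : ∀ z ∈ OmegaS, lap φ z = 0) (hbot : ∀ x : ℝ, φ ((x : ℂ) - I) = 0)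
    (hA : ∀ z ∈ closure OmegaS, |φ z| ≤ A * Real.exp (-μ * |z.re|))
    (htop : ∀ x : ℝ, HasDerivWithinAt (fun y : ℝ => φ (x + y * I)) (g x) (Iic 0) 0)
    (hg : ∀ x : ℝ, g x - τ * φ x ≤ H * Real.exp (-μ * |x|))
    {z : ℂ} (hz : z ∈ closure OmegaS) : φ z ≤ H / c * Real.exp (-μ * |z.re|) := by
  obtain ⟨κ, hκ, hκz⟩ : ∃ κ : ℝ, |κ| = μ ∧ κ * z.re = -μ * |z.re| := by
    rcases abs_cases z.re with ⟨h, -⟩ | ⟨h, -⟩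
    · exact ⟨-μ, by rw [abs_neg, abs_of_pos hμ], by rw [h]⟩
    · exact ⟨μ, abs_of_pos hμ, by rw [h]; ring⟩
  have hlim : Tendsto (fun ε : ℝ => H / c * (wave κ l η z + ε * wave (-κ) l η z)) (𝓝[>] 0)
      (𝓝 (H / c * wave κ l η z)) := by
    refine Tendsto.mono_left ?_ nhdsWithin_le_nhds
    have : Continuous fun ε : ℝ => H / c * (wave κ l η z + ε * wave (-κ) l η z) := by fun_prop
    simpa using this.tendsto 0
  refine (ge_of_tendsto hlim ?_).trans ?_
  · filter_upwards [self_mem_nhdsWithin] with ε hε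
    exact le_barrier hμ hμl hη hlη hc hτ hH hφc hφ2 hlap hbot hA htop hg hκ hε hz
  · refine mul_le_mul_of_nonneg_left ?_ (by positivity)
    rw [wave, hκz]
    exact mul_le_of_le_one_right (Real.exp_pos _).le (Real.sin_le_one _)

end MaximumPrinciple

section Layers

/-- Volume potential of a charge on the strip. -/
noncomputable def volPot (F : ℂ → ℝ) (z : ℂ) : ℝ := rhoMass⁻¹ * pot volume (ext F) theta 1 z

/-- Single layer potential of a charge on the top of the strip. -/
noncomputable def topPot (g : ℝ → ℝ) (z : ℂ) : ℝ := jump⁻¹ * pot line (onRe g) theta 1 z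

/-- The smooth defect of the volume potential. -/
noncomputable def volDef (F : ℂ → ℝ) (z : ℂ) : ℝ := rhoMass⁻¹ * avg volume (ext F) rho 1 z

/-- The smooth defect of the single layer potential. -/
noncomputable def topDef (g : ℝ → ℝ) (z : ℂ) : ℝ := jump⁻¹ * avg line (onRe g) rho 1 z

lemma coef_rho_pos {κ l : ℝ} (hl : 0 < l) (hl' : l < Real.pi / 2) : 0 < coef κ l rho 1 :=
  coef_pos contDiff_rho.continuous suppHalf_rho rho_nonneg (by simp [rho, bump]) hl hl'
    ⟨one_pos, le_rfl⟩

lemma rhoMass_pos : 0 < rhoMass := by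
  have hl : (1 : ℝ) < Real.pi / 2 := by linarith [Real.pi_gt_three]
  exact (coef_rho_pos (κ := 0) one_pos hl).trans (coef_rho_lt (by simp) hl)

variable {F F' : ℂ → ℝ} {g g' : ℝ → ℝ} {M M' : ℝ}

lemma contDiff_volPot (hF : Measurable F) (hM : ∀ w, |F w| ≤ M) : ContDiff ℝ 1 (volPot F) :=
  contDiff_const.mul (contDiff_pot_volume (measurable_ext hF) (abs_ext_le_of_bound hM))

lemma continuous_topPot (hg : Measurable g) (hM : ∀ x, |g x| ≤ M) : Continuous (topPot g) :=
  continuous_const.mul (continuous_pot_line hg hM)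

lemma locallyIntegrable_ext (hF : Measurable F) (hM : ∀ w, |F w| ≤ M) :
    LocallyIntegrable (ext F) volume :=
  locallyIntegrable_of_bounded (measurable_ext hF) (abs_ext_le_of_bound hM)

lemma contDiff_avg_rho {ν : Measure ℂ} {f : ℂ → ℝ} (hf : LocallyIntegrable f ν) :
    ContDiff ℝ 1 (avg ν f rho 1) := by
  rw [contDiff_one_iff_fderiv]
  have h := fun z => hasFDerivAt_avg hf contDiff_rho suppHalf_rho one_pos z
  refine ⟨fun z => (h z).differentiableAt, ?_⟩
  rw [funext fun z => (h z).fderiv]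
  exact (continuous_avg hf (contDiff_rho.continuous_fderiv (by norm_num)) suppHalf_rho.fderiv
    one_pos).const_smul (1⁻¹ : ℝ)

lemma contDiff_volDef (hF : Measurable F) (hM : ∀ w, |F w| ≤ M) : ContDiff ℝ 1 (volDef F) :=
  contDiff_const.mul (contDiff_avg_rho (locallyIntegrable_ext hF hM))

lemma contDiff_topDef (hg : Measurable g) (hM : ∀ x, |g x| ≤ M) : ContDiff ℝ 1 (topDef g) :=
  contDiff_const.mul (contDiff_avg_rho (locallyIntegrable_onRe hg hM))

lemma interior_regularity (hF : Measurable F) (hM : ∀ w, |F w| ≤ M) (hg : Measurable g)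
    (hM' : ∀ x, |g x| ≤ M') {z : ℂ} (hz : z ∈ OmegaS) (hh : HoldAt F OmegaS z) :
    ContDiffAt ℝ 2 (fun w => volPot F w + topPot g w) z ∧
      lap (fun w => volPot F w + topPot g w) z = volDef F z + topDef g z - F z := by
  have hext : HoldAt (ext F) univ z := hh.congr_of_nhds (isOpen_OmegaS.mem_nhds hz)
    fun w hw => ⟨hw.2, ext_eq hw.2⟩
  obtain ⟨h1, h2⟩ := pot_volume_regularity (measurable_ext hF) (locallyIntegrable_ext hF hM)
    (fun w _ => abs_ext_le_of_bound hM w) hext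
  obtain ⟨h3, h4⟩ := pot_line_regularity (measurable_onRe hg) (fun w => hM' _) (z₀ := z) hz.2.ne
  have c1 : ContDiffAt ℝ 2 (volPot F) z := contDiffAt_const.mul h1
  have c2 : ContDiffAt ℝ 2 (topPot g) z := contDiffAt_const.mul h3
  refine ⟨c1.add c2, ?_⟩
  have hr := rhoMass_pos.ne'
  rw [lap_add c1 c2]
  unfold volPot topPot
  rw [lap_const_mul h1, lap_const_mul h3, h2, h4, volDef, topDef, ext_eq hz]
  field_simp
  ring

lemma volPot_bottom (x : ℝ) : volPot F ((x : ℂ) - I) = 0 := by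
  rw [volPot, pot_ext_bottom, mul_zero]

lemma topPot_bottom (x : ℝ) : topPot g ((x : ℂ) - I) = 0 := by
  rw [topPot, pot, intervalIntegral.integral_congr_ae (g := fun _ => 0),
    intervalIntegral.integral_zero, mul_zero]
  rw [uIoc_of_le zero_le_one]
  refine Eventually.of_forall fun t ht => ?_
  rw [avg_line_eq_zero suppHalf_theta ht.1 (by simp; linarith [ht.2]), smul_zero]

lemma OmegaS_subset : OmegaS ⊆ {z | z.im < 0} := fun _ h => h.2

lemma tendsto_fderiv_I_top (hF : Measurable F) (hM : ∀ w, |F w| ≤ M) (hg : Measurable g)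
    (hM' : ∀ x, |g x| ≤ M') {x : ℝ} (hc : ContinuousAt g x) :
    Tendsto (fun z => fderiv ℝ (fun w => volPot F w + topPot g w) z I) (𝓝[{z | z.im < 0}] (x : ℂ))
      (𝓝 (g x)) := by
  have h1 : Tendsto (fun z => fderiv ℝ (volPot F) z I) (𝓝[{z | z.im < 0}] (x : ℂ)) (𝓝 0) := by
    have h0 : fderiv ℝ (volPot F) (x : ℂ) I = 0 := by
      unfold volPot
      rw [fderiv_const_mul (hasFDerivAt_pot_volume (measurable_ext hF)
        (abs_ext_le_of_bound hM) _).differentiableAt, smul_apply, fderiv_pot_ext_top hF hM,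
        smul_zero]
    rw [← h0]
    exact (((contDiff_volPot hF hM).continuous_fderiv (by norm_num)).clm_apply
      continuous_const).continuousAt.continuousWithinAt
  have h2 := (tendsto_fderiv_pot_line_I hg hM' hc).const_mul jump⁻¹
  rw [inv_mul_cancel_left₀ jump_pos.ne'] at h2
  have h3 := h1.add h2
  rw [zero_add] at h3
  refine h3.congr' ?_
  filter_upwards [self_mem_nhdsWithin] with z hz
  have d1 := (hasFDerivAt_pot_line hg hM' (ne_of_lt hz : z.im ≠ 0)).differentiableAt
  have d2 : DifferentiableAt ℝ (topPot g) z := d1.const_mul _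
  rw [fderiv_fun_add ((contDiff_volPot hF hM).differentiable (by norm_num) z) d2, add_apply]
  unfold topPot
  rw [fderiv_const_mul d1, smul_apply, smul_eq_mul]

lemma hasDerivWithinAt_top (hF : Measurable F) (hM : ∀ w, |F w| ≤ M) (hg : Measurable g)
    (hM' : ∀ x, |g x| ≤ M') {x : ℝ} (hc : ContinuousAt g x) :
    HasDerivWithinAt (fun y : ℝ => volPot F (x + y * I) + topPot g (x + y * I)) (g x)
      (Iic 0) 0 := by
  set p : ℝ → ℂ := fun y => x + y * I with hp
  have hp' : ∀ y, HasDerivAt p I y := fun y => by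
    have := ((hasDerivAt_id y).ofReal_comp.mul_const I).const_add (x : ℂ)
    rw [ofReal_one, one_mul] at this
    exact this
  have him : ∀ y, (p y).im = y := fun y => by simp [hp]
  have hp0 : p 0 = x := by simp [hp]
  have hd : ∀ y < 0, HasDerivAt (fun y => volPot F (p y) + topPot g (p y))
      (fderiv ℝ (fun w => volPot F w + topPot g w) (p y) I) y := fun y hy => by
    have d2 : DifferentiableAt ℝ (topPot g) (p y) :=
      (hasFDerivAt_pot_line hg hM' (by rw [him]; exact hy.ne)).differentiableAt.const_mul _
    exact (((contDiff_volPot hF hM).differentiable (by norm_num) _).add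
      d2).hasFDerivAt.comp_hasDerivAt y (hp' y)
  refine hasDerivWithinAt_Iic_of_tendsto_deriv (s := Iio 0)
    (fun y hy => (hd y hy).differentiableAt.differentiableWithinAt) ?_ self_mem_nhdsWithin ?_
  · have : Continuous fun y => volPot F (p y) + topPot g (p y) :=
      ((contDiff_volPot hF hM).continuous.add (continuous_topPot hg hM')).comp
        (by fun_prop : Continuous p)
    exact this.continuousWithinAt
  · have ht : Tendsto p (𝓝[<] 0) (𝓝[{z | z.im < 0}] (x : ℂ)) := by
      refine tendsto_nhdsWithin_iff.2 ⟨?_, ?_⟩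
      · rw [← hp0]; exact (hp' 0).continuousAt.continuousWithinAt
      · filter_upwards [self_mem_nhdsWithin] with y hy
        exact (him y).trans_lt hy
    refine ((tendsto_fderiv_I_top hF hM hg hM' hc).comp ht).congr' ?_
    filter_upwards [self_mem_nhdsWithin] with y hy
    exact (hd y hy).deriv.symm

lemma contDiffOn_closure (hF : Measurable F) (hM : ∀ w, |F w| ≤ M) (hgc : Continuous g)
    (hM' : ∀ x, |g x| ≤ M') (hh : ∀ x : ℝ, HoldAt (onRe g) univ x) :
    ContDiffOn ℝ 1 (fun w => volPot F w + topPot g w) (closure OmegaS) ∧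
      ∀ x : ℝ, fderivWithin ℝ (fun w => volPot F w + topPot g w) (closure OmegaS) (x : ℂ) I =
        g x := by
  have hg := hgc.measurable
  set φ : ℂ → ℝ := fun w => volPot F w + topPot g w with hφ
  have hV := contDiff_volPot hF hM
  have dU : ∀ z : ℂ, z.im ≠ 0 → ContDiffAt ℝ 2 (topPot g) z := fun z hz =>
    contDiffAt_const.mul (pot_line_regularity (measurable_onRe hg) (fun w => hM' _) hz).1
  have dφ : ∀ z : ℂ, z.im ≠ 0 → ContDiffAt ℝ 1 φ z := fun z hz =>
    hV.contDiffAt.add ((dU z hz).of_le (by norm_num))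
  have hlim : ∀ z ∈ closure OmegaS, ∃ L : ℂ →L[ℝ] ℝ, Tendsto (fderiv ℝ φ) (𝓝[OmegaS] z) (𝓝 L) ∧
      (z.im = 0 → L I = g z.re) := by
    intro z hz
    by_cases h0 : z.im = 0
    · have hzx : z = (z.re : ℂ) := by apply Complex.ext <;> simp [h0]
      obtain ⟨a, ha⟩ := tendsto_fderiv_pot_line_one hg hM' (hh z.re)
      have hle : 𝓝[OmegaS] z ≤ 𝓝[{z | z.im < 0}] (z.re : ℂ) := by
        rw [← hzx]; exact nhdsWithin_mono _ OmegaS_subset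
      have hI := (tendsto_fderiv_I_top hF hM hg hM' hgc.continuousAt).mono_left hle
      have h1 : Tendsto (fun w => fderiv ℝ φ w 1) (𝓝[OmegaS] z)
          (𝓝 (fderiv ℝ (volPot F) z 1 + jump⁻¹ * a)) := by
        have hV1 : Tendsto (fun w => fderiv ℝ (volPot F) w 1) (𝓝[OmegaS] z)
            (𝓝 (fderiv ℝ (volPot F) z 1)) :=
          ((hV.continuous_fderiv (by norm_num)).clm_apply
            continuous_const).continuousAt.continuousWithinAt
        refine (hV1.add ((ha.mono_left hle).const_mul jump⁻¹)).congr' ?_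
        filter_upwards [self_mem_nhdsWithin] with w hw
        have d1 := (hasFDerivAt_pot_line hg hM' (hw.2.ne : w.im ≠ 0)).differentiableAt
        have d2 : DifferentiableAt ℝ (topPot g) w := d1.const_mul _
        rw [hφ, fderiv_fun_add (hV.differentiable (by norm_num) w) d2, add_apply]
        unfold topPot
        rw [fderiv_const_mul d1, smul_apply, smul_eq_mul]
      exact ⟨_, tendsto_clm_of_apply h1 hI, fun _ => by simp⟩
    · exact ⟨_, ((dφ z h0).fderiv_right (m := 0) (by norm_num)).continuousAt.continuousWithinAt,
        fun h => absurd h h0⟩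
  choose! L hL hLI using hlim
  obtain ⟨r1, r2⟩ := contDiffOn_closure_of_tendsto (φ := φ) (φ' := L) isOpen_OmegaS convex_OmegaS
    ⟨-(1 / 2 : ℝ) * I, by constructor <;> norm_num⟩
    (fun z hz => ((dφ z hz.2.ne).differentiableAt (by norm_num)).differentiableWithinAt)
    ((hV.continuous.add (continuous_topPot hg hM')).continuousOn) hL
  refine ⟨r1, fun x => ?_⟩
  have hx : (x : ℂ) ∈ closure OmegaS := by rw [closure_OmegaS]; simp
  rw [r2 _ hx, hLI _ hx (by simp), ofReal_re]

lemma holdAt_topPot_real (hg : Measurable g) (hM : ∀ x, |g x| ≤ M) (x : ℝ) :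
    HoldAt (fun w => topPot g (w.re : ℂ)) univ x := by
  obtain ⟨K, hK0, hK⟩ := pot_line_holder hg hM
  refine HoldAt.const_mul (f := fun w => pot line (onRe g) theta 1 (w.re : ℂ)) ?_ _
  refine holdAt_of_le (K := K) (α := 1 / 2) (by norm_num) (by norm_num) (fun y₁ y₂ => ?_) univ
  refine (hK _ _).trans (mul_le_mul_of_nonneg_left ?_ hK0)
  refine Real.rpow_le_rpow (norm_nonneg _) ?_ (by norm_num)
  rw [← ofReal_sub, norm_real, Real.norm_eq_abs, ← sub_re]
  exact abs_re_le_norm _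

lemma abs_pot_le {ν : Measure ℂ} [IsFiniteMeasureOnCompacts ν] {d : ℕ} (hν : Growth ν d)
    (hd : 1 ≤ d) {Φ f : ℂ → ℝ} (hs : SuppHalf Φ) {C : ℝ} (hC : ∀ u, ‖Φ u‖ ≤ C) {z : ℂ}
    (hM : ∀ w, ‖z - w‖ ≤ 1 / 2 → |f w| ≤ M) : |pot ν f Φ 1 z| ≤ M * C := by
  have hM0 : 0 ≤ M := (abs_nonneg _).trans (hM z (by simp))
  have hC0 : 0 ≤ C := (norm_nonneg _).trans (hC 0)
  have := intervalIntegral.norm_integral_le_of_norm_le_const (a := 0) (b := 1) (C := M * C)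
    (f := fun t : ℝ => (t ^ 1)⁻¹ • avg ν f Φ t z) fun t ht => by
      rw [uIoc_of_le zero_le_one] at ht
      have ht0 : 0 < t := ht.1
      rw [pow_one, norm_smul, norm_inv, Real.norm_of_nonneg ht0.le, inv_mul_le_iff₀ ht0]
      refine (norm_avg_le hν hs hC ht0 fun w hw => hM w (hw.trans (by linarith [ht.2]))).trans ?_
      rw [mul_comm t]
      refine mul_le_mul_of_nonneg_left ?_ (by positivity)
      simpa using pow_le_pow_of_le_one ht0.le ht.2 hd
  simpa [pot] using this

lemma abs_avg_rho_le {ν : Measure ℂ} [IsFiniteMeasureOnCompacts ν] {d : ℕ} (hν : Growth ν d)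
    {f : ℂ → ℝ} {C : ℝ} (hC : ∀ u, ‖rho u‖ ≤ C) {z : ℂ}
    (hM : ∀ w, ‖z - w‖ ≤ 1 / 2 → |f w| ≤ M) : |avg ν f rho 1 z| ≤ M * C := by
  simpa using norm_avg_le hν suppHalf_rho hC one_pos hM

lemma pot_add {ν : Measure ℂ} [IsFiniteMeasureOnCompacts ν] [SFinite ν] {d : ℕ} (hν : Growth ν d)
    (hd : 1 ≤ d) {f f' : ℂ → ℝ} (hf : Measurable f) (hM : ∀ w, |f w| ≤ M) (hf' : Measurable f')
    (hM' : ∀ w, |f' w| ≤ M') (z : ℂ) :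
    pot ν (fun w => f w + f' w) theta 1 z = pot ν f theta 1 z + pot ν f' theta 1 z := by
  have hc := contDiff_theta.continuous
  have i : ∀ {f : ℂ → ℝ} {M : ℝ}, Measurable f → (∀ w, |f w| ≤ M) →
      IntervalIntegrable (fun t : ℝ => (t ^ 1)⁻¹ • avg ν f theta t z) volume 0 1 :=
    fun hf hM => (dom_of_growth hν hd hc suppHalf_theta (s := univ)
      fun _ _ w _ => hM w).intervalIntegrable hf hc (mem_univ z)
  rw [pot, pot, pot, ← intervalIntegral.integral_add (i hf hM) (i hf' hM')]
  refine intervalIntegral.integral_congr_ae ?_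
  rw [uIoc_of_le zero_le_one]
  refine Eventually.of_forall fun t ht => ?_
  rw [avg_add (locallyIntegrable_of_bounded hf hM) (locallyIntegrable_of_bounded hf' hM') hc
    suppHalf_theta ht.1, smul_add]

lemma pot_const_mul {ν : Measure ℂ} (a : ℝ) (f : ℂ → ℝ) (z : ℂ) :
    pot ν (fun w => a * f w) theta 1 z = a * pot ν f theta 1 z := by
  simp only [pot, avg_const_mul, ← intervalIntegral.integral_const_mul, smul_eq_mul]
  refine intervalIntegral.integral_congr fun t _ => ?_
  ring

lemma volPot_add (hF : Measurable F) (hM : ∀ w, |F w| ≤ M) (hF' : Measurable F')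
    (hM' : ∀ w, |F' w| ≤ M') (z : ℂ) :
    volPot (fun w => F w + F' w) z = volPot F z + volPot F' z := by
  rw [volPot, funext ext_add, pot_add growth_volume (by norm_num) (measurable_ext hF)
    (abs_ext_le_of_bound hM) (measurable_ext hF') (abs_ext_le_of_bound hM'), mul_add, volPot, volPot]

lemma volPot_const_mul (a : ℝ) (z : ℂ) : volPot (fun w => a * F w) z = a * volPot F z := by
  rw [volPot, funext (ext_const_mul a), pot_const_mul, volPot]; ring

lemma volDef_add (hF : Measurable F) (hM : ∀ w, |F w| ≤ M) (hF' : Measurable F')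
    (hM' : ∀ w, |F' w| ≤ M') (z : ℂ) :
    volDef (fun w => F w + F' w) z = volDef F z + volDef F' z := by
  rw [volDef, funext ext_add, avg_add (locallyIntegrable_ext hF hM) (locallyIntegrable_ext hF' hM')
    contDiff_rho.continuous suppHalf_rho one_pos, mul_add, volDef, volDef]

lemma volDef_const_mul (a : ℝ) (z : ℂ) : volDef (fun w => a * F w) z = a * volDef F z := by
  rw [volDef, funext (ext_const_mul a), avg_const_mul, volDef, smul_eq_mul]; ring

lemma topPot_add (hg : Measurable g) (hM : ∀ x, |g x| ≤ M) (hg' : Measurable g')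
    (hM' : ∀ x, |g' x| ≤ M') (z : ℂ) :
    topPot (fun x => g x + g' x) z = topPot g z + topPot g' z := by
  rw [topPot, show onRe (fun x => g x + g' x) = fun w => onRe g w + onRe g' w from rfl,
    pot_add growth_line le_rfl (measurable_onRe hg) (fun _ => hM _) (measurable_onRe hg')
    (fun _ => hM' _), mul_add, topPot, topPot]

lemma topPot_const_mul (a : ℝ) (z : ℂ) : topPot (fun x => a * g x) z = a * topPot g z := by
  rw [topPot, show onRe (fun x => a * g x) = fun w => a * onRe g w from rfl, pot_const_mul,
    topPot]; ring

lemma topDef_add (hg : Measurable g) (hM : ∀ x, |g x| ≤ M) (hg' : Measurable g')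
    (hM' : ∀ x, |g' x| ≤ M') (z : ℂ) :
    topDef (fun x => g x + g' x) z = topDef g z + topDef g' z := by
  rw [topDef, show onRe (fun x => g x + g' x) = fun w => onRe g w + onRe g' w from rfl,
    avg_add (locallyIntegrable_onRe hg hM) (locallyIntegrable_onRe hg' hM')
    contDiff_rho.continuous suppHalf_rho one_pos, mul_add, topDef, topDef]

lemma topDef_const_mul (a : ℝ) (z : ℂ) : topDef (fun x => a * g x) z = a * topDef g z := by
  rw [topDef, show onRe (fun x => a * g x) = fun w => a * onRe g w from rfl, avg_const_mul,
    topDef, smul_eq_mul]; ring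

end Layers

section Weights

/-- The nearest point of the closed strip. -/
noncomputable def proj (z : ℂ) : ℂ := z.re + (max (-1) (min z.im 0) : ℝ) * I

lemma proj_re (z : ℂ) : (proj z).re = z.re := by simp [proj]

lemma proj_im (z : ℂ) : (proj z).im = max (-1) (min z.im 0) := by simp [proj]

lemma proj_mem (z : ℂ) : proj z ∈ closure OmegaS := by
  rw [closure_OmegaS]
  exact ⟨by simp [proj_im], by simp [proj_im]⟩

lemma proj_eq {z : ℂ} (hz : z ∈ closure OmegaS) : proj z = z := by
  rw [closure_OmegaS] at hz
  apply Complex.ext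
  · exact proj_re z
  · rw [proj_im, min_eq_left hz.2, max_eq_right hz.1]

lemma continuous_proj : Continuous proj := by unfold proj; fun_prop

/-- The horizontal weight. -/
noncomputable def wt (μ x : ℝ) : ℝ := Real.exp (-μ * |x|)

lemma wt_pos (μ x : ℝ) : 0 < wt μ x := Real.exp_pos _

lemma continuous_wt (μ : ℝ) : Continuous (wt μ) := by unfold wt; fun_prop

lemma wt_le_one {μ : ℝ} (hμ : 0 < μ) (x : ℝ) : wt μ x ≤ 1 := by
  rw [wt, Real.exp_le_one_iff]
  nlinarith [abs_nonneg x]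

lemma wt_le_mul_wt {μ : ℝ} (hμ : 0 < μ) {x y : ℝ} (h : |x - y| ≤ 1 / 2) :
    wt μ y ≤ Real.exp (μ / 2) * wt μ x := by
  rw [wt, wt, ← Real.exp_add, Real.exp_le_exp]
  have := (abs_sub_abs_le_abs_sub x y).trans h
  nlinarith

/-- The horizontal part of the wave, cut off outside the closed strip. -/
noncomputable def cutWave (κ l η : ℝ) (z : ℂ) : ℝ := wave κ l η (proj z)

/-- The weight on the strip. -/
noncomputable def weight (μ l η : ℝ) (z : ℂ) : ℝ := wt μ z.re * wave 0 l η (proj z)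

variable {μ κ l η : ℝ}

lemma wave_zero_bounds (hl : 0 < l) (hη : 0 < η) (hlη : l + η < Real.pi / 2) (z : ℂ) :
    Real.sin η ≤ wave 0 l η (proj z) ∧ wave 0 l η (proj z) ≤ 1 := by
  have hz := proj_mem z
  rw [closure_OmegaS] at hz
  obtain ⟨h1, -⟩ := sin_pos_of_strip hl hη hlη hz.1 hz.2
  rw [wave, zero_mul, Real.exp_zero, one_mul]
  exact ⟨h1, Real.sin_le_one _⟩

lemma continuous_weight : Continuous (weight μ l η) :=
  ((continuous_wt μ).comp continuous_re).mul
    ((contDiff_wave (n := 1)).continuous.comp continuous_proj)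

lemma weight_pos (hl : 0 < l) (hη : 0 < η) (hlη : l + η < Real.pi / 2) (z : ℂ) :
    0 < weight μ l η z :=
  mul_pos (wt_pos _ _) (wave_pos hl hη hlη (proj_mem z) 0)

lemma weight_le_wt (hl : 0 < l) (hη : 0 < η) (hlη : l + η < Real.pi / 2) (z : ℂ) :
    weight μ l η z ≤ wt μ z.re :=
  mul_le_of_le_one_right (wt_pos _ _).le (wave_zero_bounds hl hη hlη z).2

lemma wt_le_weight (hl : 0 < l) (hη : 0 < η) (hlη : l + η < Real.pi / 2) (z : ℂ) :
    wt μ z.re ≤ (Real.sin η)⁻¹ * weight μ l η z := by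
  have hs : 0 < Real.sin η := Real.sin_pos_of_pos_of_lt_pi hη (by linarith [Real.pi_pos])
  rw [le_inv_mul_iff₀ hs, mul_comm]
  exact mul_le_mul_of_nonneg_left (wave_zero_bounds hl hη hlη z).1 (wt_pos _ _).le

lemma cutWave_eq (z : ℂ) : cutWave κ l η z = Real.exp (κ * z.re) * wave 0 l η (proj z) := by
  simp [cutWave, wave, proj_re]

lemma weight_le_cutWave (hκ : |κ| = μ) (hl : 0 < l) (hη : 0 < η) (hlη : l + η < Real.pi / 2)
    (z : ℂ) : weight μ l η z ≤ cutWave κ l η z := by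
  rw [cutWave_eq]
  exact mul_le_mul_of_nonneg_right (exp_neg_abs_le hκ _) (wave_pos hl hη hlη (proj_mem z) 0).le

lemma continuous_cutWave : Continuous (cutWave κ l η) :=
  (contDiff_wave (n := 1)).continuous.comp continuous_proj

lemma locallyIntegrable_ext_cutWave (hl : 0 < l) (hη : 0 < η) (hlη : l + η < Real.pi / 2) :
    LocallyIntegrable (ext (cutWave κ l η)) volume := by
  have hc : Continuous fun w : ℂ => Real.exp (κ * w.re) := by fun_prop
  refine hc.locallyIntegrable.mono
    (measurable_ext continuous_cutWave.measurable).aestronglyMeasurable (ae_of_all _ fun w => ?_)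
  rw [Real.norm_eq_abs, Real.norm_of_nonneg (Real.exp_pos _).le]
  refine (abs_ext_le w).trans ?_
  rw [abs_of_pos (show 0 < cutWave κ l η _ from wave_pos hl hη hlη (proj_mem _) κ), cutWave_eq]
  simp only [sub_re, ofReal_re, mul_re, I_re, mul_zero, ofReal_im, I_im, mul_one, sub_zero]
  exact mul_le_of_le_one_right (Real.exp_pos _).le (wave_zero_bounds hl hη hlη _).2

lemma ext_cutWave_le (hl : 0 < l) (hη : 0 < η) (hlη : l + η < Real.pi / 2) {w : ℂ}
    (h1 : -(3 / 2) ≤ w.im) (h2 : w.im ≤ 1 / 2) : ext (cutWave κ l η) w ≤ wave κ l η w := by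
  have hpt : ∀ y : ℝ, -1 ≤ -y → -y ≤ 0 →
      cutWave κ l η (w.re - (y : ℝ) * I) = Real.exp (κ * w.re) * Real.sin (l * (1 - y) + η) := by
    intro y hy hy'
    rw [cutWave, proj_eq (by rw [closure_OmegaS]; simp; constructor <;> linarith)]
    simp [wave, sub_eq_add_neg]
  have he := (Real.exp_pos (κ * w.re)).le
  rcases lt_trichotomy w.im (-1) with h | h | h
  · have e : |1 - abs (w.im + 1)| = 2 + w.im := by
      rw [abs_of_neg (by linarith : w.im + 1 < 0), abs_of_pos (by linarith)]; ring
    rw [ext, e, Real.sign_of_neg (by linarith), hpt _ (by linarith) (by linarith), wave]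
    have hs : 0 ≤ Real.sin η * Real.cos (l * (1 + w.im)) := by
      refine mul_nonneg (Real.sin_pos_of_pos_of_lt_pi hη (by linarith [Real.pi_pos])).le
        (Real.cos_nonneg_of_neg_pi_div_two_le_of_le ?_ ?_)
      · nlinarith
      · nlinarith [Real.pi_pos]
    have e1 : l * (1 - (2 + w.im)) + η = η - l * (1 + w.im) := by ring
    rw [e1, Real.sin_sub, Real.sin_add]
    nlinarith
  · rw [ext, h, neg_add_cancel, Real.sign_zero, zero_mul, wave, h]
    simp only [add_neg_cancel, mul_zero, zero_add]
    exact mul_nonneg he (Real.sin_pos_of_pos_of_lt_pi hη (by linarith [Real.pi_pos])).le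
  · rw [ext, Real.sign_of_pos (by linarith), one_mul, abs_of_pos (by linarith : 0 < w.im + 1)]
    have e : 1 - (w.im + 1) = -w.im := by ring
    rw [e, abs_neg, wave]
    rcases le_total w.im 0 with h0 | h0
    · rw [abs_of_nonpos h0, hpt _ (by linarith) (by linarith), sub_neg_eq_add]
    · rw [abs_of_nonneg h0, hpt _ (by linarith) (by linarith)]
      refine mul_le_mul_of_nonneg_left ?_ he
      have hs : 0 ≤ Real.cos (l + η) * Real.sin (l * w.im) := by
        refine mul_nonneg (Real.cos_nonneg_of_neg_pi_div_two_le_of_le ?_ hlη.le)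
          (Real.sin_nonneg_of_nonneg_of_le_pi ?_ ?_)
        · linarith [Real.pi_pos]
        · positivity
        · nlinarith [Real.pi_pos]
      have e1 : l * (1 - w.im) + η = (l + η) - l * w.im := by ring
      have e2 : l * (1 + w.im) + η = (l + η) + l * w.im := by ring
      rw [e1, e2, Real.sin_sub (l + η), Real.sin_add (l + η) (l * w.im)]
      linarith

lemma avg_rho_mono {ν : Measure ℂ} {f g : ℂ → ℝ} (hf : LocallyIntegrable f ν)
    (hg : LocallyIntegrable g ν) {z : ℂ} (h : ∀ w, ‖z - w‖ ≤ 1 / 2 → f w ≤ g w) :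
    avg ν f rho 1 z ≤ avg ν g rho 1 z := by
  have hc := contDiff_rho.continuous
  refine integral_mono (integrable_avg hf hc suppHalf_rho one_pos z)
    (integrable_avg hg hc suppHalf_rho one_pos z) fun w => ?_
  simp only [inv_one, one_smul, smul_eq_mul]
  rcases le_or_gt ‖z - w‖ (1 / 2) with hw | hw
  · exact mul_le_mul_of_nonneg_right (h w hw) (rho_nonneg _)
  · rw [suppHalf_rho _ hw, mul_zero, mul_zero]

lemma volDef_le (hκ : |κ| = μ) (hμ : 0 < μ) (hl : 0 < l) (hη : 0 < η)
    (hlη : l + η < Real.pi / 2) {F : ℂ → ℝ} {N : ℝ} (hN : 0 ≤ N) (hF : Measurable F)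
    (hFN : ∀ w, |F w| ≤ N * weight μ l η w) {z : ℂ} (hz : z ∈ closure OmegaS) :
    volDef F z ≤ N * (rhoMass⁻¹ * coef κ l rho 1 * wave κ l η z) := by
  have hz' := hz
  rw [closure_OmegaS] at hz'
  have hM : ∀ w, |F w| ≤ N := fun w => (hFN w).trans (mul_le_of_le_one_right hN
    ((weight_le_wt hl hη hlη w).trans (wt_le_one hμ _)))
  have iF := locallyIntegrable_ext hF hM
  have iS := locallyIntegrable_ext_cutWave (κ := κ) hl hη hlη
  have iW : LocallyIntegrable (wave κ l η) volume :=
    (contDiff_wave (n := 1)).continuous.locallyIntegrable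
  have hc := contDiff_rho.continuous
  have iNS : LocallyIntegrable (fun w => N * ext (cutWave κ l η) w) volume := iS.smul N
  have iNF : LocallyIntegrable (fun w => (-1) * ext F w) volume := iF.smul (-1 : ℝ)
  have e : ext (fun w => N * cutWave κ l η w + (-1) * F w) =
      fun w => N * ext (cutWave κ l η) w + (-1) * ext F w := by
    funext w
    rw [ext_add, ext_const_mul, ext_const_mul]
  have h1 : 0 ≤ avg volume (ext fun w => N * cutWave κ l η w + (-1) * F w) rho 1 z := by
    refine avg_ext_rho_nonneg (fun w => ?_) (by rw [e]; exact iNS.add iNF) hz'.1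
    have := (le_abs_self _).trans ((hFN w).trans (mul_le_mul_of_nonneg_left
      (weight_le_cutWave hκ hl hη hlη w) hN))
    linarith
  rw [e, avg_add iNS iNF hc suppHalf_rho one_pos, avg_const_mul, avg_const_mul] at h1
  have h2 : avg volume (ext (cutWave κ l η)) rho 1 z ≤ avg volume (wave κ l η) rho 1 z := by
    refine avg_rho_mono iS iW fun w hw => ?_
    have := abs_le.1 ((abs_im_le_norm _).trans hw)
    rw [sub_im] at this
    exact ext_cutWave_le hl hη hlη (by linarith [hz'.1]) (by linarith [hz'.2])
  rw [avg_wave hc suppHalf_rho rho_conj one_pos] at h2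
  rw [smul_eq_mul, smul_eq_mul] at h1
  rw [volDef, mul_assoc, mul_left_comm]
  refine mul_le_mul_of_nonneg_left ?_ (inv_pos.2 rhoMass_pos).le
  nlinarith [mul_le_mul_of_nonneg_left h2 hN]

/-- The contraction factor of the volume defect in the weighted norm. -/
noncomputable def defFactor (μ l : ℝ) : ℝ :=
  rhoMass⁻¹ * max (coef μ l rho 1) (coef (-μ) l rho 1)

lemma defFactor_lt_one (hμ : 0 < μ) (hμl : μ < l) (hl' : l < Real.pi / 2) :
    defFactor μ l < 1 := by
  rw [defFactor, inv_mul_lt_iff₀ rhoMass_pos, mul_one, max_lt_iff]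
  exact ⟨coef_rho_lt (by rwa [abs_of_pos hμ]) hl', coef_rho_lt (by rwa [abs_neg, abs_of_pos hμ]) hl'⟩

lemma defFactor_nonneg (hl : 0 < l) (hl' : l < Real.pi / 2) : 0 ≤ defFactor μ l :=
  mul_nonneg (inv_pos.2 rhoMass_pos).le ((coef_rho_pos hl hl').le.trans (le_max_left _ _))

lemma abs_volDef_le (hμ : 0 < μ) (hl : 0 < l) (hη : 0 < η)
    (hlη : l + η < Real.pi / 2) {F : ℂ → ℝ} {N : ℝ} (hN : 0 ≤ N) (hF : Measurable F)
    (hFN : ∀ w, |F w| ≤ N * weight μ l η w) {z : ℂ} (hz : z ∈ closure OmegaS) :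
    |volDef F z| ≤ defFactor μ l * N * weight μ l η z := by
  obtain ⟨κ, hκ, hκz, hm⟩ : ∃ κ : ℝ, |κ| = μ ∧ κ * z.re = -μ * |z.re| ∧
      coef κ l rho 1 ≤ max (coef μ l rho 1) (coef (-μ) l rho 1) := by
    rcases le_total 0 z.re with h | h
    · exact ⟨-μ, by rw [abs_neg, abs_of_pos hμ], by rw [abs_of_nonneg h], le_max_right _ _⟩
    · exact ⟨μ, abs_of_pos hμ, by rw [abs_of_nonpos h]; ring, le_max_left _ _⟩
  have hw : wave κ l η z = weight μ l η z := by
    rw [weight, proj_eq hz, wave, wave, hκz, wt, zero_mul, Real.exp_zero, one_mul]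
  have hS := (weight_pos (μ := μ) hl hη hlη z).le
  have hle : N * (rhoMass⁻¹ * coef κ l rho 1 * wave κ l η z) ≤
      defFactor μ l * N * weight μ l η z := by
    rw [hw, defFactor, mul_comm _ N, mul_assoc N]
    have := rhoMass_pos
    gcongr
  have hn : volDef (fun w => (-1) * F w) z ≤ N * (rhoMass⁻¹ * coef κ l rho 1 * wave κ l η z) :=
    volDef_le hκ hμ hl hη hlη hN (hF.const_mul _) (fun w => by simpa using hFN w) hz
  rw [volDef_const_mul] at hn
  rw [abs_le]
  have := volDef_le hκ hμ hl hη hlη hN hF hFN hz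
  constructor <;> linarith

lemma exists_layer_bound (hμ : 0 < μ) : ∃ K : ℝ, 0 ≤ K ∧
    (∀ (F : ℂ → ℝ) (N : ℝ), (∀ w, |F w| ≤ N * wt μ w.re) →
      ∀ z, |volPot F z| ≤ K * N * wt μ z.re) ∧
    (∀ (g : ℝ → ℝ) (N : ℝ), (∀ x, |g x| ≤ N * wt μ x) →
      ∀ z, |topPot g z| ≤ K * N * wt μ z.re ∧ |topDef g z| ≤ K * N * wt μ z.re) := by
  obtain ⟨A, hA0, hA⟩ := suppHalf_theta.exists_bound contDiff_theta.continuous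
  obtain ⟨B, hB0, hB⟩ := suppHalf_rho.exists_bound contDiff_rho.continuous
  have hr := inv_pos.2 rhoMass_pos
  have hj := inv_pos.2 jump_pos
  set E := Real.exp (μ / 2)
  have hE : 0 < E := Real.exp_pos _
  have near : ∀ {N : ℝ} {x y : ℂ}, 0 ≤ N → ‖x - y‖ ≤ 1 / 2 → N * wt μ y.re ≤ N * (E * wt μ x.re) :=
    fun hN h => mul_le_mul_of_nonneg_left (wt_le_mul_wt hμ (by
      rw [← sub_re]; exact (abs_re_le_norm _).trans h)) hN
  have nn : ∀ {N a : ℝ} {x : ℝ}, |a| ≤ N * wt μ x → 0 ≤ N := fun {N a x} h =>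
    nonneg_of_mul_nonneg_left ((abs_nonneg a).trans h) (wt_pos μ x)
  have hK : ∀ {a b c N x : ℝ}, 0 < a → a ≤ rhoMass⁻¹ + jump⁻¹ → b ≤ A + B → 0 ≤ N →
      |c| ≤ N * (E * wt μ x) * b →
      |a * c| ≤ (rhoMass⁻¹ + jump⁻¹) * E * (A + B) * N * wt μ x := by
    intro a b c N x ha ha' hb hN hc
    have hw := wt_pos μ x
    rw [abs_mul, abs_of_pos ha]
    calc a * |c| ≤ (rhoMass⁻¹ + jump⁻¹) * (N * (E * wt μ x) * (A + B)) := by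
          refine mul_le_mul ha' (hc.trans ?_) (abs_nonneg _) (by positivity)
          exact mul_le_mul_of_nonneg_left hb (by positivity)
      _ = _ := by ring
  refine ⟨(rhoMass⁻¹ + jump⁻¹) * E * (A + B), by positivity, fun F N hF z => ?_,
    fun g N hg z => ⟨?_, ?_⟩⟩
  · have hN := nn (hF 0)
    refine hK hr (by linarith) (b := A) (by linarith) hN ?_
    refine abs_pot_le growth_volume (by norm_num) suppHalf_theta hA fun w hw => ?_
    refine (abs_ext_le w).trans ((hF _).trans ?_)
    simp only [sub_re, ofReal_re, mul_re, I_re, mul_zero, ofReal_im, I_im, mul_one, sub_zero]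
    exact near hN hw
  · have hN := nn (hg 0)
    exact hK hj (by linarith) (b := A) (by linarith) hN (abs_pot_le growth_line le_rfl
      suppHalf_theta hA fun w hw => (hg _).trans (near hN hw))
  · have hN := nn (hg 0)
    exact hK hj (by linarith) (b := B) (by linarith) hN (abs_avg_rho_le growth_line hB
      fun w hw => (hg _).trans (near hN hw))

end Weights

section Operators
open BoundedContinuousFunction

lemma exists_clm {α β : Type*} [TopologicalSpace α] [TopologicalSpace β]
    (T : (α →ᵇ ℝ) → β → ℝ) {C : ℝ} (hC : 0 ≤ C)
    (hadd : ∀ B B' x, T (B + B') x = T B x + T B' x) (hsmul : ∀ (a : ℝ) B x, T (a • B) x = a * T B x)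
    (hcont : ∀ B, Continuous (T B)) (hb : ∀ B x, |T B x| ≤ C * ‖B‖) :
    ∃ L : (α →ᵇ ℝ) →L[ℝ] (β →ᵇ ℝ), ‖L‖ ≤ C ∧ ∀ B x, L B x = T B x := by
  refine ⟨LinearMap.mkContinuous
    { toFun := fun B => BoundedContinuousFunction.ofNormedAddCommGroup (T B) (hcont B) (C * ‖B‖)
        (hb B)
      map_add' := fun B B' => by ext x; exact hadd B B' x
      map_smul' := fun a B => by ext x; exact hsmul a B x } C fun B => ?_,
    LinearMap.mkContinuous_norm_le _ hC _, fun B x => rfl⟩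
  exact BoundedContinuousFunction.norm_ofNormedAddCommGroup_le _ (by positivity) (hb B)

lemma exists_inverse_one_sub {Y : Type*} [NormedAddCommGroup Y] [NormedSpace ℝ Y]
    [CompleteSpace Y] {P : Y →L[ℝ] Y} (hP : ‖P‖ < 1) : ∃ N : Y →L[ℝ] Y, ∀ v, N v - P (N v) = v := by
  obtain ⟨u, hu⟩ := isUnit_one_sub_of_norm_lt_one hP
  refine ⟨↑u⁻¹, fun v => ?_⟩
  have : (u : Y →L[ℝ] Y) ((↑u⁻¹ : Y →L[ℝ] Y) v) = v := by
    rw [← mul_apply_eq_comp, Units.mul_inv]; rfl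
  rw [hu] at this
  exact this

lemma exists_solution_of_apriori {Y : Type*} [NormedAddCommGroup Y] [NormedSpace ℝ Y]
    [CompleteSpace Y] (T : Y →L[ℝ] Y) {ω D : ℝ} (hD : 0 ≤ D)
    (h : ∀ θ : ℝ, 0 ≤ θ → θ ≤ 1 → ∀ b, ‖b‖ ≤ D * ‖b - (θ * ω) • T b‖) (y : Y) :
    ∃ b, b - ω • T b = y ∧ ‖b‖ ≤ D * ‖y‖ := by
  set U : ℝ → Y →L[ℝ] Y := fun θ => 1 - (θ * ω) • T with hU
  obtain ⟨n, hn⟩ := exists_nat_gt (D * (|ω| * ‖T‖))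
  have hn0 : (0 : ℝ) < n := lt_of_le_of_lt (by positivity) hn
  have key : ∀ k : ℕ, k ≤ n → IsUnit (U (k / n)) := by
    intro k
    induction k with
    | zero => intro _; simp [hU]
    | succ k ih =>
      intro hk
      obtain ⟨u, hu⟩ := ih (by omega)
      have hinv : ‖(↑u⁻¹ : Y →L[ℝ] Y)‖ ≤ D := by
        refine ContinuousLinearMap.opNorm_le_bound _ hD fun v => ?_
        have hk' : (k : ℝ) / n ≤ 1 := by
          rw [div_le_one hn0]; exact_mod_cast (by omega : k ≤ n)
        refine (h (k / n) (by positivity) hk' _).trans_eq ?_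
        have : (u : Y →L[ℝ] Y) ((↑u⁻¹ : Y →L[ℝ] Y) v) = v := by
          rw [← mul_apply_eq_comp, Units.mul_inv]; rfl
        rw [hu] at this
        exact congrArg (fun x => D * ‖x‖) this
      set A : Y →L[ℝ] Y := ↑u⁻¹ * ((ω / n) • T) with hA
      have hA1 : ‖A‖ < 1 := by
        calc ‖A‖ ≤ D * (|ω| / n * ‖T‖) := by
              refine (norm_mul_le _ _).trans ?_
              refine mul_le_mul hinv ?_ (norm_nonneg _) hD
              rw [norm_smul, Real.norm_eq_abs, abs_div, Nat.abs_cast]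
          _ = D * (|ω| * ‖T‖) / n := by ring
          _ < 1 := by rwa [div_lt_one hn0]
      have e : U ((k + 1 : ℕ) / n) = u * (1 - A) := by
        rw [mul_sub, mul_one, hA, ← mul_assoc, Units.mul_inv, one_mul, hu]
        simp only [hU]
        rw [sub_sub, ← add_smul]
        congr 2
        push_cast
        ring
      rw [e]
      exact u.isUnit.mul (isUnit_one_sub_of_norm_lt_one hA1)
  obtain ⟨u, hu⟩ := key n le_rfl
  rw [div_self hn0.ne'] at hu
  have hb : (↑u⁻¹ : Y →L[ℝ] Y) y - ω • T ((↑u⁻¹ : Y →L[ℝ] Y) y) = y := by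
    have : (u : Y →L[ℝ] Y) ((↑u⁻¹ : Y →L[ℝ] Y) y) = y := by
      rw [← mul_apply_eq_comp, Units.mul_inv]; rfl
    rw [hu] at this
    simpa [hU] using this
  refine ⟨_, hb, ?_⟩
  have := h 1 zero_le_one le_rfl ((↑u⁻¹ : Y →L[ℝ] Y) y)
  rwa [one_mul, hb] at this

variable {μ l η : ℝ}

/-- The charge with weighted density `B`. -/
noncomputable def charge (μ l η : ℝ) (B : ℂ →ᵇ ℝ) (w : ℂ) : ℝ := weight μ l η w * B w

/-- The charge on the top with weighted density `b`. -/
noncomputable def topCharge (μ : ℝ) (b : ℝ →ᵇ ℝ) (x : ℝ) : ℝ := wt μ x * b x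

lemma measurable_charge (B : ℂ →ᵇ ℝ) : Measurable (charge μ l η B) :=
  (continuous_weight.mul B.continuous).measurable

lemma continuous_topCharge (b : ℝ →ᵇ ℝ) : Continuous (topCharge μ b) :=
  (continuous_wt μ).mul b.continuous

lemma measurable_topCharge (b : ℝ →ᵇ ℝ) : Measurable (topCharge μ b) :=
  (continuous_topCharge b).measurable

lemma abs_charge_le (hl : 0 < l) (hη : 0 < η) (hlη : l + η < Real.pi / 2) (B : ℂ →ᵇ ℝ) (w : ℂ) :
    |charge μ l η B w| ≤ ‖B‖ * weight μ l η w := by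
  have := weight_pos (μ := μ) hl hη hlη w
  rw [charge, abs_mul, abs_of_pos this, mul_comm]
  exact mul_le_mul_of_nonneg_right (B.norm_coe_le_norm w) this.le

lemma abs_charge_le_wt (hl : 0 < l) (hη : 0 < η) (hlη : l + η < Real.pi / 2) (B : ℂ →ᵇ ℝ)
    (w : ℂ) : |charge μ l η B w| ≤ ‖B‖ * wt μ w.re :=
  (abs_charge_le hl hη hlη B w).trans
    (mul_le_mul_of_nonneg_left (weight_le_wt hl hη hlη w) (norm_nonneg _))

lemma abs_charge_le_norm (hμ : 0 < μ) (hl : 0 < l) (hη : 0 < η) (hlη : l + η < Real.pi / 2)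
    (B : ℂ →ᵇ ℝ) (w : ℂ) : |charge μ l η B w| ≤ ‖B‖ :=
  (abs_charge_le_wt hl hη hlη B w).trans (mul_le_of_le_one_right (norm_nonneg _) (wt_le_one hμ _))

lemma abs_topCharge_le (b : ℝ →ᵇ ℝ) (x : ℝ) : |topCharge μ b x| ≤ ‖b‖ * wt μ x := by
  rw [topCharge, abs_mul, abs_of_pos (wt_pos _ _), mul_comm]
  exact mul_le_mul_of_nonneg_right (b.norm_coe_le_norm x) (wt_pos _ _).le

lemma abs_topCharge_le_norm (hμ : 0 < μ) (b : ℝ →ᵇ ℝ) (x : ℝ) : |topCharge μ b x| ≤ ‖b‖ :=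
  (abs_topCharge_le b x).trans (mul_le_of_le_one_right (norm_nonneg _) (wt_le_one hμ _))

lemma charge_add (B B' : ℂ →ᵇ ℝ) :
    charge μ l η (B + B') = fun w => charge μ l η B w + charge μ l η B' w := by
  funext w; simp [charge, mul_add]

lemma charge_smul (a : ℝ) (B : ℂ →ᵇ ℝ) :
    charge μ l η (a • B) = fun w => a * charge μ l η B w := by
  funext w; simp [charge]; ring

lemma topCharge_add (b b' : ℝ →ᵇ ℝ) :
    topCharge μ (b + b') = fun x => topCharge μ b x + topCharge μ b' x := by
  funext x; simp [topCharge, mul_add]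

lemma topCharge_smul (a : ℝ) (b : ℝ →ᵇ ℝ) :
    topCharge μ (a • b) = fun x => a * topCharge μ b x := by
  funext x; simp [topCharge]; ring

lemma exists_operators (hμ : 0 < μ) (hμl : μ < l) (hη : 0 < η) (hlη : l + η < Real.pi / 2) :
    ∃ (N : (ℂ →ᵇ ℝ) →L[ℝ] (ℂ →ᵇ ℝ)) (Q : (ℝ →ᵇ ℝ) →L[ℝ] (ℂ →ᵇ ℝ))
      (R₁ : (ℂ →ᵇ ℝ) →L[ℝ] (ℝ →ᵇ ℝ)) (R₂ : (ℝ →ᵇ ℝ) →L[ℝ] (ℝ →ᵇ ℝ)),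
      (∀ A b, ∀ z ∈ closure OmegaS, charge μ l η (N (A + Q b)) z = charge μ l η A z +
        (volDef (charge μ l η (N (A + Q b))) z + topDef (topCharge μ b) z)) ∧
      (∀ B (x : ℝ), wt μ x * R₁ B x = volPot (charge μ l η B) x) ∧
      (∀ b (x : ℝ), wt μ x * R₂ b x = topPot (topCharge μ b) x) := by
  have hl := hμ.trans hμl
  have hl' : l < Real.pi / 2 := by linarith
  obtain ⟨K, hK, hV, hT⟩ := exists_layer_bound hμ
  have hs : 0 < Real.sin η := Real.sin_pos_of_pos_of_lt_pi hη (by linarith [Real.pi_pos])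
  have wp := weight_pos (μ := μ) hl hη hlη
  have mB := fun B => measurable_charge (μ := μ) (l := l) (η := η) B
  have aB := fun B => abs_charge_le_norm (μ := μ) hμ hl hη hlη B
  have mb := fun b => measurable_topCharge (μ := μ) b
  have ab := fun b => abs_topCharge_le_norm hμ b
  have cw : Continuous fun z => weight μ l η (proj z) := continuous_weight.comp continuous_proj
  have cr : Continuous fun x : ℝ => (x : ℂ) := continuous_ofReal
  obtain ⟨P, hP, hPe⟩ := exists_clm (fun (B : ℂ →ᵇ ℝ) z =>
    volDef (charge μ l η B) (proj z) / weight μ l η (proj z)) (C := defFactor μ l)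
    (defFactor_nonneg hl hl')
    (fun B B' z => by simp only [charge_add, volDef_add (mB B) (aB B) (mB B') (aB B'), add_div])
    (fun a B z => by simp only [charge_smul, volDef_const_mul, mul_div_assoc])
    (fun B => ((contDiff_volDef (mB B) (aB B)).continuous.comp continuous_proj).div cw
      fun z => (wp _).ne')
    (fun B z => by
      rw [abs_div, abs_of_pos (wp _), div_le_iff₀ (wp _)]
      exact abs_volDef_le hμ hl hη hlη (norm_nonneg _) (mB B) (abs_charge_le hl hη hlη B)
        (proj_mem z))
  obtain ⟨Q, -, hQe⟩ := exists_clm (fun (b : ℝ →ᵇ ℝ) z =>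
    topDef (topCharge μ b) (proj z) / weight μ l η (proj z)) (C := K * (Real.sin η)⁻¹)
    (by positivity)
    (fun b b' z => by simp only [topCharge_add, topDef_add (mb b) (ab b) (mb b') (ab b'), add_div])
    (fun a b z => by simp only [topCharge_smul, topDef_const_mul, mul_div_assoc])
    (fun b => ((contDiff_topDef (mb b) (ab b)).continuous.comp continuous_proj).div cw
      fun z => (wp _).ne')
    (fun b z => by
      rw [abs_div, abs_of_pos (wp _), div_le_iff₀ (wp _)]
      refine ((hT _ _ (abs_topCharge_le b) _).2.trans (mul_le_mul_of_nonneg_left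
        (wt_le_weight hl hη hlη _) (by positivity))).trans_eq (by ring))
  obtain ⟨R₁, -, hR₁⟩ := exists_clm (fun (B : ℂ →ᵇ ℝ) (x : ℝ) =>
    volPot (charge μ l η B) x / wt μ x) hK
    (fun B B' z => by simp only [charge_add, volPot_add (mB B) (aB B) (mB B') (aB B'), add_div])
    (fun a B z => by simp only [charge_smul, volPot_const_mul, mul_div_assoc])
    (fun B => ((contDiff_volPot (mB B) (aB B)).continuous.comp cr).div (continuous_wt μ)
      fun z => (wt_pos _ _).ne')
    (fun B x => by
      rw [abs_div, abs_of_pos (wt_pos _ _), div_le_iff₀ (wt_pos _ _)]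
      exact hV _ _ (abs_charge_le_wt hl hη hlη B) x)
  obtain ⟨R₂, -, hR₂⟩ := exists_clm (fun (b : ℝ →ᵇ ℝ) (x : ℝ) =>
    topPot (topCharge μ b) x / wt μ x) hK
    (fun b b' z => by simp only [topCharge_add, topPot_add (mb b) (ab b) (mb b') (ab b'), add_div])
    (fun a b z => by simp only [topCharge_smul, topPot_const_mul, mul_div_assoc])
    (fun b => ((continuous_topPot (mb b) (ab b)).comp cr).div (continuous_wt μ)
      fun z => (wt_pos _ _).ne')
    (fun b x => by
      rw [abs_div, abs_of_pos (wt_pos _ _), div_le_iff₀ (wt_pos _ _)]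
      exact (hT _ _ (abs_topCharge_le b) x).1)
  have hP1 : ‖P‖ < 1 := hP.trans_lt (defFactor_lt_one hμ hμl hl')
  obtain ⟨N, hN⟩ := exists_inverse_one_sub hP1
  refine ⟨N, Q, R₁, R₂, fun A b z hz => ?_, fun B x => ?_, fun b x => ?_⟩
  · set B := N (A + Q b)
    have h1 : B - P B = A + Q b := hN _
    have h2 : B z = A z + (volDef (charge μ l η B) z / weight μ l η z +
        topDef (topCharge μ b) z / weight μ l η z) := by
      have := congrArg (fun f : ℂ →ᵇ ℝ => f z) h1
      simp only [BoundedContinuousFunction.sub_apply, BoundedContinuousFunction.add_apply, hPe, hQe,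
        proj_eq hz] at this
      linarith
    rw [charge, h2, charge]
    have := (wp z).ne'
    field_simp
  · rw [hR₁, mul_div_cancel₀ _ (wt_pos _ _).ne']
  · rw [hR₂, mul_div_cancel₀ _ (wt_pos _ _).ne']

end Operators

section Solution
open BoundedContinuousFunction

lemma exists_parameters {ω μ : ℝ} (hμ0 : 0 < μ) (hμπ : μ < Real.pi / 2)
    (hμ : ω < μ / Real.tan μ) : ∃ l η c : ℝ, μ < l ∧ 0 < η ∧ l + η < Real.pi / 2 ∧ 0 < c ∧
      ∀ θ, 0 ≤ θ → θ ≤ 1 → c ≤ l * Real.cos (l + η) - θ * ω * Real.sin (l + η) := by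
  have hcos : 0 < Real.cos μ := Real.cos_pos_of_mem_Ioo ⟨by linarith, hμπ⟩
  have hsin : 0 < Real.sin μ := Real.sin_pos_of_pos_of_lt_pi hμ0 (by linarith)
  have h0 : 0 < μ * Real.cos μ - ω * Real.sin μ := by
    rw [Real.tan_eq_sin_div_cos, div_div_eq_mul_div, lt_div_iff₀ hsin] at hμ
    linarith
  have c1 : Continuous fun δ : ℝ =>
      (μ + δ) * Real.cos (μ + δ + δ) - ω * Real.sin (μ + δ + δ) := by fun_prop
  have c2 : Continuous fun δ : ℝ => μ + δ + δ := by fun_prop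
  have e1 : ∀ᶠ δ in 𝓝[>] (0 : ℝ), 0 < (μ + δ) * Real.cos (μ + δ + δ) - ω * Real.sin (μ + δ + δ) :=
    nhdsWithin_le_nhds ((c1.tendsto 0).eventually_const_lt (by simpa using h0))
  have e2 : ∀ᶠ δ in 𝓝[>] (0 : ℝ), μ + δ + δ < Real.pi / 2 :=
    nhdsWithin_le_nhds ((c2.tendsto 0).eventually_lt_const (by simpa using hμπ))
  obtain ⟨δ, h1, h2, h3⟩ := (e1.and (e2.and self_mem_nhdsWithin)).exists
  replace h3 : 0 < δ := h3
  have h4 : 0 < (μ + δ) * Real.cos (μ + δ + δ) :=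
    mul_pos (by linarith) (Real.cos_pos_of_mem_Ioo ⟨by linarith, h2⟩)
  refine ⟨μ + δ, δ, min ((μ + δ) * Real.cos (μ + δ + δ))
    ((μ + δ) * Real.cos (μ + δ + δ) - ω * Real.sin (μ + δ + δ)), by linarith, h3, h2,
    lt_min h4 h1, fun θ hθ hθ' => ?_⟩
  have m1 := mul_le_mul_of_nonneg_left (min_le_left ((μ + δ) * Real.cos (μ + δ + δ))
    ((μ + δ) * Real.cos (μ + δ + δ) - ω * Real.sin (μ + δ + δ))) (sub_nonneg.2 hθ')
  have m2 := mul_le_mul_of_nonneg_left (min_le_right ((μ + δ) * Real.cos (μ + δ + δ))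
    ((μ + δ) * Real.cos (μ + δ + δ) - ω * Real.sin (μ + δ + δ))) hθ
  linarith

variable {μ l η : ℝ}

/-- The potential of a pair of weighted densities. -/
noncomputable def sol (μ l η : ℝ) (B : ℂ →ᵇ ℝ) (b : ℝ →ᵇ ℝ) (w : ℂ) : ℝ :=
  volPot (charge μ l η B) w + topPot (topCharge μ b) w

lemma continuous_sol (hμ : 0 < μ) (hl : 0 < l) (hη : 0 < η) (hlη : l + η < Real.pi / 2)
    (B : ℂ →ᵇ ℝ) (b : ℝ →ᵇ ℝ) : Continuous (sol μ l η B b) :=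
  (contDiff_volPot (measurable_charge B) (abs_charge_le_norm hμ hl hη hlη B)).continuous.add
    (continuous_topPot (measurable_topCharge b) (abs_topCharge_le_norm hμ b))

lemma sol_bottom (B : ℂ →ᵇ ℝ) (b : ℝ →ᵇ ℝ) (x : ℝ) : sol μ l η B b ((x : ℂ) - I) = 0 := by
  rw [sol, volPot_bottom, topPot_bottom, add_zero]

lemma sol_regularity (hμ : 0 < μ) (hl : 0 < l) (hη : 0 < η) (hlη : l + η < Real.pi / 2)
    {B : ℂ →ᵇ ℝ} {b : ℝ →ᵇ ℝ} {f : ℂ → ℝ} {z : ℂ} (hz : z ∈ OmegaS) (hf : HoldAt f OmegaS z)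
    (h : ∀ z ∈ closure OmegaS, charge μ l η B z =
      f z + (volDef (charge μ l η B) z + topDef (topCharge μ b) z)) :
    ContDiffAt ℝ 2 (sol μ l η B b) z ∧ lap (sol μ l η B b) z = -f z := by
  have mB := measurable_charge (μ := μ) (l := l) (η := η) B
  have aB := abs_charge_le_norm hμ hl hη hlη B
  have mb := measurable_topCharge (μ := μ) b
  have ab := abs_topCharge_le_norm hμ b
  have hh : HoldAt (charge μ l η B) OmegaS z :=
    (hf.add (holdAt_of_contDiffAt ((contDiff_volDef mB aB).add
      (contDiff_topDef mb ab)).contDiffAt _)).congr_of_nhds univ_mem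
      fun w hw => ⟨hw.1, h w (subset_closure hw.1)⟩
  obtain ⟨h1, h2⟩ := interior_regularity mB aB mb ab hz hh
  refine ⟨h1, h2.trans ?_⟩
  rw [h z (subset_closure hz)]
  ring

lemma exists_sol_bound (hμ : 0 < μ) (hl : 0 < l) (hη : 0 < η) (hlη : l + η < Real.pi / 2) :
    ∃ K : ℝ, 0 ≤ K ∧ ∀ B b z, |sol μ l η B b z| ≤ K * (‖B‖ + ‖b‖) * wt μ z.re := by
  obtain ⟨K, hK, hV, hT⟩ := exists_layer_bound hμ
  refine ⟨K, hK, fun B b z => (abs_add_le _ _).trans ?_⟩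
  have h1 := hV _ _ (abs_charge_le_wt (μ := μ) hl hη hlη B) z
  have h2 := (hT _ _ (abs_topCharge_le (μ := μ) b) z).1
  linarith

lemma sol_top_le (hμ : 0 < μ) (hμl : μ < l) (hη : 0 < η) (hlη : l + η < Real.pi / 2) {τ c H : ℝ}
    (hc : 0 < c) (hτ : c ≤ l * Real.cos (l + η) - τ * Real.sin (l + η)) (hH : 0 ≤ H)
    {B : ℂ →ᵇ ℝ} {b : ℝ →ᵇ ℝ} (h : ∀ z ∈ closure OmegaS, charge μ l η B z =
      volDef (charge μ l η B) z + topDef (topCharge μ b) z)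
    (hg : ∀ x : ℝ, topCharge μ b x - τ * sol μ l η B b x ≤ H * wt μ x) (x : ℝ) :
    sol μ l η B b x ≤ H / c * wt μ x := by
  have hl := hμ.trans hμl
  obtain ⟨K, -, hK⟩ := exists_sol_bound hμ hl hη hlη
  have hr : ∀ z ∈ OmegaS, ContDiffAt ℝ 2 (sol μ l η B b) z ∧ lap (sol μ l η B b) z = -0 :=
    fun z hz => sol_regularity hμ hl hη hlη hz (f := fun _ => 0)
      (holdAt_of_contDiffAt contDiffAt_const _) fun z hz => by rw [zero_add]; exact h z hz
  have hx : (x : ℂ) ∈ closure OmegaS := by rw [closure_OmegaS]; simp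
  refine le_exp_of_harmonic (g := topCharge μ b) hμ hμl hη hlη hc hτ hH
    (continuous_sol hμ hl hη hlη B b).continuousOn (fun z hz => (hr z hz).1)
    (fun z hz => (hr z hz).2.trans neg_zero) (sol_bottom B b) (fun z _ => hK B b z) (fun x => ?_)
    hg hx
  exact hasDerivWithinAt_top (measurable_charge B) (abs_charge_le_norm hμ hl hη hlη B)
    (measurable_topCharge b) (abs_topCharge_le_norm hμ b) (continuous_topCharge b).continuousAt

/-- Solvability of the integral equations for the densities, with bounds. -/
lemma exists_densities {ω c : ℝ} (hμ : 0 < μ) (hμl : μ < l) (hη : 0 < η)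
    (hlη : l + η < Real.pi / 2) (hc : 0 < c)
    (hτ : ∀ θ, 0 ≤ θ → θ ≤ 1 → c ≤ l * Real.cos (l + η) - θ * ω * Real.sin (l + η)) :
    ∃ D : ℝ, 0 ≤ D ∧ ∀ (A : ℂ →ᵇ ℝ) (a : ℝ →ᵇ ℝ), ∃ (B : ℂ →ᵇ ℝ) (b : ℝ →ᵇ ℝ),
      (∀ z ∈ closure OmegaS, charge μ l η B z = charge μ l η A z +
        (volDef (charge μ l η B) z + topDef (topCharge μ b) z)) ∧
      (∀ x : ℝ, topCharge μ b x = topCharge μ a x + ω * sol μ l η B b x) ∧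
      ‖B‖ + ‖b‖ ≤ D * (‖A‖ + ‖a‖) := by
  obtain ⟨N, Q, R₁, R₂, hN, hR₁, hR₂⟩ := exists_operators hμ hμl hη hlη
  set T : (ℝ →ᵇ ℝ) →L[ℝ] (ℝ →ᵇ ℝ) := R₁ ∘L N ∘L Q + R₂ with hT
  have hTe : ∀ b, T b = R₁ (N (Q b)) + R₂ b := fun b => rfl
  have hTs : ∀ b (x : ℝ), wt μ x * T b x = sol μ l η (N (Q b)) b x := fun b x => by
    rw [hTe, BoundedContinuousFunction.add_apply, mul_add, hR₁, hR₂, sol]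
  have hN0 : ∀ b, ∀ z ∈ closure OmegaS, charge μ l η (N (Q b)) z =
      volDef (charge μ l η (N (Q b))) z + topDef (topCharge μ b) z := fun b z hz => by
    have := hN 0 b z hz
    rw [zero_add] at this
    rw [this]
    simp [charge]
  have hone : ∀ θ, 0 ≤ θ → θ ≤ 1 → ∀ b (x : ℝ),
      T b x ≤ ‖b - (θ * ω) • T b‖ / c := fun θ h0 h1 b x => by
    have := sol_top_le hμ hμl hη hlη hc (hτ θ h0 h1) (norm_nonneg (b - (θ * ω) • T b)) (hN0 b)
      (fun x => by
        have hx := (le_abs_self _).trans ((b - (θ * ω) • T b).norm_coe_le_norm x)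
        rw [← hTs, topCharge, ← mul_left_comm, ← mul_sub, mul_comm]
        exact mul_le_mul_of_nonneg_right hx (wt_pos _ _).le) x
    rw [← hTs, mul_comm] at this
    exact le_of_mul_le_mul_right this (wt_pos μ x)
  have hap : ∀ θ : ℝ, 0 ≤ θ → θ ≤ 1 → ∀ b, ‖b‖ ≤ (1 + |ω| / c) * ‖b - (θ * ω) • T b‖ := by
    intro θ h0 h1 b
    set H := ‖b - (θ * ω) • T b‖ with hH
    have hTb : ‖T b‖ ≤ H / c := by
      refine (norm_le (by positivity)).2 fun x => abs_le.2 ⟨?_, hone θ h0 h1 b x⟩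
      have := hone θ h0 h1 (-b) x
      rw [map_neg, smul_neg, sub_neg_eq_add, neg_add_eq_sub, norm_sub_rev, ← hH,
        BoundedContinuousFunction.neg_apply] at this
      linarith
    calc ‖b‖ = ‖(b - (θ * ω) • T b) + (θ * ω) • T b‖ := by rw [sub_add_cancel]
      _ ≤ H + |ω| * (H / c) := by
        refine (norm_add_le _ _).trans (add_le_add le_rfl ?_)
        rw [norm_smul, Real.norm_eq_abs, abs_mul, abs_of_nonneg h0]
        exact mul_le_mul (mul_le_of_le_one_left (abs_nonneg _) h1) hTb (norm_nonneg _)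
          (abs_nonneg _)
      _ = _ := by ring
  set D := 1 + |ω| / c
  have hD : 0 ≤ D := by positivity
  set β := D * (1 + |ω| * (‖R₁‖ * ‖N‖)) with hβ
  refine ⟨‖N‖ * (1 + ‖Q‖ * β) + β, by positivity, fun A a => ?_⟩
  obtain ⟨b, hb, hbn⟩ := exists_solution_of_apriori T hD hap (a + ω • R₁ (N A))
  have hb' : ‖b‖ ≤ β * (‖A‖ + ‖a‖) := by
    refine hbn.trans ?_
    rw [hβ, mul_assoc]
    refine mul_le_mul_of_nonneg_left ?_ hD
    refine (norm_add_le _ _).trans ?_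
    rw [norm_smul, Real.norm_eq_abs]
    have h1 : ‖R₁ (N A)‖ ≤ ‖R₁‖ * ‖N‖ * ‖A‖ := by
      rw [mul_assoc]
      exact (R₁.le_opNorm _).trans (mul_le_mul_of_nonneg_left (N.le_opNorm _) (norm_nonneg _))
    have h2 := mul_le_mul_of_nonneg_left h1 (abs_nonneg ω)
    have h3 : 0 ≤ |ω| * (‖R₁‖ * ‖N‖) * ‖a‖ := by positivity
    nlinarith [norm_nonneg A]
  refine ⟨N (A + Q b), b, hN A b, fun x => ?_, ?_⟩
  · have h1 : b = a + ω • (R₁ (N (A + Q b)) + R₂ b) := by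
      rw [sub_eq_iff_eq_add] at hb
      rw [hTe] at hb
      rw [map_add, map_add, add_assoc, smul_add, ← add_assoc]
      exact hb
    have h2 := congrArg (fun f : ℝ →ᵇ ℝ => f x) h1
    simp only [BoundedContinuousFunction.add_apply, BoundedContinuousFunction.smul_apply,
      smul_eq_mul] at h2
    rw [topCharge, h2, topCharge, sol, ← hR₁, ← hR₂]
    ring
  · have hAq : ‖A + Q b‖ ≤ (1 + ‖Q‖ * β) * (‖A‖ + ‖a‖) := by
      refine (norm_add_le _ _).trans ?_
      have := (Q.le_opNorm b).trans (mul_le_mul_of_nonneg_left hb' (norm_nonneg _))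
      linarith [norm_nonneg a]
    have := (N.le_opNorm (A + Q b)).trans (mul_le_mul_of_nonneg_left hAq (norm_nonneg _))
    linarith

lemma continuousOn_of_holdAt {f : ℂ → ℝ} {s : Set ℂ} (h : ∀ z ∈ s, HoldAt f s z) :
    ContinuousOn f s := by
  intro z hz
  obtain ⟨ε, hε, K, α, hα, -, hK⟩ := h z hz
  refine tendsto_iff_norm_sub_tendsto_zero.2 ?_
  have hc : Tendsto (fun w => K * ‖w - z‖ ^ α) (𝓝[s] z) (𝓝 0) := by
    have : Continuous fun w : ℂ => K * ‖w - z‖ ^ α :=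
      continuous_const.mul ((continuous_id.sub continuous_const).norm.rpow_const
        fun _ => Or.inr hα.le)
    have h0 := (this.tendsto z).mono_left (nhdsWithin_le_nhds (s := s))
    simpa [Real.zero_rpow hα.ne'] using h0
  refine squeeze_zero' (Eventually.of_forall fun _ => norm_nonneg _) ?_ hc
  filter_upwards [self_mem_nhdsWithin, mem_nhdsWithin_of_mem_nhds (ball_mem_nhds z hε)] with w h1 h2
  exact hK w ⟨h1, h2⟩ z ⟨hz, mem_ball_self hε⟩

end Solution

end FlatStrip

open FlatStrip

/-- exponential a priori theory for the linearized problem on the flat strip: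
for `ω < 1` and `μ ∈ (0,π/2)` with `ω < μ/tan μ`, there is `C = C(ω,μ)` such that for every
bounded, locally Hölder `f₁` with `|f₁| ≤ e^{−μ|x₁|}` and every `C¹` function `f₂` with
`|f₂| ≤ e^{−μ|x₁|}`, there is `φ`, `C²` in `Ω^S` and `C¹` up to the closure, with
`−Δφ = f₁` in `Ω^S`, `∂φ/∂x₂ − ωφ = f₂` on `{x₂ = 0}`, `φ = 0` on `{x₂ = −1}` and
`|φ| ≤ C e^{−μ|x₁|}`. -/
theorem statement18 (ω μ : ℝ) (hω : ω < 1) (hμ0 : 0 < μ) (hμπ : μ < Real.pi / 2)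
    (hμ : ω < μ / Real.tan μ) :
    ∃ C : ℝ,
      ∀ f₁ : ℂ → ℝ, ∀ f₂ : ℝ → ℝ,
        (∃ M : ℝ, ∀ z ∈ closure OmegaS, |f₁ z| ≤ M) →
        (∀ z ∈ closure OmegaS, ∃ ε > (0 : ℝ), ∃ K α : ℝ, 0 < α ∧ α ≤ 1 ∧
          ∀ y₁ ∈ closure OmegaS ∩ Metric.ball z ε,
            ∀ y₂ ∈ closure OmegaS ∩ Metric.ball z ε,
              |f₁ y₁ - f₁ y₂| ≤ K * ‖y₁ - y₂‖ ^ α) →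
        (∀ z ∈ closure OmegaS, |f₁ z| ≤ Real.exp (-μ * |z.re|)) →
        ContDiff ℝ 1 f₂ →
        (∀ x : ℝ, |f₂ x| ≤ Real.exp (-μ * |x|)) →
        ∃ φ : ℂ → ℝ,
          ContDiffOn ℝ 2 φ OmegaS ∧
          ContDiffOn ℝ 1 φ (closure OmegaS) ∧
          (∀ z ∈ OmegaS, lap φ z = -f₁ z) ∧
          (∀ x : ℝ, fderivWithin ℝ φ (closure OmegaS) (x : ℂ) Complex.I -
            ω * φ (x : ℂ) = f₂ x) ∧
          (∀ x : ℝ, φ ((x : ℂ) - Complex.I) = 0) ∧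
          (∀ z ∈ OmegaS, |φ z| ≤ C * Real.exp (-μ * |z.re|)) := by
  obtain ⟨l, η, c, hμl, hη, hlη, hc, hτ⟩ := exists_parameters hμ0 hμπ hμ
  have hl := hμ0.trans hμl
  obtain ⟨D, hD, hsolve⟩ := exists_densities hμ0 hμl hη hlη hc hτ
  obtain ⟨K, hK, hbound⟩ := exists_sol_bound hμ0 hl hη hlη
  refine ⟨K * (D * ((Real.sin η)⁻¹ + 1)), fun f₁ f₂ _ hf₁ hf₁e hf₂ hf₂e => ?_⟩
  have hs : 0 < Real.sin η := Real.sin_pos_of_pos_of_lt_pi hη (by linarith [Real.pi_pos])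
  have wp := weight_pos (μ := μ) hl hη hlη
  have hAb : ∀ z, ‖f₁ (proj z) / weight μ l η (proj z)‖ ≤ (Real.sin η)⁻¹ := fun z => by
    rw [Real.norm_eq_abs, abs_div, abs_of_pos (wp _), div_le_iff₀ (wp _)]
    exact (hf₁e _ (proj_mem z)).trans (wt_le_weight hl hη hlη _)
  have hAc : Continuous fun z => f₁ (proj z) / weight μ l η (proj z) :=
    ((continuousOn_of_holdAt hf₁).comp_continuous continuous_proj proj_mem).div
      (continuous_weight.comp continuous_proj) fun z => (wp _).ne'
  have hab : ∀ x, ‖f₂ x / wt μ x‖ ≤ 1 := fun x => by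
    rw [Real.norm_eq_abs, abs_div, abs_of_pos (wt_pos _ _), div_le_one (wt_pos _ _)]
    exact hf₂e x
  have hac : Continuous fun x => f₂ x / wt μ x :=
    hf₂.continuous.div (continuous_wt μ) fun x => (wt_pos _ _).ne'
  obtain ⟨B, b, hB, hb, hBb⟩ := hsolve
    (BoundedContinuousFunction.ofNormedAddCommGroup _ hAc _ hAb)
    (BoundedContinuousFunction.ofNormedAddCommGroup _ hac _ hab)
  have hB' : ∀ z ∈ closure OmegaS, charge μ l η B z =
      f₁ z + (volDef (charge μ l η B) z + topDef (topCharge μ b) z) := fun z hz => by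
    have e : charge μ l η (BoundedContinuousFunction.ofNormedAddCommGroup _ hAc _ hAb) z =
        f₁ z := by
      rw [charge, BoundedContinuousFunction.coe_ofNormedAddCommGroup, proj_eq hz,
        mul_div_cancel₀ _ (wp z).ne']
    rw [hB z hz, e]
  have hb' : ∀ x : ℝ, topCharge μ b x = f₂ x + ω * sol μ l η B b x := fun x => by
    rw [hb x, topCharge, BoundedContinuousFunction.coe_ofNormedAddCommGroup,
      mul_div_cancel₀ _ (wt_pos μ x).ne']
  have mB := measurable_charge (μ := μ) (l := l) (η := η) B
  have aB := abs_charge_le_norm hμ0 hl hη hlη B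
  have mb := measurable_topCharge (μ := μ) b
  have ab := abs_topCharge_le_norm hμ0 b
  have hr : ∀ z ∈ OmegaS, ContDiffAt ℝ 2 (sol μ l η B b) z ∧ lap (sol μ l η B b) z = -f₁ z :=
    fun z hz => by
      obtain ⟨ε, hε, L, α, hα, hα1, h⟩ := hf₁ z (subset_closure hz)
      exact sol_regularity hμ0 hl hη hlη hz ⟨ε, hε, L, α, hα, hα1, fun y₁ h₁ y₂ h₂ =>
        h y₁ ⟨subset_closure h₁.1, h₁.2⟩ y₂ ⟨subset_closure h₂.1, h₂.2⟩⟩ hB'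
  have hhold : ∀ x : ℝ, HoldAt (onRe (topCharge μ b)) univ x := fun x => by
    have hre : ContDiff ℝ 1 fun w : ℂ => w.re := reCLM.contDiff
    have d1 : ContDiff ℝ 1 fun w : ℂ =>
        f₂ w.re + ω * volPot (charge μ l η B) (w.re : ℂ) :=
      (hf₂.comp hre).add (contDiff_const.mul
        ((contDiff_volPot mB aB).comp (ofRealCLM.contDiff.comp hre)))
    refine ((holdAt_of_contDiffAt d1.contDiffAt univ).add
      ((holdAt_topPot_real mb ab x).const_mul ω)).congr_of_nhds Filter.univ_mem
      fun w _ => ⟨mem_univ _, ?_⟩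
    rw [onRe, hb', sol]
    ring
  obtain ⟨r1, r2⟩ := contDiffOn_closure mB aB (continuous_topCharge b) ab hhold
  refine ⟨sol μ l η B b, fun z hz => (hr z hz).1.contDiffWithinAt, r1, fun z hz => (hr z hz).2,
    fun x => ?_, sol_bottom B b, fun z _ => (hbound B b z).trans ?_⟩
  · have := r2 x
    rw [hb'] at this
    exact sub_eq_of_eq_add this
  · refine mul_le_mul_of_nonneg_right (mul_le_mul_of_nonneg_left (hBb.trans
      (mul_le_mul_of_nonneg_left (add_le_add ?_ ?_) hD)) hK) (wt_pos _ _).le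
    · exact BoundedContinuousFunction.norm_ofNormedAddCommGroup_le _ (inv_pos.2 hs).le hAb
    · exact BoundedContinuousFunction.norm_ofNormedAddCommGroup_le _ zero_le_one hab
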